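/- Every non-zero Turing degree that is bounded by a 2-random Turing degree bounds a 1-generic Turing degree. -/

import Mathlib

/-
Common framework: oracle (relative) partial computability via codes,
Turing reducibility, the jump, Cantor-space measure, Martin-Löf randomness
and genericity relative to an oracle, Turing functionals.
-/

open scoped ENNReal

namespace TypicalDegree

/-- Codes for partial functions recursive in an oracle (Kleene-style),
    following `Nat.Partrec.Code` with an extra `oracle` constructor. -/
inductive OracleCode : Type
  | zero : OracleCode
  | succ : OracleCode
  | left : OracleCode
  | right : OracleCode
  | oracle : OracleCode
  | pair : OracleCode → OracleCode → OracleCode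
  | comp : OracleCode → OracleCode → OracleCode
  | prec : OracleCode → OracleCode → OracleCode
  | rfind' : OracleCode → OracleCode

/-- Evaluation of an oracle code relative to an oracle `g : ℕ →. ℕ`. -/
def OracleCode.eval (g : ℕ →. ℕ) : OracleCode → ℕ →. ℕ
  | .zero => pure 0
  | .succ => Nat.succ
  | .left => ↑fun n : ℕ => n.unpair.1
  | .right => ↑fun n : ℕ => n.unpair.2
  | .oracle => g
  | .pair cf cg => fun n => Nat.pair <$> OracleCode.eval g cf n <*> OracleCode.eval g cg n
  | .comp cf cg => fun n => OracleCode.eval g cg n >>= OracleCode.eval g cf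
  | .prec cf cg =>
    Nat.unpaired fun a n =>
      n.rec (OracleCode.eval g cf a) fun y IH => do
        let i ← IH
        OracleCode.eval g cg (Nat.pair a (Nat.pair y i))
  | .rfind' cf =>
    Nat.unpaired fun a m =>
      (Nat.rfind fun n => (fun m => m = 0) <$> OracleCode.eval g cf (Nat.pair a (n + m))).map
        (· + m)

/-- An effective injective numbering of oracle codes. -/
def OracleCode.encodeCode : OracleCode → ℕ
  | .zero => 0
  | .succ => 1
  | .left => 2
  | .right => 3
  | .oracle => 4
  | .pair cf cg => 4 * Nat.pair cf.encodeCode cg.encodeCode + 5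
  | .comp cf cg => 4 * Nat.pair cf.encodeCode cg.encodeCode + 6
  | .prec cf cg => 4 * Nat.pair cf.encodeCode cg.encodeCode + 7
  | .rfind' cf => 4 * Nat.pair cf.encodeCode cf.encodeCode + 8

/-- The characteristic (total) oracle of an element of Cantor space. -/
def chi (X : ℕ → Bool) : ℕ →. ℕ := fun n => Part.some (cond (X n) 1 0)

/-- `f` is partial recursive relative to the oracle `g`. -/
def RedIn (f g : ℕ →. ℕ) : Prop := ∃ c : OracleCode, c.eval g = f

/-- A total function `ℕ → ℕ` viewed as a partial function. -/
def natFun (f : ℕ → ℕ) : ℕ →. ℕ := fun n => Part.some (f n)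

/-- Turing reducibility between elements of Cantor space. -/
def TRed (X Y : ℕ → Bool) : Prop := RedIn (chi X) (chi Y)

/-- Turing equivalence. -/
def TEquiv (X Y : ℕ → Bool) : Prop := TRed X Y ∧ TRed Y X

/-- `X` is computable. -/
def ComputableSeq (X : ℕ → Bool) : Prop := TRed X fun _ => false

/-- `f : ℕ → ℕ` is computable. -/
def ComputableFun (f : ℕ → ℕ) : Prop := RedIn (natFun f) (chi fun _ => false)

/-- The Turing jump of `X`: the halting problem relative to `X`,
    under the numbering `encodeCode`. -/
noncomputable def jump (X : ℕ → Bool) : ℕ → Bool := fun n =>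
  @decide (∃ c : OracleCode, c.encodeCode = n ∧ (c.eval (chi X) n).Dom) (Classical.dec _)

/-- `∅'`, the halting problem. -/
noncomputable def zeroJump : ℕ → Bool := jump fun _ => false

/-- `X` extends the finite binary string `σ` (i.e. `σ ⊂ X`). -/
def extendsStr (X : ℕ → Bool) (σ : List Bool) : Prop :=
  ∀ i : Fin σ.length, X i.1 = σ.get i

/-- `⟦V⟧`: the open set of infinite sequences extending some string in `V`. -/
def openOf (V : Set (List Bool)) : Set (ℕ → Bool) := {X | ∃ σ ∈ V, extendsStr X σ}

/-- The (fair-coin) measure of the open set `⟦V⟧` determined by a set of strings `V`: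
    the supremum over `n` of the proportion of length-`n` strings with a prefix in `V`. -/
noncomputable def stringMeasure (V : Set (List Bool)) : ℝ≥0∞ :=
  ⨆ n : ℕ, (Nat.card {f : Fin n → Bool // ∃ σ ∈ V, σ <+: List.ofFn f} : ℝ≥0∞) / 2 ^ n

/-- The fair-coin (Lebesgue) measure on Cantor space, as the outer measure obtained from
    open coverings by sets of strings; it agrees with Lebesgue measure on measurable sets. -/
noncomputable def cantorMeasure (S : Set (ℕ → Bool)) : ℝ≥0∞ :=
  ⨅ (V : Set (List Bool)) (_ : S ⊆ openOf V), stringMeasure V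

/-- `W` is computably enumerable relative to `X`. -/
def CEIn (X : ℕ → Bool) (W : Set (List Bool)) : Prop :=
  ∃ c : OracleCode, ∀ σ : List Bool, σ ∈ W ↔ (c.eval (chi X) (Encodable.encode σ)).Dom

/-- `W` is computably enumerable. -/
def CE (W : Set (List Bool)) : Prop := CEIn (fun _ => false) W

/-- The c.e. set of strings with index `d`. -/
def ceSetOf (d : OracleCode) : Set (List Bool) :=
  {σ | (d.eval (chi fun _ => false) (Encodable.encode σ)).Dom}

/-- The sequence `V` of sets of strings is uniformly c.e. relative to `X`. -/
def UniformCEIn (X : ℕ → Bool) (V : ℕ → Set (List Bool)) : Prop :=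
  ∃ c : OracleCode, ∀ (i : ℕ) (σ : List Bool),
    σ ∈ V i ↔ (c.eval (chi X) (Nat.pair i (Encodable.encode σ))).Dom

/-- A Martin-Löf test relative to `X`. -/
def MLTest (X : ℕ → Bool) (V : ℕ → Set (List Bool)) : Prop :=
  UniformCEIn X V ∧ ∀ i : ℕ, stringMeasure (V i) < (2 : ℝ≥0∞)⁻¹ ^ i

/-- `Y` is Martin-Löf random relative to `X`. -/
def MLRandomIn (X Y : ℕ → Bool) : Prop :=
  ∀ V : ℕ → Set (List Bool), MLTest X V → ∃ i, Y ∉ openOf (V i)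

/-- `Y` is 1-random. -/
def OneRandom (Y : ℕ → Bool) : Prop := MLRandomIn (fun _ => false) Y

/-- `Y` is 2-random: Martin-Löf random relative to `∅'`. -/
def TwoRandom (Y : ℕ → Bool) : Prop := MLRandomIn zeroJump Y

/-- `Y` is weakly 2-random: it avoids every null `Π⁰₂` class
    (every null intersection of a uniformly c.e. sequence of open sets). -/
def Weak2Random (Y : ℕ → Bool) : Prop :=
  ∀ V : ℕ → Set (List Bool), UniformCEIn (fun _ => false) V →
    cantorMeasure (⋂ i, openOf (V i)) = 0 → Y ∉ ⋂ i, openOf (V i)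

/-- `Y` is 1-generic relative to `X`. -/
def OneGenericIn (X Y : ℕ → Bool) : Prop :=
  ∀ W : Set (List Bool), CEIn X W →
    ∃ σ : List Bool, extendsStr Y σ ∧ (σ ∈ W ∨ ∀ τ : List Bool, σ <+: τ → τ ∉ W)

/-- `Y` is 1-generic. -/
def OneGeneric (Y : ℕ → Bool) : Prop := OneGenericIn (fun _ => false) Y

/-- `Y` is 2-generic: 1-generic relative to `∅'`. -/
def TwoGeneric (Y : ℕ → Bool) : Prop := OneGenericIn zeroJump Y

/-- The Turing functional coded by `c` is total on oracle `X` with value `Y ∈ 2^ω`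
    (i.e. `Ψ^X = Y`). -/
def FTotal (c : OracleCode) (X : ℕ → Bool) (Y : ℕ → Bool) : Prop :=
  c.eval (chi X) = chi Y

/-- `Ψ^X ⊇ σ`: the output of the functional `c` on oracle `X` extends the string `σ`. -/
def FExtends (c : OracleCode) (X : ℕ → Bool) (σ : List Bool) : Prop :=
  ∀ i : Fin σ.length, c.eval (chi X) i.1 = Part.some (cond (σ.get i) 1 0)

/-- `π(Ψ,σ) = μ({X : Ψ^X ⊇ σ})`. -/
noncomputable def piMeasure (c : OracleCode) (σ : List Bool) : ℝ≥0∞ :=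
  cantorMeasure {X | FExtends c X σ}

/-- A Turing functional is special if every infinite binary sequence
    in its range is incomputable. -/
def Special (c : OracleCode) : Prop :=
  ∀ X Y : ℕ → Bool, FTotal c X Y → ¬ ComputableSeq Y

/-- The code `c` computes the total function `T` on strings (no oracle). -/
def ComputesFun (c : OracleCode) (T : List Bool → Bool) : Prop :=
  ∀ σ : List Bool, c.eval (chi fun _ => false) (Encodable.encode σ) = Part.some (cond (T σ) 1 0)

/-- `T` is (the characteristic function of) a tree: closed under prefixes. -/
def IsTree (T : List Bool → Bool) : Prop :=
  ∀ σ τ : List Bool, σ <+: τ → T τ = true → T σ = true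

/-- The set of infinite paths through the tree `T`; `Π⁰₁` classes are the
    sets of paths through computable trees. -/
def pathsOf (T : List Bool → Bool) : Set (ℕ → Bool) :=
  {X | ∀ n : ℕ, T (List.ofFn fun i : Fin n => X i.1) = true}

/-- The computable join `X ⊕ Y`. -/
def join (X Y : ℕ → Bool) : ℕ → Bool := fun n =>
  if n % 2 = 0 then X (n / 2) else Y (n / 2)

/-- A finite string used as a (partial) oracle. -/
def strOracle (τ : List Bool) : ℕ →. ℕ := fun n =>
  if h : n < τ.length then Part.some (cond (τ.get ⟨n, h⟩) 1 0) else Part.none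

/-- `Ψ^{τ₀}` and `Ψ^{τ₁}` are incompatible: they give different outputs somewhere. -/
def SplitPair (c : OracleCode) (τ₀ τ₁ : List Bool) : Prop :=
  ∃ (n v₀ v₁ : ℕ), v₀ ∈ c.eval (strOracle τ₀) n ∧ v₁ ∈ c.eval (strOracle τ₁) n ∧ v₀ ≠ v₁

/-- `(U,V)` is a `Ψ`-splitting above `τ`. -/
def SplittingAbove (c : OracleCode) (τ : List Bool) (U V : Finset (List Bool)) : Prop :=
  (∃ ℓ : ℕ, ∀ σ ∈ U ∪ V, σ.length = ℓ ∧ τ <+: σ) ∧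
    ∀ σ₀ ∈ U, ∀ σ₁ ∈ V, SplitPair c σ₀ σ₁

/-- The output sequence `Ψ^X` of the functional `c` on oracle `X`
    (defaults to `false` when not total). -/
noncomputable def outSeq (c : OracleCode) (X : ℕ → Bool) : ℕ → Bool := fun n =>
  @dite _ (∃ Y : ℕ → Bool, FTotal c X Y) (Classical.dec _) (fun h => h.choose n) fun _ => false

/-- `Ψ^X ↾ n`, as a finite string. -/
noncomputable def outStr (c : OracleCode) (X : ℕ → Bool) (n : ℕ) : List Bool :=
  List.ofFn fun i : Fin n => outSeq c X i.1

/-- The degree of `M` is a minimal Turing degree. -/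
def MinimalDeg (M : ℕ → Bool) : Prop :=
  ¬ ComputableSeq M ∧ ∀ Z : ℕ → Bool, TRed Z M → ComputableSeq Z ∨ TRed M Z


section part1_block

theorem take_pfx {α : Type*} (n : ℕ) (l : List α) : l.take n <+: l := ⟨l.drop n, List.take_append_drop n l⟩

theorem pfx_or_pfx {α : Type*} {l₁ l₂ l₃ : List α} (h₁ : l₁ <+: l₃) (h₂ : l₂ <+: l₃) : l₁ <+: l₂ ∨ l₂ <+: l₁ :=
  List.prefix_or_prefix_of_prefix h₁ h₂


theorem partrec_eval {α : Type} [Primcodable α] (g : α → ℕ →. ℕ) (hg : Partrec₂ g) (c : OracleCode) :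
    Partrec₂ (fun a n => c.eval (g a) n) := by
  induction c with
  | zero => exact (Computable.const 0).partrec
  | succ => exact (Computable.succ.comp Computable.snd).partrec
  | left => exact (Computable.fst.comp (Computable.unpair.comp Computable.snd)).partrec
  | right => exact (Computable.snd.comp (Computable.unpair.comp Computable.snd)).partrec
  | oracle => exact hg
  | pair cf cg hf hg' =>
    have h1 : Partrec (fun p : α × ℕ => (cf.eval (g p.1) p.2).bind
        (fun v => (cg.eval (g p.1) p.2).map (fun w => Nat.pair v w))) := by
      refine Partrec.bind hf ?_
      refine Partrec.map ?_ ?_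
      · exact hg'.comp (Computable.fst.comp Computable.fst) (Computable.snd.comp Computable.fst)
      · exact (Primrec₂.natPair.to_comp.comp
          (Computable.snd.comp Computable.fst) Computable.snd)
    refine h1.of_eq fun p => ?_
    simp [OracleCode.eval, Seq.seq, Part.bind_map]
  | comp cf cg hf hg' =>
    have h1 : Partrec (fun p : α × ℕ => (cg.eval (g p.1) p.2).bind
        (fun v => cf.eval (g p.1) v)) := by
      refine Partrec.bind hg' ?_
      exact hf.comp (Computable.fst.comp Computable.fst) Computable.snd
    exact h1.of_eq fun p => rfl
  | prec cf cg hf hg' =>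
    have h1 := Partrec.nat_rec (α := α × ℕ) (σ := ℕ) (f := fun p => p.2.unpair.2)
      (g := fun p => cf.eval (g p.1) p.2.unpair.1)
      (h := fun p q => cg.eval (g p.1) (Nat.pair p.2.unpair.1 (Nat.pair q.1 q.2)))
      (Computable.snd.comp (Computable.unpair.comp Computable.snd))
      (hf.comp Computable.fst (Computable.fst.comp (Computable.unpair.comp Computable.snd)))
      (hg'.comp (Computable.fst.comp Computable.fst)
        (Primrec₂.natPair.to_comp.comp
          (Computable.fst.comp (Computable.unpair.comp (Computable.snd.comp Computable.fst)))
          (Primrec₂.natPair.to_comp.comp (Computable.fst.comp Computable.snd)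
            (Computable.snd.comp Computable.snd))))
    refine h1.of_eq fun p => ?_
    simp [OracleCode.eval, Nat.unpaired]
  | rfind' cf hf =>
    have h1 := Partrec.rfind (α := α × ℕ)
      (p := fun p n => (cf.eval (g p.1) (Nat.pair p.2.unpair.1 (n + p.2.unpair.2))).map (fun m => decide (m = 0)))
      (Partrec.map (hf.comp (Computable.fst.comp Computable.fst)
        (Primrec₂.natPair.to_comp.comp
          (Computable.fst.comp (Computable.unpair.comp (Computable.snd.comp Computable.fst)))
          (Primrec.nat_add.to_comp.comp Computable.snd
            (Computable.snd.comp (Computable.unpair.comp (Computable.snd.comp Computable.fst))))))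
        ((Primrec.eq.comp Primrec.snd (Primrec.const 0)).decide.to_comp))
    have h2 := Partrec.map h1 (g := fun p m => m + p.2.unpair.2)
      (Primrec.nat_add.to_comp.comp Computable.snd
            (Computable.snd.comp (Computable.unpair.comp (Computable.snd.comp Computable.fst))))
    refine h2.of_eq fun p => ?_
    simp [OracleCode.eval, Nat.unpaired]

theorem mem_comp {g : ℕ →. ℕ} {cf cg : OracleCode} {n v : ℕ} :
    v ∈ (OracleCode.comp cf cg).eval g n ↔ ∃ a ∈ cg.eval g n, v ∈ cf.eval g a := by
  change v ∈ Part.bind _ _ ↔ _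
  exact Part.mem_bind_iff

theorem mem_rfind' {g : ℕ →. ℕ} {cf : OracleCode} {n v : ℕ} :
    v ∈ (OracleCode.rfind' cf).eval g n ↔ ∃ a, (0 ∈ cf.eval g (Nat.pair n.unpair.1 (a + n.unpair.2)) ∧
      ∀ m < a, ∃ b ∈ cf.eval g (Nat.pair n.unpair.1 (m + n.unpair.2)), b ≠ 0) ∧ a + n.unpair.2 = v := by
  change v ∈ Part.map _ (Nat.rfind _) ↔ _
  rw [Part.mem_map_iff]
  refine exists_congr fun a => and_congr_left fun _ => ?_
  refine Iff.trans Nat.mem_rfind ?_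
  refine and_congr ?_ (forall_congr' fun m => forall_congr' fun hm => ?_)
  · change true ∈ Part.map _ _ ↔ _
    simp [Part.mem_map_iff]
  · change false ∈ Part.map _ _ ↔ _
    simp [Part.mem_map_iff]

/-- oracle monotonicity -/
theorem eval_mono {g g' : ℕ →. ℕ} (h : ∀ n v, v ∈ g n → v ∈ g' n) (c : OracleCode) :
    ∀ n v, v ∈ c.eval g n → v ∈ c.eval g' n := by
  induction c with
  | zero => intro n v hv; exact hv
  | succ => intro n v hv; exact hv
  | left => intro n v hv; exact hv
  | right => intro n v hv; exact hv
  | oracle => exact h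
  | pair cf cg hf hg' =>
    intro n v hv
    simp only [OracleCode.eval, Seq.seq, Part.bind_eq_bind, Part.map_eq_map, Part.bind_map, Part.mem_bind_iff, Part.mem_map_iff] at hv ⊢
    obtain ⟨a, ha, b, hb, rfl⟩ := hv
    exact ⟨a, hf _ _ ha, b, hg' _ _ hb, rfl⟩
  | comp cf cg hf hg' =>
    intro n v hv
    simp only [mem_comp] at hv ⊢
    obtain ⟨a, ha, hb⟩ := hv
    exact ⟨a, hg' _ _ ha, hf _ _ hb⟩
  | prec cf cg hf hg' =>
    intro n v hv
    simp only [OracleCode.eval, Nat.unpaired] at hv ⊢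
    generalize n.unpair.2 = m at hv ⊢
    induction m generalizing v with
    | zero => exact hf _ _ hv
    | succ m ih =>
      simp only [Part.bind_eq_bind, Part.mem_bind_iff] at hv ⊢
      obtain ⟨a, ha, hb⟩ := hv
      exact ⟨a, ih _ ha, hg' _ _ hb⟩
  | rfind' cf hf =>
    intro n v hv
    rw [mem_rfind'] at hv ⊢
    obtain ⟨a, ⟨ha, hb⟩, e⟩ := hv
    refine ⟨a, ⟨hf _ _ ha, fun m hm => ?_⟩, e⟩
    obtain ⟨b, hb, e⟩ := hb m hm
    exact ⟨b, hf _ _ hb, e⟩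

/-- use principle, for an increasing chain of oracles -/
theorem eval_use {g : ℕ →. ℕ} {gs : ℕ → ℕ →. ℕ} (hm : ∀ s t, s ≤ t → ∀ n v, v ∈ gs s n → v ∈ gs t n)
    (hu : ∀ n v, v ∈ g n → ∃ s, v ∈ gs s n) (c : OracleCode) :
    ∀ n v, v ∈ c.eval g n → ∃ s, v ∈ c.eval (gs s) n := by
  have mm : ∀ (c : OracleCode) s t, s ≤ t → ∀ n v, v ∈ c.eval (gs s) n → v ∈ c.eval (gs t) n :=
    fun c s t hst => eval_mono (hm s t hst) c
  induction c with
  | zero => intro n v hv; exact ⟨0, hv⟩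
  | succ => intro n v hv; exact ⟨0, hv⟩
  | left => intro n v hv; exact ⟨0, hv⟩
  | right => intro n v hv; exact ⟨0, hv⟩
  | oracle => exact hu
  | pair cf cg hf hg' =>
    intro n v hv
    simp only [OracleCode.eval, Seq.seq, Part.bind_eq_bind, Part.map_eq_map, Part.bind_map, Part.mem_bind_iff, Part.mem_map_iff] at hv ⊢
    obtain ⟨a, ha, b, hb, rfl⟩ := hv
    obtain ⟨s1, h1⟩ := hf _ _ ha
    obtain ⟨s2, h2⟩ := hg' _ _ hb
    exact ⟨max s1 s2, a, mm _ _ _ (le_max_left _ _) _ _ h1, b, mm _ _ _ (le_max_right _ _) _ _ h2, rfl⟩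
  | comp cf cg hf hg' =>
    intro n v hv
    simp only [mem_comp] at hv ⊢
    obtain ⟨a, ha, hb⟩ := hv
    obtain ⟨s1, h1⟩ := hg' _ _ ha
    obtain ⟨s2, h2⟩ := hf _ _ hb
    exact ⟨max s1 s2, a, mm _ _ _ (le_max_left _ _) _ _ h1, mm _ _ _ (le_max_right _ _) _ _ h2⟩
  | prec cf cg hf hg' =>
    intro n v hv
    have key : ∀ s t, s ≤ t → _ := fun s t hst => mm (.prec cf cg) s t hst
    simp only [OracleCode.eval, Nat.unpaired] at hv ⊢
    generalize n.unpair.2 = m at hv ⊢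
    induction m generalizing v with
    | zero => exact hf _ _ hv
    | succ m ih =>
      simp only [Part.bind_eq_bind, Part.mem_bind_iff] at hv ⊢
      obtain ⟨a, ha, hb⟩ := hv
      obtain ⟨s1, h1⟩ := ih _ ha
      obtain ⟨s2, h2⟩ := hg' _ _ hb
      refine ⟨max s1 s2, a, ?_, mm _ _ _ (le_max_right _ _) _ _ h2⟩
      have := key s1 (max s1 s2) (le_max_left _ _) (Nat.pair n.unpair.1 m) a
      simp only [OracleCode.eval, Nat.unpaired, Nat.unpair_pair] at this
      exact this h1
  | rfind' cf hf =>
    intro n v hv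
    simp only [mem_rfind'] at hv ⊢
    obtain ⟨a, ⟨ha, hb⟩, e⟩ := hv
    obtain ⟨s1, h1⟩ := hf _ _ ha
    have h2 : ∀ k ≤ a, ∃ s, ∀ m < k, ∃ b ∈ cf.eval (gs s) (Nat.pair n.unpair.1 (m + n.unpair.2)),
        b ≠ 0 := by
      intro k
      induction k with
      | zero => intro _; exact ⟨0, by simp⟩
      | succ k ih =>
        intro hk
        obtain ⟨s, hs⟩ := ih (by omega)
        obtain ⟨b, hb1, e⟩ := hb k (by omega)
        obtain ⟨s', hs'⟩ := hf _ _ hb1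
        refine ⟨max s s', fun m hm => ?_⟩
        rcases Nat.lt_succ_iff_lt_or_eq.mp hm with h | rfl
        · obtain ⟨b, h1, h2⟩ := hs m h
          exact ⟨b, mm _ _ _ (le_max_left _ _) _ _ h1, h2⟩
        · exact ⟨b, mm _ _ _ (le_max_right _ _) _ _ hs', e⟩
    obtain ⟨s2, h2⟩ := h2 a le_rfl
    refine ⟨max s1 s2, a, ⟨mm _ _ _ (le_max_left _ _) _ _ h1, ?_⟩, e⟩
    intro m hm
    obtain ⟨b, h1, h2⟩ := h2 m hm
    exact ⟨b, mm _ _ _ (le_max_right _ _) _ _ h1, h2⟩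

/-- translating plain codes -/
def ofCode : Nat.Partrec.Code → OracleCode
  | .zero => .zero
  | .succ => .succ
  | .left => .left
  | .right => .right
  | .pair a b => .pair (ofCode a) (ofCode b)
  | .comp a b => .comp (ofCode a) (ofCode b)
  | .prec a b => .prec (ofCode a) (ofCode b)
  | .rfind' a => .rfind' (ofCode a)

theorem eval_ofCode (g : ℕ →. ℕ) (c : Nat.Partrec.Code) : (ofCode c).eval g = c.eval := by
  induction c with
  | zero => rfl
  | succ => rfl
  | left => rfl
  | right => rfl
  | pair a b ha hb => simp only [ofCode, OracleCode.eval, Nat.Partrec.Code.eval, ha, hb]; rfl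
  | comp a b ha hb => simp only [ofCode, OracleCode.eval, Nat.Partrec.Code.eval, ha, hb]; rfl
  | prec a b ha hb =>
    simp only [ofCode, OracleCode.eval, Nat.Partrec.Code.eval, ha, hb]; rfl
  | rfind' a ha => simp only [ofCode, OracleCode.eval, Nat.Partrec.Code.eval, ha]; rfl

theorem exists_oracleCode {f : ℕ →. ℕ} (hf : Nat.Partrec f) :
    ∃ c : OracleCode, ∀ g, c.eval g = f := by
  obtain ⟨c, hc⟩ := Nat.Partrec.Code.exists_code.mp hf
  exact ⟨ofCode c, fun g => by rw [eval_ofCode, hc]⟩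

theorem encodeCode_inj : ∀ c d : OracleCode, c.encodeCode = d.encodeCode → c = d := by
  intro c
  induction c with
  | zero => intro d h; cases d <;> simp [OracleCode.encodeCode] at h ⊢
  | succ => intro d h; cases d <;> simp [OracleCode.encodeCode] at h ⊢
  | left => intro d h; cases d <;> simp [OracleCode.encodeCode] at h ⊢
  | right => intro d h; cases d <;> simp [OracleCode.encodeCode] at h ⊢
  | oracle => intro d h; cases d <;> simp [OracleCode.encodeCode] at h ⊢
  | pair a b ha hb =>
    intro d h; cases d <;> simp only [OracleCode.encodeCode] at h <;> try omega
    obtain ⟨h1, h2⟩ := Nat.pair_eq_pair.mp (Nat.eq_of_mul_eq_mul_left (show 0 < 4 by norm_num) (Nat.add_right_cancel h))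
    rw [ha _ h1, hb _ h2]
  | comp a b ha hb =>
    intro d h; cases d <;> simp only [OracleCode.encodeCode] at h <;> try omega
    obtain ⟨h1, h2⟩ := Nat.pair_eq_pair.mp (Nat.eq_of_mul_eq_mul_left (show 0 < 4 by norm_num) (Nat.add_right_cancel h))
    rw [ha _ h1, hb _ h2]
  | prec a b ha hb =>
    intro d h; cases d <;> simp only [OracleCode.encodeCode] at h <;> try omega
    obtain ⟨h1, h2⟩ := Nat.pair_eq_pair.mp (Nat.eq_of_mul_eq_mul_left (show 0 < 4 by norm_num) (Nat.add_right_cancel h))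
    rw [ha _ h1, hb _ h2]
  | rfind' a ha =>
    intro d h; cases d <;> simp only [OracleCode.encodeCode] at h <;> try omega
    obtain ⟨h1, h2⟩ := Nat.pair_eq_pair.mp (Nat.eq_of_mul_eq_mul_left (show 0 < 4 by norm_num) (Nat.add_right_cancel h))
    rw [ha _ h1]


end part1_block

section part2_block

def restr (X : ℕ → Bool) (s : ℕ) : List Bool := (List.range s).map X

@[simp] theorem restr_length (X : ℕ → Bool) (s : ℕ) : (restr X s).length = s := by simp [restr]

theorem restr_succ (X : ℕ → Bool) (s : ℕ) : restr X (s+1) = restr X s ++ [X s] := by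
  simp [restr, List.range_succ]

theorem restr_take (X : ℕ → Bool) (s n : ℕ) : (restr X s).take n = restr X (min n s) := by
  simp [restr, ← List.map_take, List.take_range]

theorem restr_pfx (X : ℕ → Bool) {s t : ℕ} (h : s ≤ t) : restr X s <+: restr X t := by
  have := restr_take X t s
  rw [min_eq_left h] at this
  rw [← this]; exact take_pfx _ _

theorem prefix_restr_iff (X : ℕ → Bool) {s : ℕ} {σ : List Bool} :
    σ <+: restr X s ↔ σ.length ≤ s ∧ restr X σ.length = σ := by
  constructor
  · intro h
    have hl : σ.length ≤ s := by simpa using h.length_le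
    refine ⟨hl, ?_⟩
    have := List.prefix_iff_eq_take.mp h
    rw [restr_take, min_eq_left hl] at this
    exact this.symm
  · rintro ⟨h1, h2⟩
    rw [← h2]; exact restr_pfx X h1

theorem extendsStr_iff (X : ℕ → Bool) (σ : List Bool) : extendsStr X σ ↔ restr X σ.length = σ := by
  unfold extendsStr restr
  constructor
  · intro h
    apply List.ext_getElem (by simp)
    intro i h1 h2
    simpa using h ⟨i, h2⟩
  · intro h i
    have : (List.map X (List.range σ.length))[i.1]'(by simp) = σ[i.1] := by
      simp only [h]
    simpa using this

theorem mem_strOracle {τ : List Bool} {n v : ℕ} :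
    v ∈ strOracle τ n ↔ ∃ b, τ[n]? = some b ∧ v = cond b 1 0 := by
  unfold strOracle
  split
  · rename_i h
    simp [h, Part.mem_some_iff]
  · rename_i h
    rw [List.getElem?_eq_none (not_lt.mp h)]
    simp [Part.notMem_none]

theorem partrec_strOracle : Partrec₂ strOracle := by
  have h : Primrec (fun p : List Bool × ℕ => (p.1[p.2]?).map (fun b => cond b 1 0)) := by
    refine Primrec.option_map (Primrec.list_getElem?.comp Primrec.fst Primrec.snd) ?_
    exact Primrec.cond Primrec.snd (Primrec.const 1) (Primrec.const 0)
  have h2 := Computable.ofOption h.to_comp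
  refine h2.of_eq fun p => ?_
  apply Part.ext
  intro v
  rw [Part.mem_ofOption, mem_strOracle]
  simp [eq_comm]

theorem strOracle_mono {τ τ' : List Bool} (h : τ <+: τ') : ∀ n v, v ∈ strOracle τ n → v ∈ strOracle τ' n := by
  intro n v
  simp only [mem_strOracle]
  rintro ⟨b, hb, rfl⟩
  refine ⟨b, ?_, rfl⟩
  obtain ⟨l, rfl⟩ := h
  rw [List.getElem?_append_left]
  · exact hb
  · by_contra hh
    rw [List.getElem?_eq_none (not_lt.mp hh)] at hb; simp at hb

theorem mem_strOracle_restr {X : ℕ → Bool} {s n v : ℕ} :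
    v ∈ strOracle (restr X s) n ↔ n < s ∧ v = cond (X n) 1 0 := by
  rw [mem_strOracle]
  by_cases h : n < s
  · simp [restr, h]
  · simp [restr, h]
    
open Nat.Partrec (Code)
open Nat.Partrec.Code (evaln evaln_mono evaln_sound evaln_complete)

theorem exists_Y (A B : ℕ → Bool) (h : TRed B A) : ∃ Y : List Bool → List Bool, Primrec Y ∧
    (∀ x x', x <+: x' → Y x <+: Y x') ∧ (∀ x, (Y x).length ≤ x.length) ∧
    (∀ s, Y (restr A s) <+: restr B s) ∧ ∀ n, ∃ s, n ≤ (Y (restr A s)).length := by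
  obtain ⟨c, hc⟩ := h
  have hp := partrec_eval strOracle partrec_strOracle c
  have hp' : Nat.Partrec (fun m => (Part.ofOption (Encodable.decode (α := List Bool × ℕ) m)).bind
      (fun p => c.eval (strOracle p.1) p.2)) := by
    have : Partrec (fun m : ℕ => (Part.ofOption (Encodable.decode (α := List Bool × ℕ) m)).bind
      (fun p => c.eval (strOracle p.1) p.2)) := by
      refine Partrec.bind (Computable.ofOption Computable.decode) ?_
      exact hp.comp (Computable.fst.comp Computable.snd) (Computable.snd.comp Computable.snd)
    exact Partrec.nat_iff.mp this
  obtain ⟨d, hd⟩ := Code.exists_code.mp hp'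
  have hd' : ∀ x n, d.eval (Encodable.encode (x, n)) = c.eval (strOracle x) n := by
    intro x n; rw [hd]; simp [Encodable.encodek]
  let val : List Bool → ℕ → Option ℕ := fun x n =>
    ((List.range (x.length + 1)).filterMap
      (fun j => evaln x.length d (Encodable.encode (x.take j, n)))).head?
  have val_sound : ∀ x n v, val x n = some v → v ∈ c.eval (strOracle x) n := by
    intro x n v hv
    have := List.mem_of_head? hv
    rw [List.mem_filterMap] at this
    obtain ⟨j, _, hj⟩ := this
    have := evaln_sound hj
    rw [hd'] at this
    exact eval_mono (strOracle_mono (take_pfx _ _)) c _ _ this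
  have val_some : ∀ x n j v, j ≤ x.length → v ∈ evaln x.length d (Encodable.encode (x.take j, n)) → val x n = some v := by
    intro x n j v hj hv
    have hm : v ∈ ((List.range (x.length + 1)).filterMap
      (fun j => evaln x.length d (Encodable.encode (x.take j, n)))) :=
      List.mem_filterMap.mpr ⟨j, by simp; omega, hv⟩
    have : ∃ w, val x n = some w := by
      cases hh : val x n with
      | some w => exact ⟨w, rfl⟩
      | none =>
        simp only [val, List.head?_eq_none_iff] at hh
        rw [hh] at hm; simp at hm
    obtain ⟨w, hw⟩ := this
    have h1 := val_sound _ _ _ hw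
    have h2 := evaln_sound hv
    rw [hd'] at h2
    have h3 := eval_mono (strOracle_mono (take_pfx _ _)) c _ _ h2
    rw [hw, Part.mem_unique h1 h3]
  have val_mono : ∀ x x' n v, x <+: x' → val x n = some v → val x' n = some v := by
    intro x x' n v hx hv
    have := List.mem_of_head? hv
    rw [List.mem_filterMap] at this
    obtain ⟨j, hj, hv⟩ := this
    have hj' : j ≤ x.length := by simp at hj; omega
    refine val_some x' n j v (hj'.trans hx.length_le) ?_
    refine evaln_mono hx.length_le ?_
    obtain ⟨l, rfl⟩ := hx
    rw [List.take_append_of_le_length hj']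
    exact hv
  let len : List Bool → ℕ := fun x => (List.range x.length).findIdx (fun n => (val x n).isNone)
  have len_le : ∀ x, len x ≤ x.length := fun x => by
    have := List.findIdx_le_length (xs := List.range x.length) (p := fun n => (val x n).isNone)
    simpa using this
  have len_lt : ∀ x n, n < len x → ∃ v, val x n = some v := by
    intro x n hn
    have := List.not_of_lt_findIdx hn
    simp at this
    exact Option.isSome_iff_exists.mp (by simpa [Option.isSome_iff_ne_none] using this)
  have le_len : ∀ x m, m ≤ x.length → (∀ n < m, ∃ v, val x n = some v) → m ≤ len x := by
    intro x m hm h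
    by_contra hlt
    push Not at hlt
    have h1 : len x < (List.range x.length).length := by simp; omega
    have := List.findIdx_getElem (w := h1)
    simp only [List.getElem_range] at this
    obtain ⟨v, hv⟩ := h (len x) hlt
    change (val x (len x)).isNone = true at this
    rw [hv] at this; simp at this
  have primval : Primrec₂ val := by
    have h1 : Primrec₂ (fun (p : List Bool × ℕ) (j : ℕ) => evaln p.1.length d (Encodable.encode (p.1.take j, p.2))) := by
      refine Code.primrec_evaln.comp (Primrec.pair (Primrec.pair (Primrec.list_length.comp (Primrec.fst.comp Primrec.fst)) (Primrec.const d)) ?_)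
      refine Primrec.encode.comp (Primrec.pair (Primrec.list_take.comp Primrec.snd (Primrec.fst.comp Primrec.fst)) (Primrec.snd.comp Primrec.fst))
    refine Primrec.list_head?.comp (Primrec.listFilterMap (Primrec.list_range.comp (Primrec.succ.comp (Primrec.list_length.comp Primrec.fst))) h1)
  refine ⟨fun x => (List.range (len x)).map (fun n => decide (val x n = some 1)), ?_, ?_, ?_, ?_, ?_⟩
  · refine Primrec.list_map (Primrec.list_range.comp ?_) ?_
    · refine Primrec.list_findIdx (Primrec.list_range.comp Primrec.list_length) ?_
      refine (Primrec.not.comp (Primrec.option_isSome.comp primval)).of_eq ?_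
      intro p; change (!(val p.1 p.2).isSome) = (val p.1 p.2).isNone; cases val p.1 p.2 <;> rfl
    · exact (Primrec.eq.comp primval (Primrec.const _)).decide
  · intro x x' hx
    have h1 : len x ≤ len x' := by
      apply le_len _ _ ((len_le x).trans hx.length_le)
      intro n hn
      obtain ⟨v, hv⟩ := len_lt _ _ hn
      exact ⟨v, val_mono _ _ _ _ hx hv⟩
    have h2 : (List.range (len x)).map (fun n => decide (val x n = some 1)) = (List.range (len x)).map (fun n => decide (val x' n = some 1)) := by
      apply List.map_congr_left
      intro n hn
      rw [List.mem_range] at hn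
      obtain ⟨v, hv⟩ := len_lt _ _ hn
      rw [hv, val_mono _ _ _ _ hx hv]
    change (List.range (len x)).map (fun n => decide (val x n = some 1)) <+: (List.range (len x')).map (fun n => decide (val x' n = some 1))
    rw [h2]
    exact restr_pfx (fun n => decide (val x' n = some 1)) h1
  · intro x; simpa using len_le x
  · intro s
    change (List.range (len (restr A s))).map (fun n => decide (val (restr A s) n = some 1)) <+: restr B s
    have h2 : (List.range (len (restr A s))).map (fun n => decide (val (restr A s) n = some 1)) = restr B (len (restr A s)) := by
      apply List.map_congr_left
      intro n hn
      rw [List.mem_range] at hn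
      obtain ⟨v, hv⟩ := len_lt _ _ hn
      have h3 := val_sound _ _ _ hv
      have h4 : v ∈ c.eval (chi A) n := by
        refine eval_mono (fun n v hv => ?_) c _ _ h3
        rw [mem_strOracle_restr] at hv
        rw [hv.2]; exact Part.mem_some _
      rw [hc] at h4
      have : v = cond (B n) 1 0 := Part.mem_some_iff.mp h4
      rw [hv, this]
      cases B n <;> simp
    rw [h2]
    exact restr_pfx B (by simpa using len_le (restr A s))
  · have use : ∀ n, ∃ s0, ∀ s ≥ s0, ∃ v, val (restr A s) n = some v := by
      intro n
      have h1 : cond (B n) 1 0 ∈ c.eval (chi A) n := by rw [hc]; exact Part.mem_some _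
      obtain ⟨s1, hs1⟩ := eval_use (g := chi A) (gs := fun s => strOracle (restr A s))
        (fun s t hst => strOracle_mono (restr_pfx A hst))
        (fun n v hv => ⟨n+1, by rw [mem_strOracle_restr]; exact ⟨by omega, Part.mem_some_iff.mp hv⟩⟩) c _ _ h1
      rw [← hd'] at hs1
      obtain ⟨k, hk⟩ := evaln_complete.mp hs1
      refine ⟨max s1 k, fun s hs => ⟨_, val_some _ n s1 (cond (B n) 1 0) (by simp; omega) ?_⟩⟩
      rw [restr_take, min_eq_left (by omega)]
      exact evaln_mono (by simp; omega) hk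
    have use2 : ∀ m, ∃ s0, ∀ s ≥ s0, ∀ n < m, ∃ v, val (restr A s) n = some v := by
      intro m
      induction m with
      | zero => exact ⟨0, by simp⟩
      | succ m ih =>
        obtain ⟨s1, h1⟩ := ih
        obtain ⟨s2, h2⟩ := use m
        refine ⟨max s1 s2, fun s hs n hn => ?_⟩
        rcases Nat.lt_succ_iff_lt_or_eq.mp hn with h | rfl
        · exact h1 s (by omega) n h
        · exact h2 s (by omega)
    intro n
    obtain ⟨s0, h0⟩ := use2 n
    refine ⟨max s0 n, ?_⟩
    simp only [List.length_map, List.length_range]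
    exact le_len _ _ (by simp) (h0 _ (le_max_left _ _))


end part2_block

section part3_block
open Nat.Partrec (Code)
open Nat.Partrec.Code (evaln evaln_mono evaln_sound evaln_complete)

theorem prefix_iff_take {σ τ : List Bool} : σ <+: τ ↔ τ.take σ.length = σ := by
  rw [List.prefix_iff_eq_take, eq_comm]

theorem primrec_pfx : PrimrecRel (fun σ τ : List Bool => σ <+: τ) := by
  have : PrimrecRel (fun σ τ : List Bool => τ.take σ.length = σ) :=
    Primrec.eq.comp (Primrec.list_take.comp (Primrec.list_length.comp Primrec.fst) Primrec.snd) Primrec.fst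
  exact this.of_eq fun σ τ => prefix_iff_take.symm

def Wset (e : ℕ) : Set (List Bool) := {τ | ((Denumerable.ofNat Code e).eval (Encodable.encode τ)).Dom}

theorem exists_Wset (V : Set (List Bool)) (h : CE V) : ∃ e, Wset e = V := by
  obtain ⟨c, hc⟩ := h
  have h1 : Partrec₂ (fun (_ : Unit) (n : ℕ) => chi (fun _ => false) n) :=
    (Computable.const 0).partrec
  have h2 := partrec_eval (fun _ : Unit => chi (fun _ => false)) h1 c
  have h3 : Partrec (fun n => c.eval (chi (fun _ => false)) n) :=
    h2.comp (Computable.const ()) Computable.id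
  obtain ⟨d, hd⟩ := Code.exists_code.mp (Partrec.nat_iff.mp h3)
  refine ⟨Encodable.encode d, ?_⟩
  ext τ
  rw [hc]
  simp [Wset, Denumerable.ofNat_encode, hd]

def Efun (t e : ℕ) (σ : List Bool) : Option (List Bool) :=
  ((List.range t).filterMap (fun i => (Encodable.decode (α := List Bool) i).bind fun τ =>
    if σ <+: τ ∧ (evaln t (Denumerable.ofNat Code e) (Encodable.encode τ)).isSome = true then some τ else none)).head?

theorem Efun_primrec : Primrec (fun p : (ℕ × ℕ) × List Bool => Efun p.1.1 p.1.2 p.2) := by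
  refine Primrec.list_head?.comp (Primrec.listFilterMap (Primrec.list_range.comp (Primrec.fst.comp Primrec.fst)) ?_)
  refine Primrec.option_bind (Primrec.decode.comp Primrec.snd) ?_
  refine Primrec.ite (PrimrecPred.and ?_ ?_) (Primrec.option_some.comp Primrec.snd) (Primrec.const none)
  · exact primrec_pfx.comp (Primrec.snd.comp (Primrec.fst.comp Primrec.fst)) Primrec.snd
  · refine Primrec.eq.comp (Primrec.option_isSome.comp ?_) (Primrec.const true)
    have a : Primrec (fun p : ((((ℕ × ℕ) × List Bool) × ℕ) × List Bool) => p.1.1.1) :=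
      Primrec.fst.comp (Primrec.fst.comp Primrec.fst)
    exact Code.primrec_evaln.comp (Primrec.pair (Primrec.pair (Primrec.fst.comp a)
      ((Primrec.ofNat _).comp (Primrec.snd.comp a))) (Primrec.encode.comp Primrec.snd))

theorem Efun_sound {t e σ τ} (h : Efun t e σ = some τ) : σ <+: τ ∧ τ ∈ Wset e := by
  have := List.mem_of_head? h
  rw [List.mem_filterMap] at this
  obtain ⟨i, hi, hj⟩ := this
  rw [Option.bind_eq_some_iff] at hj
  obtain ⟨τ', h1, h2⟩ := hj
  split_ifs at h2 with h3
  simp at h2; subst h2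
  refine ⟨h3.1, ?_⟩
  obtain ⟨v, hv⟩ := Option.isSome_iff_exists.mp h3.2
  have := evaln_sound hv
  exact Part.dom_iff_mem.mpr ⟨v, this⟩

theorem Efun_isSome_iff {t e σ} : (Efun t e σ).isSome = true ↔
    ∃ τ, σ <+: τ ∧ (∃ i < t, Encodable.decode (α := List Bool) i = some τ) ∧
      (evaln t (Denumerable.ofNat Code e) (Encodable.encode τ)).isSome = true := by
  have key : ∀ l : List (List Bool), l.head?.isSome = true ↔ ∃ τ, τ ∈ l := by
    intro l; cases l with
    | nil => simp
    | cons a l => simp only [List.head?_cons, Option.isSome_some, true_iff]; exact ⟨a, by simp⟩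
  unfold Efun
  rw [key]
  simp only [List.mem_filterMap, List.mem_range, Option.bind_eq_some_iff]
  constructor
  · rintro ⟨τ, i, hi, τ', h1, h2⟩
    split_ifs at h2 with h3
    simp at h2; subst h2
    exact ⟨τ', h3.1, ⟨i, hi, h1⟩, h3.2⟩
  · rintro ⟨τ, h1, ⟨i, h2, h4⟩, h3⟩
    exact ⟨τ, i, h2, τ, h4, by rw [if_pos ⟨h1, h3⟩]⟩

theorem Efun_mono {t t' e σ} (htt : t ≤ t') (h : (Efun t e σ).isSome = true) : (Efun t' e σ).isSome = true := by
  rw [Efun_isSome_iff] at h ⊢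
  obtain ⟨τ, h1, ⟨i, h2, h4⟩, h3⟩ := h
  refine ⟨τ, h1, ⟨i, by omega, h4⟩, ?_⟩
  obtain ⟨v, hv⟩ := Option.isSome_iff_exists.mp h3
  exact Option.isSome_iff_exists.mpr ⟨v, evaln_mono htt hv⟩

theorem Efun_complete {e σ τ} (h : σ <+: τ) (hτ : τ ∈ Wset e) : ∃ t, (Efun t e σ).isSome = true := by
  obtain ⟨v, hv⟩ := Part.dom_iff_mem.mp hτ
  obtain ⟨k, hk⟩ := evaln_complete.mp hv
  refine ⟨max k (Encodable.encode τ + 1), ?_⟩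
  rw [Efun_isSome_iff]
  exact ⟨τ, h, ⟨_, by omega, Encodable.encodek _⟩, Option.isSome_iff_exists.mpr ⟨v, evaln_mono (le_max_left _ _) hk⟩⟩

theorem eval_comp_some {g : ℕ →. ℕ} {cf cg : OracleCode} {n a : ℕ} (h : cg.eval g n = Part.some a) :
    (OracleCode.comp cf cg).eval g n = cf.eval g a := by
  apply Part.ext
  intro v
  rw [mem_comp, h]
  simp

/-- total functions computable relative to `g` -/
def RTot (g : ℕ →. ℕ) (f : ℕ → ℕ) : Prop := ∃ c : OracleCode, ∀ n, c.eval g n = Part.some (f n)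

theorem RTot.of_primrec (g) {f : ℕ → ℕ} (h : Primrec f) : RTot g f := by
  obtain ⟨c, hc⟩ := exists_oracleCode (Partrec.nat_iff.mp h.to_comp.partrec)
  exact ⟨c, fun n => by rw [hc]; rfl⟩

theorem RTot.of_computable (g) {f : ℕ → ℕ} (h : Computable f) : RTot g f := by
  obtain ⟨c, hc⟩ := exists_oracleCode (Partrec.nat_iff.mp h.partrec)
  exact ⟨c, fun n => by rw [hc]; rfl⟩

theorem RTot.comp {g f f'} (h : RTot g f) (h' : RTot g f') : RTot g (fun n => f (f' n)) := by
  obtain ⟨c, hc⟩ := h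
  obtain ⟨d, hd⟩ := h'
  refine ⟨.comp c d, fun n => ?_⟩
  rw [eval_comp_some (hd n), hc]

theorem RTot.pair {g f f'} (h : RTot g f) (h' : RTot g f') : RTot g (fun n => Nat.pair (f n) (f' n)) := by
  obtain ⟨c, hc⟩ := h
  obtain ⟨d, hd⟩ := h'
  refine ⟨.pair c d, fun n => ?_⟩
  change Nat.pair <$> (c.eval g n) <*> (d.eval g n) = _
  rw [hd, hc]
  simp [Seq.seq]

theorem RTot.oracle (X : ℕ → Bool) : RTot (chi X) (fun n => cond (X n) 1 0) := ⟨.oracle, fun _ => rfl⟩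

theorem RTot.prec {g} {f f' : ℕ → ℕ} (h : RTot g f) (h' : RTot g f') :
    RTot g (fun m => Nat.rec (f m.unpair.1) (fun y i => f' (Nat.pair m.unpair.1 (Nat.pair y i))) m.unpair.2) := by
  obtain ⟨c, hc⟩ := h
  obtain ⟨d, hd⟩ := h'
  refine ⟨.prec c d, fun n => ?_⟩
  simp only [OracleCode.eval, Nat.unpaired]
  generalize n.unpair.2 = m
  induction m with
  | zero => exact hc _
  | succ m ih =>
    change Part.bind _ _ = _
    rw [ih, Part.bind_some, hd]

theorem RTot.rfind {g q} (h : RTot g q) (hq : ∀ n, ∃ s, q (Nat.pair n s) = 0) :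
    ∃ r : ℕ → ℕ, RTot g r ∧ ∀ n, q (Nat.pair n (r n)) = 0 := by
  classical
  obtain ⟨c, hc⟩ := h
  refine ⟨fun n => Nat.find (hq n), ?_, fun n => Nat.find_spec (hq n)⟩
  obtain ⟨d, hd⟩ := RTot.of_primrec g (f := fun n => Nat.pair n 0) (Primrec₂.natPair.comp Primrec.id (Primrec.const 0))
  refine ⟨.comp (.rfind' c) d, fun n => ?_⟩
  rw [eval_comp_some (hd n), Part.eq_some_iff, mem_rfind']
  simp only [Nat.unpair_pair, add_zero, hc, Part.mem_some_iff]
  refine ⟨_, ⟨(Nat.find_spec (hq n)).symm, fun m hm => ⟨_, rfl, Nat.find_min (hq n) hm⟩⟩, rfl⟩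

theorem RTot.restr (B : ℕ → Bool) : RTot (chi B) (fun s => Encodable.encode (restr B s)) := by
  have hst : Primrec (fun m : ℕ => Encodable.encode
      (((Encodable.decode (α := List Bool) m.unpair.1).getD []) ++ [decide (m.unpair.2 = 1)])) := by
    refine Primrec.encode.comp (Primrec.list_append.comp (Primrec.option_getD.comp (Primrec.decode.comp (Primrec.fst.comp Primrec.unpair)) (Primrec.const [])) ?_)
    exact Primrec.list_cons.comp (Primrec.eq.comp (Primrec.snd.comp Primrec.unpair) (Primrec.const 1)).decide (Primrec.const [])
  have r1 : RTot (chi B) (fun m => m.unpair.2.unpair.2) := .of_primrec _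
    (Primrec.snd.comp (Primrec.unpair.comp (Primrec.snd.comp Primrec.unpair)))
  have r2 : RTot (chi B) (fun m => m.unpair.2.unpair.1) := .of_primrec _
    (Primrec.fst.comp (Primrec.unpair.comp (Primrec.snd.comp Primrec.unpair)))
  have r3 := (RTot.of_primrec (chi B) hst).comp (r1.pair ((RTot.oracle B).comp r2))
  have r4 := RTot.prec (RTot.of_primrec (chi B) (Primrec.const (Encodable.encode ([] : List Bool)))) r3
  have r5 := r4.comp (RTot.of_primrec (chi B) (Primrec₂.natPair.comp (Primrec.const 0) Primrec.id))
  obtain ⟨c, hc⟩ := r5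
  refine ⟨c, fun n => ?_⟩
  rw [hc]
  congr 1
  simp only [Nat.unpair_pair, Encodable.encodek, Option.getD_some, id]
  induction n with
  | zero => rfl
  | succ n ih =>
    simp only [ih, restr_succ, Encodable.encodek, Option.getD_some]
    cases B n <;> rfl

theorem TRed_of (B G : ℕ → Bool) (f : List Bool → ℕ → Option Bool) (hf : Primrec₂ f)
    (h1 : ∀ n, ∃ s, (f (restr B s) n).isSome = true)
    (h2 : ∀ s n b, f (restr B s) n = some b → b = G n) : TRed G B := by
  have hq : RTot (chi B) (fun m => cond (f (restr B m.unpair.2) m.unpair.1).isSome 0 1) := by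
    have p : Primrec (fun m : ℕ => cond (f ((Encodable.decode (α := List Bool) m.unpair.1).getD []) m.unpair.2).isSome 0 1) := by
      refine Primrec.cond (Primrec.option_isSome.comp (hf.comp (Primrec.option_getD.comp (Primrec.decode.comp (Primrec.fst.comp Primrec.unpair)) (Primrec.const [])) (Primrec.snd.comp Primrec.unpair))) (Primrec.const _) (Primrec.const _)
    have := (RTot.of_primrec (chi B) p).comp (((RTot.restr B).comp (.of_primrec _ (Primrec.snd.comp Primrec.unpair))).pair (.of_primrec _ (Primrec.fst.comp Primrec.unpair)))
    simpa using this
  obtain ⟨r, hr, hr2⟩ := RTot.rfind hq (fun n => by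
    obtain ⟨s, hs⟩ := h1 n
    exact ⟨s, by simp [hs]⟩)
  have p : Primrec (fun m : ℕ => cond ((f ((Encodable.decode (α := List Bool) m.unpair.1).getD []) m.unpair.2).getD false) 1 0) := by
    refine Primrec.cond (Primrec.option_getD.comp (hf.comp (Primrec.option_getD.comp (Primrec.decode.comp (Primrec.fst.comp Primrec.unpair)) (Primrec.const [])) (Primrec.snd.comp Primrec.unpair)) (Primrec.const _)) (Primrec.const _) (Primrec.const _)
  obtain ⟨c, hc⟩ := (RTot.of_primrec (chi B) p).comp (((RTot.restr B).comp hr).pair (.of_primrec _ Primrec.id))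
  refine ⟨c, ?_⟩
  funext n
  rw [hc]
  simp only [Nat.unpair_pair, Encodable.encodek, Option.getD_some, id, chi]
  congr 1
  have := hr2 n
  simp only [Nat.unpair_pair] at this
  cases hh : f (restr B (r n)) n with
  | none => rw [hh] at this; simp at this
  | some b => rw [h2 _ _ _ hh]; rfl

/-- codes for constants -/
def constCode : ℕ → OracleCode
  | 0 => .zero
  | n+1 => .comp .succ (constCode n)

theorem eval_constCode (g) (m n : ℕ) : (constCode m).eval g n = Part.some m := by
  induction m with
  | zero => rfl
  | succ m ih =>
    rw [constCode, eval_comp_some ih]; rfl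

theorem primrec_constCode : Primrec (fun m => (constCode m).encodeCode) := by
  have : Primrec (fun m : ℕ => Nat.rec (motive := fun _ => ℕ) 0 (fun _ i => 4 * Nat.pair 1 i + 6) m) := by
    refine Primrec.nat_rec₁ _ ?_
    exact Primrec.nat_add.comp (Primrec.nat_mul.comp (Primrec.const 4) (Primrec₂.natPair.comp (Primrec.const 1) Primrec.snd)) (Primrec.const 6)
  refine this.of_eq fun m => ?_
  induction m with
  | zero => rfl
  | succ m ih => simp only [ih]; rfl

theorem sigma2 (P : ℕ → ℕ → ℕ → Bool) (hP : Computable (fun p : ℕ × ℕ × ℕ => P p.1 p.2.1 p.2.2)) :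
    ∃ C : OracleCode, ∀ u, (C.eval (chi zeroJump) u).Dom ↔ ∃ a, ∀ b, P u a b = true := by
  have hd : Partrec (fun m : ℕ => Nat.rfind (fun b => Part.some (! P m.unpair.1 m.unpair.2 b))) := by
    have a : Computable (fun p : ℕ × ℕ => p.1.unpair) := Computable.unpair.comp Computable.fst
    have a2 : Computable (fun p : ℕ × ℕ => (p.1.unpair.1, p.1.unpair.2, p.2)) :=
      Computable.pair (Computable.fst.comp a) (Computable.pair (Computable.snd.comp a) Computable.snd)
    have a3 : Computable (fun p : ℕ × ℕ => P p.1.unpair.1 p.1.unpair.2 p.2) :=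
      Computable.of_eq (Computable.comp (f := fun p : ℕ × ℕ × ℕ => P p.1 p.2.1 p.2.2)
        (g := fun p : ℕ × ℕ => (p.1.unpair.1, p.1.unpair.2, p.2)) hP a2) (fun p => by dsimp only)
    have a4 : Computable (fun p : ℕ × ℕ => ! P p.1.unpair.1 p.1.unpair.2 p.2) := Primrec.not.to_comp.comp a3
    have a5 : Partrec₂ (fun (m b : ℕ) => Part.some (! P m.unpair.1 m.unpair.2 b)) := a4.partrec
    exact Partrec.rfind a5
  obtain ⟨d, hd⟩ := exists_oracleCode (Partrec.nat_iff.mp hd)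
  have hdom : ∀ g m, (d.eval g m).Dom ↔ ∃ b, P m.unpair.1 m.unpair.2 b = false := by
    intro g m
    rw [hd]
    refine Iff.trans Nat.rfind_dom ?_
    constructor
    · rintro ⟨b, h, _⟩; exact ⟨b, by simpa using h⟩
    · rintro ⟨b, h⟩; exact ⟨b, by simpa using h, fun _ => trivial⟩
  let h : ℕ → ℕ := fun m => (OracleCode.comp d (constCode m)).encodeCode
  have hh : Primrec h := by
    change Primrec (fun m => 4 * Nat.pair d.encodeCode (constCode m).encodeCode + 6)
    exact Primrec.nat_add.comp (Primrec.nat_mul.comp (Primrec.const 4) (Primrec₂.natPair.comp (Primrec.const _) primrec_constCode)) (Primrec.const 6)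
  have hz : ∀ m, zeroJump (h m) = true ↔ ∃ b, P m.unpair.1 m.unpair.2 b = false := by
    intro m
    rw [← hdom (chi fun _ => false) m]
    simp only [zeroJump, jump, decide_eq_true_eq]
    have he : ∀ n, (OracleCode.comp d (constCode m)).eval (chi fun _ => false) n = d.eval (chi fun _ => false) m := by
      intro n
      exact eval_comp_some (eval_constCode _ _ _)
    constructor
    · rintro ⟨c, h1, h2⟩
      have := encodeCode_inj _ _ h1
      subst this
      rwa [he] at h2
    · intro h
      exact ⟨_, rfl, by rwa [he]⟩
  obtain ⟨c, hc⟩ := (RTot.oracle zeroJump).comp (.of_primrec _ hh)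
  obtain ⟨d', hd'⟩ := RTot.of_primrec (chi zeroJump) (f := fun n => Nat.pair n 0) (Primrec₂.natPair.comp Primrec.id (Primrec.const 0))
  refine ⟨.comp (.rfind' c) d', fun u => ?_⟩
  have e1 : (OracleCode.comp (.rfind' c) d').eval (chi zeroJump) u = (OracleCode.rfind' c).eval (chi zeroJump) (Nat.pair u 0) := by
    exact eval_comp_some (hd' u)
  rw [e1, Part.dom_iff_mem]
  simp only [mem_rfind', Nat.unpair_pair, add_zero, hc, Part.mem_some_iff]
  have key : ∀ a, (0 = cond (zeroJump (h (Nat.pair u a))) 1 0) ↔ ∀ b, P u a b = true := by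
    intro a
    have := hz (Nat.pair u a)
    simp only [Nat.unpair_pair] at this
    cases hv : zeroJump (h (Nat.pair u a)) with
    | true =>
      obtain ⟨b, hb⟩ := this.mp hv
      simp only [cond_true, zero_ne_one, false_iff]
      intro h; rw [h b] at hb; simp at hb
    | false =>
      simp only [cond_false, true_iff]
      intro b
      by_contra hb
      have := this.mpr ⟨b, by simpa using hb⟩
      rw [hv] at this; simp at this
  constructor
  · rintro ⟨y, a, ⟨h1, _⟩, _⟩
    exact ⟨a, (key a).mp h1⟩
  · intro hex
    classical
    refine ⟨_, Nat.find hex, ⟨(key _).mpr (Nat.find_spec hex), fun m hm => ⟨_, rfl, ?_⟩⟩, rfl⟩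
    intro h0
    exact Nat.find_min hex hm ((key m).mp h0.symm)


end part3_block

section part4_block
open MeasureTheory

noncomputable def coin : Measure Bool := (PMF.uniformOfFintype Bool).toMeasure

instance : IsProbabilityMeasure coin := by unfold coin; infer_instance

theorem coin_singleton (b : Bool) : coin {b} = 2⁻¹ := by
  simp [coin]

noncomputable def lam : Measure (ℕ → Bool) := Measure.infinitePi (fun _ : ℕ => coin)

instance : IsProbabilityMeasure lam := by unfold lam; infer_instance

theorem cyl_eq (x : List Bool) : {X : ℕ → Bool | restr X x.length = x} =
    Set.pi (Finset.range x.length) (fun i => {x.getD i false}) := by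
  ext X
  simp only [Set.mem_ofPred_eq, Set.mem_pi, Finset.coe_range, Set.mem_Iio, Set.mem_singleton_iff]
  rw [← extendsStr_iff]
  constructor
  · intro h i hi
    have := h ⟨i, hi⟩
    simpa [hi] using this
  · intro h i
    have := h i.1 i.2
    simpa using this

theorem cyl_meas (x : List Bool) (s : ℕ) : MeasurableSet {X : ℕ → Bool | restr X s = x} := by
  by_cases h : x.length = s
  · subst h
    rw [cyl_eq]
    exact MeasurableSet.pi (Finset.countable_toSet _) (fun _ _ => measurableSet_singleton _)
  · have : {X : ℕ → Bool | restr X s = x} = ∅ := by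
      ext X; simp only [Set.mem_ofPred_eq, Set.mem_empty_iff_false, iff_false]
      rintro rfl; simp at h
    rw [this]; exact MeasurableSet.empty

theorem lam_cyl (x : List Bool) : lam {X : ℕ → Bool | restr X x.length = x} = 2⁻¹ ^ x.length := by
  rw [cyl_eq, lam, Measure.infinitePi_pi _ (fun _ _ => measurableSet_singleton _)]
  simp [coin_singleton]

theorem meas_restr (s : ℕ) (P : List Bool → Prop) : MeasurableSet {X : ℕ → Bool | P (restr X s)} := by
  have : {X : ℕ → Bool | P (restr X s)} = ⋃ x ∈ {x | P x}, {X | restr X s = x} := by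
    ext X; simp
  rw [this]
  exact MeasurableSet.biUnion (Set.to_countable _) (fun x _ => cyl_meas x s)

/-- all strings of length `s` -/
def strs : ℕ → List (List Bool)
  | 0 => [[]]
  | s+1 => (strs s).flatMap (fun x => [x ++ [false], x ++ [true]])

theorem mem_strs (s : ℕ) (x : List Bool) : x ∈ strs s ↔ x.length = s := by
  induction s generalizing x with
  | zero => simp [strs]
  | succ s ih =>
    simp only [strs, List.mem_flatMap, ih]
    constructor
    · rintro ⟨y, hy, h⟩
      simp at h; rcases h with rfl | rfl <;> simp [hy]
    · intro h
      have hne : x ≠ [] := by rintro rfl; simp at h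
      refine ⟨x.dropLast, by simp [h], ?_⟩
      have := List.dropLast_append_getLast hne
      cases hb : x.getLast hne <;> rw [hb] at this <;> simp [this]

theorem strs_nodup (s : ℕ) : (strs s).Nodup := by
  induction s with
  | zero => simp [strs]
  | succ s ih =>
    simp only [strs]
    rw [List.nodup_flatMap]
    refine ⟨fun x _ => by simp, ?_⟩
    refine ih.imp ?_
    intro a b hab
    simp only [Function.onFun, List.disjoint_left]
    intro c h1 h2
    simp only [List.mem_cons, List.not_mem_nil, or_false] at h1 h2
    rcases h1 with rfl | rfl <;> rcases h2 with h | h <;> simp at h <;> exact hab h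

theorem strs_primrec : Primrec strs := by
  have : Primrec (fun s : ℕ => Nat.rec (motive := fun _ => List (List Bool)) [[]] (fun _ l => l.flatMap (fun x => [x ++ [false], x ++ [true]])) s) := by
    refine Primrec.nat_rec₁ _ ?_
    refine Primrec.list_flatMap Primrec.snd ?_
    exact Primrec.list_cons.comp (Primrec.list_append.comp Primrec.snd (Primrec.const [false]))
      (Primrec.list_cons.comp (Primrec.list_append.comp Primrec.snd (Primrec.const [true])) (Primrec.const []))
  refine this.of_eq fun s => ?_
  induction s with
  | zero => rfl
  | succ s ih => simp only [ih]; rfl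

theorem lam_restr (s : ℕ) (P : List Bool → Prop) [DecidablePred P] :
    lam {X | P (restr X s)} = (((strs s).filter (fun x => decide (P x))).length : ℝ≥0∞) / 2 ^ s := by
  have e : {X : ℕ → Bool | P (restr X s)} = ⋃ x ∈ ((strs s).filter (fun x => decide (P x))).toFinset, {X | restr X s = x} := by
    ext X; simp [mem_strs]
  rw [e, measure_biUnion_finset]
  · rw [Finset.sum_congr rfl (g := fun _ => (2⁻¹ : ℝ≥0∞) ^ s)]
    · rw [Finset.sum_const, List.toFinset_card_of_nodup ((strs_nodup s).filter _), nsmul_eq_mul, div_eq_mul_inv, ENNReal.inv_pow]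
    · intro x hx
      simp [mem_strs] at hx
      rw [← hx.1, lam_cyl]
  · intro x _ y _ hxy
    simp only [Function.onFun, Set.disjoint_left, Set.mem_ofPred_eq]
    intro X h1 h2; exact hxy (h1.symm.trans h2)
  · intro x _; exact cyl_meas x s

theorem openOf_iff (V : Set (List Bool)) (X : ℕ → Bool) : X ∈ openOf V ↔ ∃ s, restr X s ∈ V := by
  simp only [openOf, Set.mem_ofPred_eq, extendsStr_iff]
  constructor
  · rintro ⟨σ, h, h2⟩; exact ⟨σ.length, by rwa [h2]⟩
  · rintro ⟨s, h⟩; exact ⟨_, h, by simp⟩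

theorem stringMeasure_le (V : Set (List Bool)) : stringMeasure V ≤ lam (openOf V) := by
  classical
  refine iSup_le fun n => ?_
  have : (Nat.card {f : Fin n → Bool // ∃ σ ∈ V, σ <+: List.ofFn f}) =
      ((strs n).filter (fun x => decide (∃ σ ∈ V, σ <+: x))).length := by
    rw [← List.toFinset_card_of_nodup ((strs_nodup n).filter _), Nat.card_eq_fintype_card, Fintype.card_subtype]
    refine Finset.card_bij (fun f _ => List.ofFn f) ?_ ?_ ?_
    · intro f hf
      simp [mem_strs] at hf ⊢
      exact hf
    · intro f _ g _ h; exact List.ofFn_injective h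
    · intro x hx
      simp [mem_strs] at hx
      obtain ⟨hl, hx⟩ := hx
      subst hl
      refine ⟨fun i => x.get i, ?_, List.ofFn_get x⟩
      simp only [Finset.mem_filter, Finset.mem_univ, true_and, List.ofFn_get]
      exact hx
  rw [this, ← lam_restr n (fun x => ∃ σ ∈ V, σ <+: x)]
  apply measure_mono
  rintro X ⟨σ, hσ, h⟩
  rw [openOf_iff]
  refine ⟨σ.length, ?_⟩
  rw [prefix_restr_iff] at h
  rwa [h.2]

theorem meas_openOf (V : Set (List Bool)) : MeasurableSet (openOf V) := by
  have : openOf V = ⋃ s, {X | restr X s ∈ V} := by ext X; simp [openOf_iff]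
  rw [this]
  exact MeasurableSet.iUnion fun s => meas_restr s (· ∈ V)

/-- summation over a disjoint countable family -/
theorem sum_disj {ι : Type} [Countable ι] (R : Set ι) (C M : ι → Set (ℕ → Bool)) (N : Set (ℕ → Bool)) (c : ℝ≥0∞)
    (hC : ∀ i ∈ R, MeasurableSet (C i)) (hN : MeasurableSet N)
    (hd : R.PairwiseDisjoint C) (h : ∀ i ∈ R, c * lam (M i) ≤ lam (C i ∩ N)) :
    c * lam (⋃ i ∈ R, M i) ≤ lam ((⋃ i ∈ R, C i) ∩ N) := by
  have hc : R.Countable := Set.to_countable R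
  rw [Set.iUnion₂_inter, measure_biUnion (f := fun i => C i ∩ N) hc]
  · calc c * lam (⋃ i ∈ R, M i) ≤ c * ∑' i : R, lam (M i) := by
          gcongr; exact measure_biUnion_le _ hc _
      _ = ∑' i : R, c * lam (M i) := ENNReal.tsum_mul_left.symm
      _ ≤ _ := ENNReal.tsum_le_tsum fun i => h i.1 i.2
  · intro i hi j hj hij
    exact (hd hi hj hij).mono Set.inter_subset_left Set.inter_subset_left
  · intro i hi; exact (hC i hi).inter hN

theorem sum_disj_le {ι : Type} [Countable ι] (R : Set ι) (C : ι → Set (ℕ → Bool)) (N : Set (ℕ → Bool)) (c : ℝ≥0∞)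
    (hC : ∀ i ∈ R, MeasurableSet (C i)) 
    (hd : R.PairwiseDisjoint C) (h : ∀ i ∈ R, lam (N ∩ C i) ≤ c * lam (C i)) :
    lam (N ∩ (⋃ i ∈ R, C i)) ≤ c * lam (⋃ i ∈ R, C i) := by
  have hc : R.Countable := Set.to_countable R
  rw [Set.inter_iUnion₂, measure_biUnion hc hd hC, ← ENNReal.tsum_mul_left]
  exact (measure_biUnion_le _ hc _).trans (ENNReal.tsum_le_tsum fun i => h i.1 i.2)


end part4_block

section part5_block
open MeasureTheory

theorem Efun_anti {t e σ σ'} (h : σ <+: σ') (hs : (Efun t e σ').isSome = true) : (Efun t e σ).isSome = true := by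
  rw [Efun_isSome_iff] at hs ⊢
  obtain ⟨τ, h1, h2, h3⟩ := hs
  exact ⟨τ, h.trans h1, h2, h3⟩

/-- states: current output, history of events, current mode -/
abbrev St := List Bool × List (ℕ × ℕ × List Bool) × Option (ℕ × ℕ)

def attemptOK (t e : ℕ) (hist : List (ℕ × ℕ × List Bool)) : Prop :=
  ∀ ev ∈ hist, ev.1 = 0 ∨ ev.2.1 ≠ e ∨ (ev.1 = 1 ∧ (Efun t e ev.2.2).isSome = true)

instance (t e hist) : Decidable (attemptOK t e hist) := by unfold attemptOK; infer_instance

def nxtNone (t : ℕ) (S : St) : St :=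
  if attemptOK t S.2.1.length.unpair.1 S.2.1 then (S.1, S.2.1, some (S.2.1.length.unpair.1, t+1))
  else (S.1 ++ [false], (0, S.2.1.length.unpair.1, S.1 ++ [false]) :: S.2.1, none)

def nxtSome (t : ℕ) (S : St) (bit : Bool) (m : ℕ × ℕ) : St :=
  match Efun t m.1 S.1 with
  | some τ => (τ ++ [false], (2, m.1, τ ++ [false]) :: S.2.1, none)
  | none => if bit = true ∧ t.unpair.1 = m.1 then (S.1 ++ [false], (1, m.1, S.1 ++ [false]) :: S.2.1, none) else S

def nxt (t : ℕ) (S : St) (bit : Bool) : St :=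
  match S.2.2 with
  | none => nxtNone t S
  | some m => nxtSome t S bit m

def bitOf (o : Option (List Bool)) (σ : List Bool) : Bool :=
  match o with
  | none => false
  | some ρ => decide (ρ <+: σ)

def st (r : ℕ → Option (List Bool)) : ℕ → List Bool → St
  | 0, _ => ([], [], none)
  | t+1, σ => nxt t (st r t σ) (bitOf (r t) σ)

def cnt (Y : List Bool → List Bool) (s : ℕ) (σ : List Bool) : ℕ :=
  ((strs s).filter (fun x => decide (σ <+: Y x))).length

def small (Y : List Bool → List Bool) (K s : ℕ) (root σ : List Bool) : Prop :=
  ∃ z < s + 1, 0 < cnt Y z root ∧ cnt Y s σ * 2 ^ (K + 1 + z) ≤ 2 ^ s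

instance (Y K s root σ) : Decidable (small Y K s root σ) := by unfold small; infer_instance

def Leaf (Y : List Bool → List Bool) (r : ℕ → Option (List Bool)) (k e s : ℕ) (σ : List Bool) : Prop :=
  ∃ n < σ.length + 1, (st r s σ).2.2 = some (e, n) ∧ small Y (k + e + 2) s (σ.take n) σ ∧
    ∀ m < σ.length, n ≤ m → ¬ small Y (k + e + 2) s (σ.take n) (σ.take m)

instance (Y r k e s σ) : Decidable (Leaf Y r k e s σ) := by unfold Leaf; infer_instance

/-- some leaf between `ρ` and `y` -/
def LeafIn (Y : List Bool → List Bool) (r : ℕ → Option (List Bool)) (k e s : ℕ) (ρ y : List Bool) : Prop :=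
  ∃ m < y.length + 1, ρ <+: y.take m ∧ Leaf Y r k e s (y.take m)

instance (Y r k e s ρ y) : Decidable (LeafIn Y r k e s ρ y) := by unfold LeafIn; infer_instance

def Wt (Y : List Bool → List Bool) (r : ℕ → Option (List Bool)) (k e s : ℕ) (ρ : List Bool) : ℕ :=
  ((strs s).filter (fun x => decide (LeafIn Y r k e s ρ (Y x)))).length

def elig (Y : List Bool → List Bool) (r : ℕ → Option (List Bool)) (k s : ℕ) (σ : List Bool) : Prop :=
  Leaf Y r k s.unpair.1 s σ ∧ σ.length ≤ s ∧ Efun s s.unpair.1 (st r s σ).1 = none ∧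
    ∀ j < σ.length + 1, cnt Y s (σ.take j) < 2 ^ (k + s.unpair.1 + 2) * Wt Y r k s.unpair.1 s (σ.take j)

instance (Y r k s σ) : Decidable (elig Y r k s σ) := by unfold elig; infer_instance

def pick (Y : List Bool → List Bool) (r : ℕ → Option (List Bool)) (k s : ℕ) : Option (List Bool) :=
  ((List.range s).filterMap (fun i => (Encodable.decode (α := List Bool) i).bind fun σ =>
    if elig Y r k s σ then some σ else none)).head?

def RL (Y : List Bool → List Bool) (k : ℕ) : ℕ → List (Option (List Bool))
  | 0 => []
  | s+1 => RL Y k s ++ [pick Y (fun i => (RL Y k s).getD i none) k s]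

def rr (Y : List Bool → List Bool) (k s : ℕ) : Option (List Bool) :=
  pick Y (fun i => (RL Y k s).getD i none) k s

theorem RL_eq (Y k s) : RL Y k s = (List.range s).map (rr Y k) := by
  induction s with
  | zero => rfl
  | succ s ih => rw [RL, List.range_succ, List.map_append, ← ih]; rfl

/-! congruence -/

theorem st_congr {r r' : ℕ → Option (List Bool)} {s : ℕ} (h : ∀ i < s, r i = r' i) (σ) : st r s σ = st r' s σ := by
  induction s with
  | zero => rfl
  | succ s ih => rw [st, st, ih (fun i hi => h i (by omega)), h s (by omega)]

theorem Leaf_congr {r r' : ℕ → Option (List Bool)} {s : ℕ} (h : ∀ i < s, r i = r' i) (Y k e) :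
    Leaf Y r k e s = Leaf Y r' k e s := by
  funext σ; unfold Leaf; rw [st_congr h]

theorem LeafIn_congr {r r' : ℕ → Option (List Bool)} {s : ℕ} (h : ∀ i < s, r i = r' i) (Y k e) :
    LeafIn Y r k e s = LeafIn Y r' k e s := by
  funext ρ y; unfold LeafIn; rw [Leaf_congr h]

theorem Wt_congr {r r' : ℕ → Option (List Bool)} {s : ℕ} (h : ∀ i < s, r i = r' i) (Y k e) :
    Wt Y r k e s = Wt Y r' k e s := by
  funext ρ; unfold Wt; simp only [LeafIn_congr h]

theorem elig_congr {r r' : ℕ → Option (List Bool)} {s : ℕ} (h : ∀ i < s, r i = r' i) (Y k σ) :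
    elig Y r k s σ ↔ elig Y r' k s σ := by
  unfold elig; rw [Leaf_congr h, Wt_congr h, st_congr h]

theorem pick_congr {r r' : ℕ → Option (List Bool)} {s : ℕ} (h : ∀ i < s, r i = r' i) (Y k) :
    pick Y r k s = pick Y r' k s := by
  unfold pick; simp only [elig_congr h]

theorem rr_eq (Y k s) : rr Y k s = pick Y (rr Y k) k s := by
  rw [rr]
  apply pick_congr
  intro i hi
  simp [RL_eq, hi]

/-! basic facts about states -/

theorem nxt_of_none {t S b} (h : S.2.2 = none) : nxt t S b = nxtNone t S := by
  unfold nxt; rw [h]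

theorem nxt_of_some {t S b m} (h : S.2.2 = some m) : nxt t S b = nxtSome t S b m := by
  unfold nxt; rw [h]

/-- what a state with active mode looks like -/
structure Active (r : ℕ → Option (List Bool)) (t : ℕ) (σ : List Bool) (e n : ℕ) : Prop where
  pos : 1 ≤ n
  le : n ≤ t
  mode0 : (st r (n-1) σ).2.2 = none
  ok : attemptOK (n-1) e (st r (n-1) σ).2.1
  const : ∀ i, n ≤ i → i ≤ t → st r i σ = ((st r (n-1) σ).1, (st r (n-1) σ).2.1, some (e, n))
  quiet : ∀ i, n ≤ i → i < t → Efun i e (st r (n-1) σ).1 = none ∧ ¬ (bitOf (r i) σ = true ∧ i.unpair.1 = e)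

theorem active_of_mode {r t σ e n} (h : (st r t σ).2.2 = some (e, n)) : Active r t σ e n := by
  induction t with
  | zero => simp [st] at h
  | succ t ih =>
    cases hm : (st r t σ).2.2 with
    | none =>
      have hst : st r (t+1) σ = nxtNone t (st r t σ) := by rw [st, nxt_of_none hm]
      unfold nxtNone at hst
      split_ifs at hst with hok
      · rw [hst] at h
        simp only [Option.some.injEq, Prod.mk.injEq] at h
        obtain ⟨h1, h2⟩ := h
        subst h2
        refine ⟨by omega, le_rfl, by simpa using hm, by rw [← h1]; simpa using hok, ?_, ?_⟩
        · intro i h3 h4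
          have : i = t + 1 := by omega
          subst this
          rw [hst, h1]; rfl
        · intro i h3 h4; omega
      · rw [hst] at h; simp at h
    | some m =>
      have hst : st r (t+1) σ = nxtSome t (st r t σ) (bitOf (r t) σ) m := by rw [st, nxt_of_some hm]
      unfold nxtSome at hst
      cases hE : Efun t m.1 (st r t σ).1 with
      | some τ => rw [hE] at hst; rw [hst] at h; simp at h
      | none =>
        rw [hE] at hst
        simp only at hst
        split_ifs at hst with hb
        · rw [hst] at h; simp at h
        · rw [hst] at h
          have A := ih h
          have hm' : m = (e, n) := by rw [hm] at h; simpa using h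
          subst hm'
          refine ⟨A.pos, by have := A.le; omega, A.mode0, A.ok, ?_, ?_⟩
          · intro i h1 h2
            rcases Nat.lt_or_ge i (t+1) with h3 | h3
            · exact A.const i h1 (by omega)
            · have : i = t+1 := by omega
              subst this
              rw [hst]; exact A.const t A.le le_rfl
          · intro i h1 h2
            rcases Nat.lt_or_ge i t with h3 | h3
            · exact A.quiet i h1 h3
            · have : i = t := by omega
              subst this
              rw [A.const i A.le le_rfl] at hE
              exact ⟨hE, hb⟩

theorem Active.const' {r t σ e n} (A : Active r t σ e n) {i} (h1 : n ≤ i) (h2 : i ≤ t) : st r i σ = st r t σ := by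
  rw [A.const i h1 h2, A.const t A.le le_rfl]

theorem Active.out_eq {r t σ e n} (A : Active r t σ e n) : (st r t σ).1 = (st r (n-1) σ).1 := by
  rw [A.const t A.le le_rfl]

theorem Active.quietE {r t σ e n} (A : Active r t σ e n) {i} (h1 : n ≤ i) (h2 : i < t) : Efun i e (st r t σ).1 = none := by
  rw [A.out_eq]
  exact (A.quiet i h1 h2).1

theorem Active.mode {r t σ e n} (A : Active r t σ e n) : (st r t σ).2.2 = some (e, n) := by
  rw [A.const t A.le le_rfl]

/-! the greedy choice -/

theorem head_range {β : Type} (g : ℕ → Option β) (s i : ℕ) (hi : i < s) (h : (g i).isSome = true) :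
    ∃ j ≤ i, ∃ b, g j = some b ∧ ((List.range s).filterMap g).head? = some b := by
  induction s with
  | zero => omega
  | succ s ih =>
    rw [List.range_succ, List.filterMap_append]
    rcases Nat.lt_or_ge i s with h1 | h1
    · obtain ⟨j, hj, b, hb, hh⟩ := ih h1
      refine ⟨j, hj, b, hb, ?_⟩
      rw [List.head?_append, hh]; rfl
    · have : i = s := by omega
      subst this
      by_cases hex : ∃ j < i, (g j).isSome = true
      · cases hc : ((List.range i).filterMap g) with
        | nil =>
          exfalso
          obtain ⟨j, hj, hs⟩ := hex
          rw [List.filterMap_eq_nil_iff] at hc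
          rw [hc j (by simpa using hj)] at hs; simp at hs
        | cons b l =>
          have : b ∈ (List.range i).filterMap g := by rw [hc]; simp
          rw [List.mem_filterMap] at this
          obtain ⟨j, hj, hb⟩ := this
          exact ⟨j, by simp at hj; omega, b, hb, by simp⟩
      · have : (List.range i).filterMap g = [] := by
          rw [List.filterMap_eq_nil_iff]
          intro a ha
          by_contra hne
          exact hex ⟨a, by simpa using ha, by rwa [Option.isSome_iff_ne_none]⟩
        obtain ⟨b, hb⟩ := Option.isSome_iff_exists.1 h
        exact ⟨i, le_rfl, b, hb, by simp [this, hb]⟩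

theorem pick_elig {Y r k s σ} (h : pick Y r k s = some σ) : elig Y r k s σ := by
  unfold pick at h
  have := List.mem_of_head? h
  rw [List.mem_filterMap] at this
  obtain ⟨i, _, hi⟩ := this
  rw [Option.bind_eq_some_iff] at hi
  obtain ⟨τ, _, h2⟩ := hi
  split_ifs at h2 with h3
  cases h2; exact h3

theorem elig_pick {Y r k s σ} (h : elig Y r k s σ) (hs : Encodable.encode σ < s) :
    ∃ τ, pick Y r k s = some τ ∧ ∃ j ≤ Encodable.encode σ, Encodable.decode j = some τ := by
  obtain ⟨j, hj, b, hb, hh⟩ := head_range (fun i => (Encodable.decode (α := List Bool) i).bind fun σ =>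
    if elig Y r k s σ then some σ else none) s (Encodable.encode σ) hs (by simp [h])
  refine ⟨b, hh, ?_⟩
  simp only [Option.bind_eq_some_iff] at hb
  obtain ⟨τ, h1, h2⟩ := hb
  split_ifs at h2 with h3
  cases h2
  exact ⟨j, hj, h1⟩

/-- the standing assumptions -/
structure Sys (Y : List Bool → List Bool) (r : ℕ → Option (List Bool)) (k : ℕ) : Prop where
  mono : ∀ x x', x <+: x' → Y x <+: Y x'
  len : ∀ x, (Y x).length ≤ x.length
  eq : ∀ s, r s = pick Y r k s

theorem Sys.elig {Y r k} (S : Sys Y r k) {s σ} (h : r s = some σ) : elig Y r k s σ :=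
  pick_elig (by rw [← S.eq, h])

theorem Sys.r_len {Y r k} (S : Sys Y r k) {s σ} (h : r s = some σ) : σ.length ≤ s := (S.elig h).2.1

theorem bitOf_true {o σ} : bitOf o σ = true ↔ ∃ ρ, o = some ρ ∧ ρ <+: σ := by
  cases o <;> simp [bitOf]

theorem Sys.st_pfx {Y r k} (S : Sys Y r k) {t ρ ρ'} (h : ρ <+: ρ') (ht : t ≤ ρ.length) : st r t ρ = st r t ρ' := by
  induction t with
  | zero => rfl
  | succ t ih =>
    rw [st, st, ih (by omega)]
    congr 1
    rw [Bool.eq_iff_iff, bitOf_true, bitOf_true]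
    constructor
    · rintro ⟨τ, h1, h2⟩; exact ⟨τ, h1, h2.trans h⟩
    · rintro ⟨τ, h1, h2⟩
      exact ⟨τ, h1, List.prefix_of_prefix_length_le h2 h (by have := S.r_len h1; omega)⟩

/-! cylinders under the functional -/

def CS (Y : List Bool → List Bool) (s : ℕ) (σ : List Bool) : Set (ℕ → Bool) := {X | σ <+: Y (restr X s)}

def CC (Y : List Bool → List Bool) (σ : List Bool) : Set (ℕ → Bool) := ⋃ s, CS Y s σ

theorem lam_CS (Y s σ) : lam (CS Y s σ) = (cnt Y s σ : ℝ≥0∞) / 2 ^ s := by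
  unfold CS cnt
  rw [lam_restr s (fun x => σ <+: Y x)]

theorem meas_CS (Y s σ) : MeasurableSet (CS Y s σ) := meas_restr s (fun x => σ <+: Y x)

theorem meas_CC (Y σ) : MeasurableSet (CC Y σ) := MeasurableSet.iUnion fun s => meas_CS Y s σ

theorem Sys.Y_restr {Y r k} (S : Sys Y r k) (X) {s s'} (h : s ≤ s') : Y (restr X s) <+: Y (restr X s') :=
  S.mono _ _ (restr_pfx X h)

theorem Sys.CS_mono {Y r k} (S : Sys Y r k) {s s'} (h : s ≤ s') (σ) : CS Y s σ ⊆ CS Y s' σ := by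
  intro X hX
  exact List.IsPrefix.trans hX (S.Y_restr X h)

theorem CS_anti (Y s) {σ σ' : List Bool} (h : σ <+: σ') : CS Y s σ' ⊆ CS Y s σ := by
  intro X hX
  exact List.IsPrefix.trans h hX

theorem CC_anti (Y) {σ σ' : List Bool} (h : σ <+: σ') : CC Y σ' ⊆ CC Y σ :=
  Set.iUnion_mono fun s => CS_anti Y s h

theorem CS_sub_CC (Y s σ) : CS Y s σ ⊆ CC Y σ := Set.subset_iUnion (fun s => CS Y s σ) s

theorem Sys.comparable {Y r k} (S : Sys Y r k) {X σ τ} (h1 : X ∈ CC Y σ) (h2 : X ∈ CC Y τ) : σ <+: τ ∨ τ <+: σ := by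
  obtain ⟨s, hs⟩ := Set.mem_iUnion.1 h1
  obtain ⟨s', hs'⟩ := Set.mem_iUnion.1 h2
  have a := S.CS_mono (le_max_left s s') σ hs
  have b := S.CS_mono (le_max_right s s') τ hs'
  exact pfx_or_pfx a b

theorem div_le_div_nat (a b s t : ℕ) : (a : ℝ≥0∞) / 2 ^ s ≤ (b : ℝ≥0∞) / 2 ^ t ↔ a * 2 ^ t ≤ b * 2 ^ s := by
  rw [ENNReal.div_le_iff (by positivity) (by simp), ← ENNReal.mul_div_right_comm,
    ENNReal.le_div_iff_mul_le (by simp) (by simp)]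
  norm_cast

theorem div_lt_div_nat (a b s t : ℕ) : (a : ℝ≥0∞) / 2 ^ s < (b : ℝ≥0∞) / 2 ^ t ↔ a * 2 ^ t < b * 2 ^ s := by
  rw [← not_le, div_le_div_nat, not_le]

theorem Sys.cnt_mono {Y r k} (S : Sys Y r k) {s s'} (h : s ≤ s') (σ) : cnt Y s σ * 2 ^ s' ≤ cnt Y s' σ * 2 ^ s := by
  rw [← div_le_div_nat, ← lam_CS, ← lam_CS]
  exact measure_mono (S.CS_mono h σ)

theorem take_of_pfx {σ ρ : List Bool} (h : σ <+: ρ) : ρ.take σ.length = σ := (List.prefix_iff_eq_take.1 h).symm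

theorem take_take_of_pfx {σ ρ : List Bool} (h : σ <+: ρ) {n} (hn : n ≤ σ.length) : ρ.take n = σ.take n := by
  rw [← take_of_pfx h, List.take_take, min_eq_left hn]

/-- L2: below a leaf the states do not split -/
theorem Sys.leaf_st {Y r k} (S : Sys Y r k) {e s σ} (hL : Leaf Y r k e s σ) {t} (ht : t ≤ s) {ρ} (hρ : σ <+: ρ) :
    st r t ρ = st r t σ := by
  obtain ⟨n, hn, hmode, hsm, hmin⟩ := hL
  have A := active_of_mode hmode
  induction t generalizing ρ with
  | zero => rfl
  | succ t ih =>
    rw [st, st, ih (by omega) hρ]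
    by_cases hb : bitOf (r t) ρ = bitOf (r t) σ
    · rw [hb]
    have hb1 : ∃ ρ', r t = some ρ' ∧ ρ' <+: ρ ∧ ¬ ρ' <+: σ := by
      rw [Bool.eq_iff_iff, bitOf_true, bitOf_true] at hb
      by_contra hcon
      push Not at hcon
      apply hb
      constructor
      · rintro ⟨τ, h1, h2⟩; exact ⟨τ, h1, hcon τ h1 h2⟩
      · rintro ⟨τ, h1, h2⟩; exact ⟨τ, h1, h2.trans hρ⟩
    obtain ⟨ρ', hr1, hr2, hr3⟩ := hb1
    have hσρ : σ <+: ρ' := (pfx_or_pfx hr2 hρ).resolve_left hr3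
    have hlen : σ.length < ρ'.length := by
      rcases Nat.lt_or_ge σ.length ρ'.length with h | h
      · exact h
      · exact absurd ((hσρ.eq_of_length_le h) ▸ List.prefix_rfl) hr3
    have hlt := S.r_len hr1
    have hnt : n ≤ t := by omega
    have hst := A.const' hnt (by omega : t ≤ s)
    rw [hst, nxt_of_some hmode, nxt_of_some hmode]
    have hE := A.quietE hnt (by omega : t < s)
    unfold nxtSome
    simp only [hE]
    by_cases hu : t.unpair.1 = e
    swap
    · simp [hu]
    exfalso
    obtain ⟨⟨n'', hn'', hm'', hs'', hmin''⟩, _⟩ := S.elig hr1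
    rw [hu] at hm'' hs'' hmin''
    rw [ih (by omega) hσρ, hst, hmode] at hm''
    simp only [Option.some.injEq, Prod.mk.injEq, true_and] at hm''
    subst hm''
    have h1 := hmin'' σ.length hlen (by omega)
    rw [take_take_of_pfx hσρ (by omega), take_of_pfx hσρ] at h1
    rw [take_take_of_pfx hσρ (by omega)] at hs''
    obtain ⟨z', hz', hz'p, _⟩ := hs''
    obtain ⟨z, hz, hzp, hzs⟩ := hsm
    have hc := S.cnt_mono (by omega : t ≤ s) σ
    apply h1
    have key : ∀ w, cnt Y s σ * 2 ^ (k + e + 2 + 1 + w) ≤ 2 ^ s → cnt Y t σ * 2 ^ (k + e + 2 + 1 + w) ≤ 2 ^ t := by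
      intro w hw
      have h3 : cnt Y t σ * 2 ^ (k + e + 2 + 1 + w) * 2 ^ s ≤ 2 ^ t * 2 ^ s := by
        calc _ = (cnt Y t σ * 2 ^ s) * 2 ^ (k + e + 2 + 1 + w) := by ring
          _ ≤ (cnt Y s σ * 2 ^ t) * 2 ^ (k + e + 2 + 1 + w) := Nat.mul_le_mul_right _ hc
          _ = (cnt Y s σ * 2 ^ (k + e + 2 + 1 + w)) * 2 ^ t := by ring
          _ ≤ 2 ^ s * 2 ^ t := Nat.mul_le_mul_right _ hw
          _ = _ := by ring
      exact Nat.le_of_mul_le_mul_right h3 (by positivity)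
    rcases Nat.lt_or_ge t z with h | h
    · refine ⟨z', hz', hz'p, key z' (le_trans (Nat.mul_le_mul_left _ ?_) hzs)⟩
      exact Nat.pow_le_pow_right (by norm_num) (by omega)
    · exact ⟨z, by omega, hzp, key z hzs⟩

theorem Sys.leaf_unique {Y r k} (S : Sys Y r k) {e s σ σ'} (hL : Leaf Y r k e s σ) (hL' : Leaf Y r k e s σ')
    (h : σ <+: σ') : σ = σ' := by
  have hst := S.leaf_st hL le_rfl h
  obtain ⟨n, hn, hmode, hsm, hmin⟩ := hL
  obtain ⟨n', hn', hmode', hsm', hmin'⟩ := hL'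
  rw [hst, hmode] at hmode'
  simp only [Option.some.injEq, Prod.mk.injEq, true_and] at hmode'
  subst hmode'
  by_contra hne
  have hlen : σ.length < σ'.length := by
    rcases Nat.lt_or_ge σ.length σ'.length with h1 | h1
    · exact h1
    · exact absurd (h.eq_of_length_le h1) hne
  apply hmin' σ.length hlen (by omega)
  rwa [take_take_of_pfx h (by omega), take_of_pfx h]

/-- one release step -/
theorem Sys.release {Y r k} (S : Sys Y r k) {j σ ρ} (hr : r j = some σ) (hρ : σ <+: ρ) :
    st r (j+1) ρ = ((st r j σ).1 ++ [false], (1, j.unpair.1, (st r j σ).1 ++ [false]) :: (st r j σ).2.1, none) := by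
  obtain ⟨hL, _, hE, _⟩ := S.elig hr
  have hst := S.leaf_st hL le_rfl hρ
  obtain ⟨n, hn, hmode, -, -⟩ := hL
  rw [st, hst, nxt_of_some hmode]
  unfold nxtSome
  have hb : bitOf (r j) ρ = true := bitOf_true.2 ⟨σ, hr, hρ⟩
  simp only [hE, hb, and_self, if_true]

theorem Sys.release_inj {Y r k} (S : Sys Y r k) {s s' σ} (h : r s = some σ) (h' : r s' = some σ) (hlt : s < s') : False := by
  have h1 := S.release h (List.prefix_rfl)
  obtain ⟨n', hn', hmode', -, -⟩ := (S.elig h').1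
  have A := active_of_mode hmode'
  have := S.r_len h
  have h2 := A.const' (i := s+1) (by omega) (by omega)
  rw [h1] at h2
  rw [← h2] at hmode'
  simp at hmode'


theorem hist_mono {r t t' σ} (h : t ≤ t') {ev} (hev : ev ∈ (st r t σ).2.1) : ev ∈ (st r t' σ).2.1 := by
  induction t', h using Nat.le_induction with
  | base => exact hev
  | succ t' _ ih =>
    rw [st]
    cases hm : (st r t' σ).2.2 with
    | none =>
      rw [nxt_of_none hm]; unfold nxtNone
      split_ifs
      · exact ih
      · simp [ih]
    | some m =>
      rw [nxt_of_some hm]; unfold nxtSome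
      split
      · simp [ih]
      · split_ifs
        · simp [ih]
        · exact ih

theorem active_sep {r σ t1 t2 e1 n1 e2 n2} (h1 : (st r t1 σ).2.2 = some (e1, n1)) (h2 : (st r t2 σ).2.2 = some (e2, n2))
    (h : t1 ≤ t2) : (e1, n1) = (e2, n2) ∨ t1 < n2 := by
  rcases Nat.lt_or_ge t1 n2 with h3 | h3
  · exact Or.inr h3
  · have A := active_of_mode h2
    have := A.const' h3 h
    rw [this, h2] at h1
    left; simpa using h1.symm

/-- after an attempt at `e` has been opened at `m`, any later attempt at `e` needs a convergence -/
theorem later_attempt {r τ m e t' n'} (h1 : (st r m τ).2.2 = some (e, m)) (h2 : (st r t' τ).2.2 = some (e, n')) (h : m < n') :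
    ∃ t < n', (Efun t e (st r m τ).1).isSome = true := by
  have A := active_of_mode h2
  have inv : ∀ t, m ≤ t → st r t τ = st r m τ ∨ (∃ t'' < t, (Efun t'' e (st r m τ).1).isSome = true) ∨
      (1, e, (st r m τ).1 ++ [false]) ∈ (st r t τ).2.1 := by
    intro t ht
    induction t, ht using Nat.le_induction with
    | base => exact Or.inl rfl
    | succ t ht ih =>
      rcases ih with h3 | ⟨t'', h3, h4⟩ | h3
      · rw [st, h3, nxt_of_some h1]; unfold nxtSome
        split
        · rename_i hE
          exact Or.inr (Or.inl ⟨t, by omega, by simp at hE; rw [hE]; rfl⟩)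
        · split_ifs
          · right; right; simp
          · left; rfl
      · exact Or.inr (Or.inl ⟨t'', by omega, h4⟩)
      · exact Or.inr (Or.inr (hist_mono (Nat.le_succ t) h3))
  rcases inv (n'-1) (by omega) with h3 | ⟨t'', h3, h4⟩ | h3
  · have := A.mode0
    rw [h3, h1] at this; simp at this
  · exact ⟨t'', by omega, h4⟩
  · have := A.ok _ h3
    simp at this
    exact ⟨n'-1, by omega, Efun_anti (List.prefix_append _ _) this⟩


end part5_block

section part6_block
open MeasureTheory

def minP (Q : List Bool → Prop) : Set (List Bool) := {ρ | Q ρ ∧ ∀ ρ', ρ' <+: ρ → Q ρ' → ρ' = ρ}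

theorem exists_minP {Q : List Bool → Prop} {σ} (h : Q σ) : ∃ ρ ∈ minP Q, ρ <+: σ := by
  classical
  have hex : ∃ m, m ≤ σ.length ∧ Q (σ.take m) := ⟨σ.length, le_rfl, by simpa using h⟩
  have h1 := Nat.find_spec hex
  refine ⟨σ.take (Nat.find hex), ⟨h1.2, ?_⟩, take_pfx _ _⟩
  intro ρ' hp hq
  have hp2 := hp.trans (take_pfx _ _)
  have hlen := hp2.length_le
  have h2 : Nat.find hex ≤ ρ'.length := Nat.find_min' hex ⟨hlen, by rwa [take_of_pfx hp2]⟩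
  apply hp.eq_of_length_le
  rw [List.length_take]; exact le_trans (min_le_left _ _) h2

theorem Sys.minP_disj {Y r k} (S : Sys Y r k) (Q) : (minP Q).PairwiseDisjoint (CC Y) := by
  intro a ha b hb hab
  refine Set.disjoint_left.2 fun X h1 h2 => hab ?_
  rcases S.comparable h1 h2 with h | h
  · exact hb.2 a h ha.1
  · exact (ha.2 b h hb.1).symm

def Perm (Y : List Bool → List Bool) (r : ℕ → Option (List Bool)) (k e : ℕ) (σ : List Bool) : Prop :=
  ∃ s0, ∀ s, s0 ≤ s → Leaf Y r k e s σ

def Lset (Y : List Bool → List Bool) (r : ℕ → Option (List Bool)) (k e : ℕ) : Set (ℕ → Bool) :=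
  ⋃ σ ∈ {σ | Perm Y r k e σ}, CC Y σ

def MS (Y : List Bool → List Bool) (r : ℕ → Option (List Bool)) (k e s : ℕ) (ρ : List Bool) : Set (ℕ → Bool) :=
  {X | LeafIn Y r k e s ρ (Y (restr X s))}

theorem lam_MS (Y r k e s ρ) : lam (MS Y r k e s ρ) = (Wt Y r k e s ρ : ℝ≥0∞) / 2 ^ s := by
  unfold MS Wt
  rw [lam_restr s (fun x => LeafIn Y r k e s ρ (Y x))]

theorem meas_MS (Y r k e s ρ) : MeasurableSet (MS Y r k e s ρ) := meas_restr s (fun x => LeafIn Y r k e s ρ (Y x))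

theorem mem_MS {Y r k e s ρ} {X : ℕ → Bool} : X ∈ MS Y r k e s ρ ↔ ∃ σ, ρ <+: σ ∧ Leaf Y r k e s σ ∧ σ <+: Y (restr X s) := by
  constructor
  · rintro ⟨m, hm, h1, h2⟩
    exact ⟨_, h1, h2, take_pfx _ _⟩
  · rintro ⟨σ, h1, h2, h3⟩
    refine ⟨σ.length, ?_, ?_⟩
    · have := h3.length_le; omega
    · rw [take_of_pfx h3]; exact ⟨h1, h2⟩

theorem cnt_lt_iff (Y : List Bool → List Bool) (r k e s ρ K) : cnt Y s ρ < 2 ^ K * Wt Y r k e s ρ ↔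
    ((2 : ℝ≥0∞) ^ K)⁻¹ * lam (CS Y s ρ) < lam (MS Y r k e s ρ) := by
  rw [lam_CS, lam_MS, mul_comm (_⁻¹), ← div_eq_mul_inv, div_eq_mul_inv, div_eq_mul_inv, mul_assoc,
    ← ENNReal.mul_inv (by simp) (by simp), ← pow_add, ← div_eq_mul_inv, div_lt_div_nat]
  rw [pow_add, mul_comm (2 ^ s) (2^K), ← mul_assoc, Nat.mul_lt_mul_right (by positivity), mul_comm]

theorem Perm.leaf_unique {Y r k} (S : Sys Y r k) {e σ σ'} (h : Perm Y r k e σ) (h' : Perm Y r k e σ') (hp : σ <+: σ') : σ = σ' := by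
  obtain ⟨s0, h0⟩ := h
  obtain ⟨s1, h1⟩ := h'
  exact S.leaf_unique (h0 (max s0 s1) (le_max_left _ _)) (h1 _ (le_max_right _ _)) hp

theorem Perm.quiet {Y r k e σ s0} (h : ∀ s, s0 ≤ s → Leaf Y r k e s σ) {s} (hs : s0 ≤ s) (hs' : σ.length ≤ s) :
    Efun s e (st r s σ).1 = none := by
  obtain ⟨n, hn, hm, -, -⟩ := h (s+1) (by omega)
  have A := active_of_mode hm
  rw [A.const' (by omega) (by omega : s ≤ s+1)]
  exact A.quietE (by omega) (by omega)

/-- no permanent leaf sees heavy permanent leaves at all its prefixes -/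
theorem Sys.perm_light {Y r k} (S : Sys Y r k) {e σ} (h : Perm Y r k e σ) :
    ∃ ρ, ρ <+: σ ∧ lam (Lset Y r k e ∩ CC Y ρ) ≤ ((2 : ℝ≥0∞) ^ (k + e + 2))⁻¹ * lam (CC Y ρ) := by
  by_contra hcon
  push Not at hcon
  have step : ∀ j, ∃ s0, ∀ s, s0 ≤ s → cnt Y s (σ.take j) < 2 ^ (k + e + 2) * Wt Y r k e s (σ.take j) := by
    intro j
    have h1 := hcon (σ.take j) (take_pfx _ _)
    set ρ := σ.take j with hρ
    have hsub : Lset Y r k e ∩ CC Y ρ ⊆ ⋃ s0, ⋂ s ∈ {s | s0 ≤ s}, MS Y r k e s ρ := by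
      rintro X ⟨hX1, hX2⟩
      simp only [Lset, Set.mem_iUnion] at hX1
      obtain ⟨τ, hτ, hX1⟩ := hX1
      have hτ' : Perm Y r k e τ := hτ
      have hρτ : ρ <+: τ := by
        rcases S.comparable hX2 hX1 with h | h2
        · exact h
        · have := hτ'.leaf_unique S h (h2.trans (take_pfx _ _))
          rw [this]; exact take_pfx _ _
      obtain ⟨s0, h0⟩ := hτ'
      obtain ⟨s1, hs1⟩ := Set.mem_iUnion.1 hX1
      rw [Set.mem_iUnion]
      refine ⟨max s0 s1, ?_⟩
      simp only [Set.mem_iInter]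
      intro s hs
      have hs : max s0 s1 ≤ s := hs
      rw [mem_MS]
      exact ⟨τ, hρτ, h0 s (le_trans (le_max_left _ _) hs), S.CS_mono (le_trans (le_max_right _ _) hs) τ hs1⟩
    have h2 := lt_of_lt_of_le h1 (measure_mono hsub)
    rw [Monotone.measure_iUnion] at h2
    · rw [lt_iSup_iff] at h2
      obtain ⟨s0, h0⟩ := h2
      refine ⟨s0, fun s hs => ?_⟩
      rw [cnt_lt_iff]
      calc _ ≤ ((2 : ℝ≥0∞) ^ (k + e + 2))⁻¹ * lam (CC Y ρ) := by gcongr; exact CS_sub_CC _ _ _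
        _ < _ := h0
        _ ≤ _ := measure_mono (Set.biInter_subset_of_mem hs)
    · intro a b hab
      exact Set.biInter_subset_biInter_left fun s hs => le_trans hab hs
  choose g hg using step
  obtain ⟨s0, h0⟩ := h
  obtain ⟨M, hM⟩ : ∃ M, ∀ j < σ.length + 1, g j ≤ M := by
    refine ⟨(Finset.range (σ.length+1)).sup g, fun j hj => ?_⟩
    exact Finset.le_sup (f := g) (by simpa using hj)
  set s1 := s0 + M + σ.length + Encodable.encode σ + 1 with hs1
  have el : ∀ i, ∃ τ, r (Nat.pair e (s1 + i)) = some τ ∧ ∃ j ≤ Encodable.encode σ, Encodable.decode j = some τ := by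
    intro i
    have hge : s1 + i ≤ Nat.pair e (s1 + i) := Nat.right_le_pair _ _
    rw [S.eq]
    apply elig_pick _ (by omega)
    unfold TypicalDegree.elig
    rw [Nat.unpair_pair]
    refine ⟨h0 _ (by omega), by omega, Perm.quiet h0 (by omega) (by omega), fun j hj => hg j _ ?_⟩
    have := hM j hj
    omega
  choose τ hτ w hw hdec using el
  have hinj : Function.Injective (fun i => (⟨w i, by have := hw i; omega⟩ : Fin (Encodable.encode σ + 1))) := by
    intro a b hab
    simp only [Fin.mk.injEq] at hab
    have e1 := hdec a
    rw [hab, hdec b] at e1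
    have e2 : τ b = τ a := by simpa using e1
    by_contra hne
    have h1 := hτ a
    have h2 := hτ b
    rw [e2] at h2
    rcases lt_or_gt_of_ne hne with h | h
    · exact S.release_inj h1 h2 (Nat.pair_lt_pair_right _ (by omega))
    · exact S.release_inj h2 h1 (Nat.pair_lt_pair_right _ (by omega))
  exact not_injective_infinite_finite _ hinj

theorem Sys.lam_Lset {Y r k} (S : Sys Y r k) (e) : lam (Lset Y r k e) ≤ ((2 : ℝ≥0∞) ^ (k + e + 2))⁻¹ := by
  set Q : List Bool → Prop := fun ρ => lam (Lset Y r k e ∩ CC Y ρ) ≤ ((2 : ℝ≥0∞) ^ (k + e + 2))⁻¹ * lam (CC Y ρ)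
  have hsub : Lset Y r k e ⊆ Lset Y r k e ∩ ⋃ ρ ∈ minP Q, CC Y ρ := by
    intro X hX
    refine ⟨hX, ?_⟩
    simp only [Lset, Set.mem_iUnion] at hX
    obtain ⟨τ, hτ, hX⟩ := hX
    obtain ⟨ρ, hρ, hq⟩ := S.perm_light hτ
    obtain ⟨ρ', h1, h2⟩ := exists_minP (Q := Q) hq
    simp only [Set.mem_iUnion]
    exact ⟨ρ', h1, CC_anti Y (h2.trans hρ) hX⟩
  calc _ ≤ _ := measure_mono hsub
    _ ≤ ((2 : ℝ≥0∞) ^ (k + e + 2))⁻¹ * lam (⋃ ρ ∈ minP Q, CC Y ρ) :=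
        sum_disj_le _ _ _ _ (fun ρ _ => meas_CC Y ρ) (S.minP_disj Q) (fun ρ h => h.1)
    _ ≤ ((2 : ℝ≥0∞) ^ (k + e + 2))⁻¹ * 1 := by gcongr; exact prob_le_one
    _ = _ := mul_one _


end part6_block

section part7_block
open MeasureTheory

def ecount (e : ℕ) (S : St) : ℕ := (S.2.1.filter (fun ev => decide (ev.1 = 1 ∧ ev.2.1 = e))).length

theorem ecount_step (r : ℕ → Option (List Bool)) (e t σ) : ecount e (st r (t+1) σ) = ecount e (st r t σ) ∨
    (ecount e (st r (t+1) σ) = ecount e (st r t σ) + 1 ∧ bitOf (r t) σ = true ∧ t.unpair.1 = e ∧ (st r (t+1) σ).2.2 = none) := by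
  rw [st]
  cases hm : (st r t σ).2.2 with
  | none =>
    rw [nxt_of_none hm]; unfold nxtNone
    split_ifs
    · left; rfl
    · left; simp [ecount]
  | some m =>
    rw [nxt_of_some hm]; unfold nxtSome
    split
    · left; simp [ecount]
    · split_ifs with hb
      · by_cases he : m.1 = e
        · right; simp [ecount, he, hb.1]; rw [hb.2, he]
        · left; simp [ecount, he]
      · left; rfl

theorem ecount_mono (r : ℕ → Option (List Bool)) (e σ) {t t'} (h : t ≤ t') : ecount e (st r t σ) ≤ ecount e (st r t' σ) := by
  induction t', h using Nat.le_induction with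
  | base => exact le_rfl
  | succ t' _ ih => rcases ecount_step r e t' σ with h | h <;> omega

theorem ecount_le (r : ℕ → Option (List Bool)) (e σ m t) (h : ∀ s, m ≤ s → s < t → ¬ (bitOf (r s) σ = true ∧ s.unpair.1 = e)) :
    ecount e (st r t σ) ≤ m := by
  induction t with
  | zero => simp [st, ecount]
  | succ t ih =>
    have := ih fun s h1 h2 => h s h1 (by omega)
    rcases ecount_step r e t σ with h1 | h1
    · omega
    · rcases Nat.lt_or_ge t m with h2 | h2
      · have aux : ∀ u, ecount e (st r u σ) ≤ u := by
          intro u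
          induction u with
          | zero => simp [st, ecount]
          | succ u ih2 => rcases ecount_step r e u σ with h | h <;> omega
        have := aux (t+1); omega
      · exact absurd ⟨h1.2.1, h1.2.2.1⟩ (h t h2 (by omega))

theorem ecount_le_self (r : ℕ → Option (List Bool)) (e σ t) : ecount e (st r t σ) ≤ t :=
  ecount_le r e σ t t (fun s h1 h2 => by omega)

theorem exists_release {r : ℕ → Option (List Bool)} {e σ m t} (h : m < ecount e (st r t σ)) :
    ∃ s τ, m ≤ s ∧ s < t ∧ r s = some τ ∧ τ <+: σ ∧ s.unpair.1 = e := by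
  by_contra hcon
  have := ecount_le r e σ m t (fun s h1 h2 h3 => by
    obtain ⟨τ, h4, h5⟩ := bitOf_true.1 h3.1
    exact hcon ⟨s, τ, h1, h2, h4, h5, h3.2⟩)
  omega

def Qn (r : ℕ → Option (List Bool)) (e n : ℕ) (ρ : List Bool) : Prop := n ≤ ecount e (st r ρ.length ρ)

theorem Sys.Qn_up {Y r k} (S : Sys Y r k) {e n ρ ρ'} (h : ρ <+: ρ') (hq : Qn r e n ρ) : Qn r e n ρ' := by
  unfold Qn at *
  rw [S.st_pfx h le_rfl] at hq
  exact hq.trans (ecount_mono r e ρ' h.length_le)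

theorem Qn_len {r : ℕ → Option (List Bool)} {e n ρ} (hq : Qn r e n ρ) : n ≤ ρ.length :=
  le_trans hq (ecount_le_self _ _ _ _)

def Un (Y : List Bool → List Bool) (r : ℕ → Option (List Bool)) (e n : ℕ) : Set (ℕ → Bool) :=
  ⋃ s, {X | Qn r e n (Y (restr X s))}

def NN (Y : List Bool → List Bool) (r : ℕ → Option (List Bool)) (e : ℕ) : Set (ℕ → Bool) := ⋂ n, Un Y r e n

theorem meas_Un (Y r e n) : MeasurableSet (Un Y r e n) :=
  MeasurableSet.iUnion fun s => meas_restr s (fun x => Qn r e n (Y x))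

theorem meas_NN (Y r e) : MeasurableSet (NN Y r e) := MeasurableSet.iInter fun n => meas_Un Y r e n

theorem Un_anti (Y r e) : Antitone (Un Y r e) := by
  intro n n' h X hX
  obtain ⟨s, hs⟩ := Set.mem_iUnion.1 hX
  exact Set.mem_iUnion.2 ⟨s, le_trans h hs⟩

/-- long outputs with many releases -/
theorem Sys.NN_long {Y r k} (S : Sys Y r k) {e X ρ} (hX : X ∈ NN Y r e) (hρ : X ∈ CC Y ρ) (n : ℕ) :
    ∃ y, ρ <+: y ∧ X ∈ CC Y y ∧ n ≤ ecount e (st r y.length y) := by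
  have h1 := Set.mem_iInter.1 hX (max n ρ.length)
  obtain ⟨s, hs⟩ := Set.mem_iUnion.1 h1
  have hs : Qn r e (max n ρ.length) (Y (restr X s)) := hs
  have hy : X ∈ CC Y (Y (restr X s)) := CS_sub_CC Y s _ List.prefix_rfl
  refine ⟨Y (restr X s), ?_, hy, le_trans (le_max_left _ _) hs⟩
  have hl := Qn_len hs
  rcases S.comparable hρ hy with h | h
  · exact h
  · rw [h.eq_of_length_le (le_trans (le_max_right _ _) hl)]

def Rel (r : ℕ → Option (List Bool)) (e : ℕ) (f : List Bool) (j : ℕ) (σ : List Bool) : Prop :=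
  r j = some σ ∧ j.unpair.1 = e ∧ f <+: σ ∧ (st r j σ).2.2 = some (e, f.length)

def Mf (Y : List Bool → List Bool) (r : ℕ → Option (List Bool)) (k e s : ℕ) (f : List Bool) : Set (ℕ → Bool) :=
  {X | ∃ τ, f <+: τ ∧ Leaf Y r k e s τ ∧ (st r s τ).2.2 = some (e, f.length) ∧ τ <+: Y (restr X s)}

def Dt (Y : List Bool → List Bool) (r : ℕ → Option (List Bool)) (e : ℕ) (f : List Bool) (t : ℕ) : Set (ℕ → Bool) :=
  CC Y f \ ⋃ p ∈ {p : ℕ × List Bool | p.1 < t ∧ Rel r e f p.1 p.2}, CC Y p.2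

theorem meas_Dt (Y r e f t) : MeasurableSet (Dt Y r e f t) :=
  (meas_CC Y f).diff (MeasurableSet.biUnion (Set.to_countable _) fun p _ => meas_CC Y p.2)

theorem mem_Dt {Y r e f t} {X : ℕ → Bool} : X ∈ Dt Y r e f t ↔ X ∈ CC Y f ∧ ∀ j < t, ∀ σ, Rel r e f j σ → X ∉ CC Y σ := by
  simp only [Dt, Set.mem_sdiff, Set.mem_iUnion, not_exists, Set.mem_ofPred_eq, Prod.forall, and_imp]
  constructor
  · rintro ⟨h1, h2⟩; exact ⟨h1, fun j hj σ h => h2 j σ hj h⟩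
  · rintro ⟨h1, h2⟩; exact ⟨h1, fun j σ hj h => h2 j hj σ h⟩

/-- a leaf with root `f` at `s` is incompatible with all earlier releases with root `f` -/
theorem Sys.rel_leaf {Y r k} (S : Sys Y r k) {e s f j σ τ X} (hL : Leaf Y r k e s τ) (hm : (st r s τ).2.2 = some (e, f.length))
    (hR : Rel r e f j σ) (hj : j < s) (h1 : X ∈ CC Y τ) (h2 : X ∈ CC Y σ) : False := by
  obtain ⟨hr, hu, hf, hmo⟩ := hR
  have A1 := active_of_mode hmo
  have hle := A1.le
  obtain ⟨ρ, hρ1, hρ2⟩ : ∃ ρ, τ <+: ρ ∧ σ <+: ρ := by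
    rcases S.comparable h1 h2 with h | h
    · exact ⟨σ, h, List.prefix_rfl⟩
    · exact ⟨τ, List.prefix_rfl, h⟩
  have e1 := S.release hr hρ2
  rw [← S.leaf_st hL le_rfl hρ1] at hm
  have A := active_of_mode hm
  have e2 := A.const' (i := j+1) (by omega) (by omega)
  rw [← e2, e1] at hm
  simp at hm

theorem Sys.Mf_sub {Y r k} (S : Sys Y r k) {e s f t} (h : ∀ j, s ≤ j → j < t → ∀ σ, ¬ Rel r e f j σ) :
    Mf Y r k e s f ⊆ Dt Y r e f t := by
  rintro X ⟨τ, hf, hL, hm, hτ⟩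
  have hX : X ∈ CC Y τ := CS_sub_CC Y s τ hτ
  rw [mem_Dt]
  refine ⟨CC_anti Y hf hX, fun j hj σ hR hσ => ?_⟩
  rcases Nat.lt_or_ge j s with h1 | h1
  · exact S.rel_leaf hL hm hR h1 hX hσ
  · exact h j h1 hj σ hR

theorem pow_half (K : ℕ) : ((2 : ℝ≥0∞) ^ K)⁻¹ = ((2 : ℝ≥0∞) ^ (K+1))⁻¹ + ((2 : ℝ≥0∞) ^ (K+1))⁻¹ := by
  rw [← two_mul, pow_succ, ENNReal.mul_inv (by simp) (by simp), mul_comm, mul_assoc, ENNReal.inv_mul_cancel (by simp) (by simp), mul_one]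

theorem Sys.Dt_big {Y r k} (S : Sys Y r k) {e f} (hroot : (st r f.length f).2.2 = some (e, f.length)) (s t : ℕ) :
    ((2 : ℝ≥0∞) ^ (k + e + 2 + 1))⁻¹ * lam (Mf Y r k e s f) ≤ lam (Dt Y r e f t) := by
  classical
  by_cases hex : ∃ j, s ≤ j ∧ j < t ∧ ∃ σ, Rel r e f j σ
  swap
  · calc _ ≤ 1 * lam (Mf Y r k e s f) := by gcongr; simp [ENNReal.inv_le_one]; exact one_le_pow₀ (by norm_num)
      _ = lam (Mf Y r k e s f) := one_mul _
      _ ≤ _ := measure_mono (S.Mf_sub fun j h1 h2 σ h3 => hex ⟨j, h1, h2, σ, h3⟩)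
  obtain ⟨i, ⟨hsi, hit, σ, hR⟩, hmax⟩ : ∃ i, (s ≤ i ∧ i < t ∧ ∃ σ, Rel r e f i σ) ∧ ∀ j, (s ≤ j ∧ j < t ∧ ∃ σ, Rel r e f j σ) → j ≤ i := by
    obtain ⟨j0, hj0⟩ := hex
    refine ⟨Nat.findGreatest (fun j => s ≤ j ∧ j < t ∧ ∃ σ, Rel r e f j σ) t, ?_, ?_⟩
    · exact Nat.findGreatest_spec (P := fun j => s ≤ j ∧ j < t ∧ ∃ σ, Rel r e f j σ) (by omega : j0 ≤ t) hj0
    · intro j hj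
      exact Nat.le_findGreatest (by omega) hj
  have hR' := hR
  obtain ⟨hr, hu, hf, hmo⟩ := hR
  have Aσ := active_of_mode hmo
  have hfi : f.length ≤ i := Aσ.le
  obtain ⟨hLσ, hlen, hE, hcnt⟩ := S.elig hr
  rw [hu] at hLσ hE hcnt
  have hout : (st r i σ).1 = (st r f.length f).1 := by
    rw [S.st_pfx hf le_rfl, Aσ.const' le_rfl hfi]
  rw [hout] at hE
  -- the difference is in Dt
  have hsub : MS Y r k e i f ⊆ Dt Y r e f t ∪ CS Y i σ := by
    intro X hX
    obtain ⟨τ, hfτ, hL, hτ⟩ := mem_MS.1 hX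
    have hXτ : X ∈ CC Y τ := CS_sub_CC Y i τ hτ
    by_cases hXσ : X ∈ CC Y σ
    · right
      have : τ = σ := by
        rcases S.comparable hXτ hXσ with h | h
        · exact S.leaf_unique hL hLσ h
        · exact (S.leaf_unique hLσ hL h).symm
      rw [← this]; exact hτ
    · left
      rw [mem_Dt]
      refine ⟨CC_anti Y hfτ hXτ, fun j hj σ' hR1 hX' => ?_⟩
      have hji : j ≤ i := by
        rcases Nat.lt_or_ge j s with h | h
        · omega
        · exact hmax j ⟨h, hj, σ', hR1⟩
      rcases Nat.lt_or_ge j i with h | h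
      · have hL' := hL
        obtain ⟨n', hn', hm', -, -⟩ := hL'
        have e1 : (st r f.length τ).2.2 = some (e, f.length) := by rw [← S.st_pfx hfτ le_rfl]; exact hroot
        rcases active_sep e1 hm' hfi with h2 | h2
        · simp only [Prod.mk.injEq, true_and] at h2
          rw [← h2] at hm'
          exact S.rel_leaf hL hm' hR1 h hXτ hX'
        · obtain ⟨t'', ht'', hs''⟩ := later_attempt e1 hm' h2
          rw [← S.st_pfx hfτ le_rfl] at hs''
          have := Efun_mono (t' := i) (by have := (active_of_mode hm').le; omega) hs''
          rw [hE] at this; simp at this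
      · have : j = i := by omega
        subst this
        have := hR1.1
        rw [hr] at this
        cases this
        exact hXσ hX'
  have h1 := hcnt f.length (by have := hf.length_le; omega)
  rw [take_of_pfx hf, cnt_lt_iff, pow_half] at h1
  have h2 : lam (CS Y i σ) ≤ ((2 : ℝ≥0∞) ^ (k + e + 2 + 1))⁻¹ * lam (CS Y i f) := by
    obtain ⟨n', hn', hm', ⟨z, hz, hzp, hzs⟩, -⟩ := hLσ
    rw [hmo] at hm'
    simp only [Option.some.injEq, Prod.mk.injEq, true_and] at hm'
    rw [← hm', take_of_pfx hf] at hzp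
    have hc := S.cnt_mono (by omega : z ≤ i) f
    have key : cnt Y i σ * 2 ^ (k + e + 2 + 1) ≤ cnt Y i f := by
      have : cnt Y i σ * 2 ^ (k + e + 2 + 1) * 2 ^ z ≤ cnt Y i f * 2 ^ z := by
        calc _ = cnt Y i σ * 2 ^ (k + e + 2 + 1 + z) := by rw [pow_add _ _ z, mul_assoc]
          _ ≤ 2 ^ i := hzs
          _ ≤ cnt Y z f * 2 ^ i := Nat.le_mul_of_pos_left _ hzp
          _ ≤ _ := hc
      exact Nat.le_of_mul_le_mul_right this (by positivity)
    rw [lam_CS, lam_CS, mul_comm, div_eq_mul_inv (cnt Y i f : ℝ≥0∞), mul_assoc,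
      ← ENNReal.mul_inv (by simp) (by simp), ← pow_add, ← div_eq_mul_inv, div_le_div_nat, pow_add, mul_comm (2 ^ i), ← mul_assoc]
    exact Nat.mul_le_mul_right _ key
  have h3 : lam (MS Y r k e i f) ≤ lam (Dt Y r e f t) + ((2 : ℝ≥0∞) ^ (k + e + 2 + 1))⁻¹ * lam (CS Y i f) :=
    (measure_mono hsub).trans ((measure_union_le _ _).trans (by gcongr))
  have h4 := h1.le.trans h3
  rw [add_mul] at h4
  have h5 : ((2 : ℝ≥0∞) ^ (k + e + 2 + 1))⁻¹ * lam (CS Y i f) ≤ lam (Dt Y r e f t) :=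
    ENNReal.le_of_add_le_add_right (ENNReal.mul_ne_top (by simp) (measure_ne_top _ _)) h4
  refine le_trans ?_ h5
  gcongr
  rintro X ⟨τ, hfτ, _, _, hτ⟩
  exact S.CS_mono hsi f (CS_anti Y s hfτ hτ)

theorem Sys.exists_rel {Y r k} (S : Sys Y r k) {e f X} (hroot : (st r f.length f).2.2 = some (e, f.length))
    (hf : X ∈ CC Y f) (hN : X ∈ NN Y r e) : ∃ j σ, Rel r e f j σ ∧ X ∈ CC Y σ := by
  obtain ⟨y, hfy, hy, hc⟩ := S.NN_long hN hf (f.length + 1)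
  obtain ⟨j, σ', hj, hjy, hr, hσ, hu⟩ := exists_release (Nat.lt_of_succ_le hc)
  have hLσ := (S.elig hr).1
  rw [hu] at hLσ
  have hst := S.leaf_st hLσ le_rfl hσ
  obtain ⟨n', hn', hm', -, -⟩ := hLσ
  have e1 : (st r f.length y).2.2 = some (e, f.length) := by rw [← S.st_pfx hfy le_rfl]; exact hroot
  rw [← hst] at hm'
  rcases active_sep e1 hm' hj with h2 | h2
  · simp only [Prod.mk.injEq, true_and] at h2
    refine ⟨j, σ', ⟨hr, hu, ?_, by rw [← hst, hm', h2]⟩, CC_anti Y hσ hy⟩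
    exact List.prefix_of_prefix_length_le hfy hσ (by omega)
  · have A := active_of_mode hm'
    have inv : ∀ t, f.length ≤ t → st r t y = st r f.length y ∨ (∃ j σ, Rel r e f j σ ∧ σ <+: y) ∨
        ∃ ev ∈ (st r t y).2.1, ev.1 = 2 ∧ ev.2.1 = e := by
      intro t ht
      induction t, ht using Nat.le_induction with
      | base => exact Or.inl rfl
      | succ t ht ih =>
        rcases ih with h3 | h3 | ⟨ev, h3, h4⟩
        · rw [st, h3, nxt_of_some e1]; unfold nxtSome
          split
          · right; right; simp
          · split_ifs with hb
            · right; left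
              obtain ⟨τ, hτ1, hτ2⟩ := bitOf_true.1 hb.1
              have hLτ := (S.elig hτ1).1
              have hst2 := S.leaf_st hLτ le_rfl hτ2
              obtain ⟨n2, hn2, hm2, -, -⟩ := hLτ
              have hu2 : t.unpair.1 = e := hb.2
              have hm3 : (st r t τ).2.2 = some (e, f.length) := by rw [← hst2, h3, e1]
              rw [hm3] at hm2
              simp only [Option.some.injEq, Prod.mk.injEq] at hm2
              exact ⟨t, τ, ⟨hτ1, hu2, List.prefix_of_prefix_length_le hfy hτ2 (by omega), hm3⟩, hτ2⟩
            · left; rfl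
        · exact Or.inr (Or.inl h3)
        · exact Or.inr (Or.inr ⟨ev, hist_mono (Nat.le_succ t) h3, h4⟩)
    rcases inv (n'-1) (by omega) with h3 | ⟨j, σ, h3, h4⟩ | ⟨ev, h3, h4, h5⟩
    · have := A.mode0
      rw [h3, e1] at this; simp at this
    · exact ⟨j, σ, h3, CC_anti Y h4 hy⟩
    · have := A.ok _ h3
      simp [h4, h5] at this

theorem Sys.Mf_le {Y r k} (S : Sys Y r k) {e f} (hroot : (st r f.length f).2.2 = some (e, f.length)) (s : ℕ) :
    ((2 : ℝ≥0∞) ^ (k + e + 2 + 1))⁻¹ * lam (Mf Y r k e s f) ≤ lam (CC Y f ∩ (NN Y r e)ᶜ) := by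
  have hsub : ⋂ t, Dt Y r e f t ⊆ CC Y f ∩ (NN Y r e)ᶜ := by
    intro X hX
    rw [Set.mem_iInter] at hX
    have hf := (mem_Dt.1 (hX 0)).1
    refine ⟨hf, fun hN => ?_⟩
    obtain ⟨j, σ, hR, hσ⟩ := S.exists_rel hroot hf hN
    exact (mem_Dt.1 (hX (j+1))).2 j (by omega) σ hR hσ
  refine le_trans ?_ (measure_mono hsub)
  have hanti : Antitone (Dt Y r e f) := by
    intro a b hab X hX
    rw [mem_Dt] at hX ⊢
    exact ⟨hX.1, fun j hj => hX.2 j (by omega)⟩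
  rw [hanti.measure_iInter (fun t => (meas_Dt Y r e f t).nullMeasurableSet) ⟨0, measure_ne_top _ _⟩]
  exact le_iInf fun t => S.Dt_big hroot s t

theorem Sys.MS_le {Y r k} (S : Sys Y r k) {e ρ s} (hnone : (st r ρ.length ρ).2.2 = none) (hs : ρ.length ≤ s) :
    ((2 : ℝ≥0∞) ^ (k + e + 2 + 1))⁻¹ * lam (MS Y r k e s ρ) ≤ lam (CC Y ρ ∩ (NN Y r e)ᶜ) := by
  set F : Set (List Bool) := {f | ρ <+: f ∧ (st r f.length f).2.2 = some (e, f.length) ∧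
    ∃ τ, f <+: τ ∧ (st r s τ).2.2 = some (e, f.length)} with hF
  have hMS : MS Y r k e s ρ ⊆ ⋃ f ∈ F, Mf Y r k e s f := by
    intro X hX
    obtain ⟨τ, hρτ, hL, hτ⟩ := mem_MS.1 hX
    have hL' := hL
    obtain ⟨n, hn, hm, -, -⟩ := hL
    have A := active_of_mode hm
    have hlt : ρ.length < n := by
      by_contra hcon
      have := A.const' (i := ρ.length) (by omega) hs
      rw [← S.st_pfx hρτ le_rfl] at this
      rw [← this, hnone] at hm; simp at hm
    have hfl : (τ.take n).length = n := by simp; omega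
    simp only [Set.mem_iUnion]
    refine ⟨τ.take n, ⟨?_, ?_, τ, take_pfx _ _, ?_⟩, τ, take_pfx _ _, hL', ?_, hτ⟩
    · exact List.prefix_of_prefix_length_le hρτ (take_pfx _ _) (by omega)
    · rw [S.st_pfx (take_pfx n τ) le_rfl, hfl, A.const' le_rfl A.le, hm]
    · rw [hfl, hm]
    · rw [hfl, hm]
  have anti : ∀ f ∈ F, ∀ f' ∈ F, f <+: f' → f = f' := by
    rintro f ⟨_, hr1, τ, hfτ, hm⟩ f' ⟨_, hr2, τ', hfτ', hm'⟩ hff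
    by_contra hne
    have hlen : f.length < f'.length := by
      rcases Nat.lt_or_ge f.length f'.length with h1 | h1
      · exact h1
      · exact absurd (hff.eq_of_length_le h1) hne
    have e1 : (st r f.length τ').2.2 = some (e, f.length) := by rw [← S.st_pfx (hff.trans hfτ') le_rfl]; exact hr1
    obtain ⟨t, ht, hE⟩ := later_attempt e1 hm' hlen
    have A := active_of_mode hm
    have A' := active_of_mode hm'
    have hle := A'.le
    have hq := A.quietE (i := f'.length - 1) (by omega) (by omega)
    rw [← A.const' le_rfl A.le, ← S.st_pfx hfτ le_rfl] at hq
    rw [← S.st_pfx (hff.trans hfτ') le_rfl] at hE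
    have := Efun_mono (t' := f'.length - 1) (by omega) hE
    rw [hq] at this; simp at this
  have hd : F.PairwiseDisjoint (CC Y) := by
    intro a ha b hb hab
    refine Set.disjoint_left.2 fun X h1 h2 => hab ?_
    rcases S.comparable h1 h2 with h | h
    · exact anti a ha b hb h
    · exact (anti b hb a ha h).symm
  calc _ ≤ ((2 : ℝ≥0∞) ^ (k + e + 2 + 1))⁻¹ * lam (⋃ f ∈ F, Mf Y r k e s f) := by gcongr
    _ ≤ lam ((⋃ f ∈ F, CC Y f) ∩ (NN Y r e)ᶜ) := sum_disj F (CC Y) (Mf Y r k e s) _ _ (fun f _ => meas_CC Y f)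
        (meas_NN Y r e).compl hd (fun f hf => S.Mf_le hf.2.1 s)
    _ ≤ _ := by
      apply measure_mono
      apply Set.inter_subset_inter_left
      exact Set.iUnion₂_subset fun f hf => CC_anti Y hf.1

theorem Sys.CC_le {Y r k} (S : Sys Y r k) {e ρ} (hnone : (st r ρ.length ρ).2.2 = none) :
    ((2 : ℝ≥0∞) ^ (k + e + 2 + 1))⁻¹ * ((2 : ℝ≥0∞) ^ (k + e + 2 + 1))⁻¹ * lam (CC Y ρ) ≤ lam (CC Y ρ ∩ (NN Y r e)ᶜ) := by
  have hle1 : ((2 : ℝ≥0∞) ^ (k + e + 2 + 1))⁻¹ ≤ 1 := by simp [ENNReal.inv_le_one]; exact one_le_pow₀ (by norm_num)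
  by_cases hnon : (CC Y ρ ∩ NN Y r e).Nonempty
  swap
  · have : CC Y ρ ∩ (NN Y r e)ᶜ = CC Y ρ := by
      apply Set.inter_eq_left.2
      intro X hX hN
      exact hnon ⟨X, hX, hN⟩
    rw [this]
    calc _ ≤ 1 * 1 * lam (CC Y ρ) := by gcongr
      _ = _ := by simp
  obtain ⟨X, hXρ, hN⟩ := hnon
  by_cases h0 : lam (CC Y ρ) = 0
  · rw [h0]; simp
  obtain ⟨s0, hs0⟩ : ∃ s0, lam (CC Y ρ) / 2 < lam (CS Y s0 ρ) := by
    have h1 : lam (CC Y ρ) / 2 < lam (CC Y ρ) := ENNReal.half_lt_self h0 (measure_ne_top _ _)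
    conv_rhs at h1 => rw [CC]
    rw [Monotone.measure_iUnion (fun a b h => S.CS_mono h ρ), lt_iSup_iff] at h1
    exact h1
  obtain ⟨y, hρy, hy, hc⟩ := S.NN_long hN hXρ (max s0 ρ.length + 1)
  obtain ⟨s, σ, hj, hjy, hr, hσ, hu⟩ := exists_release (Nat.lt_of_succ_le hc)
  obtain ⟨hLσ, hlen, hE, hcnt⟩ := S.elig hr
  rw [hu] at hLσ hE hcnt
  have hst := S.leaf_st hLσ le_rfl hσ
  obtain ⟨n, hn, hm, -, -⟩ := hLσ
  rw [← hst] at hm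
  have A := active_of_mode hm
  have h1 : s0 ≤ s := le_trans (le_max_left _ _) hj
  have h2 : ρ.length ≤ s := le_trans (le_max_right _ _) hj
  have hlt : ρ.length < n := by
    by_contra hcon
    have := A.const' (i := ρ.length) (by omega) h2
    rw [← S.st_pfx hρy le_rfl] at this
    rw [← this, hnone] at hm; simp at hm
  have hρσ : ρ <+: σ := List.prefix_of_prefix_length_le hρy hσ (by omega)
  have h3 := hcnt ρ.length (by omega)
  rw [take_of_pfx hρσ, cnt_lt_iff] at h3
  refine le_trans ?_ (S.MS_le hnone h2)
  rw [mul_assoc]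
  gcongr
  calc ((2 : ℝ≥0∞) ^ (k + e + 2 + 1))⁻¹ * lam (CC Y ρ) = ((2 : ℝ≥0∞) ^ (k + e + 2))⁻¹ * (lam (CC Y ρ) / 2) := by
        rw [pow_succ, ENNReal.mul_inv (by simp) (by simp), div_eq_mul_inv, mul_assoc, mul_comm (2⁻¹)]
    _ ≤ ((2 : ℝ≥0∞) ^ (k + e + 2))⁻¹ * lam (CS Y s ρ) := by
        gcongr
        exact hs0.le.trans (measure_mono (S.CS_mono h1 ρ))
    _ ≤ _ := h3.le

theorem Sys.Un_le {Y r k} (S : Sys Y r k) (e n) :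
    ((2 : ℝ≥0∞) ^ (k + e + 2 + 1))⁻¹ * ((2 : ℝ≥0∞) ^ (k + e + 2 + 1))⁻¹ * lam (Un Y r e (n+1)) ≤ lam (Un Y r e (n+1) ∩ (NN Y r e)ᶜ) := by
  have hU : Un Y r e (n+1) = ⋃ ρ ∈ minP (Qn r e (n+1)), CC Y ρ := by
    ext X
    simp only [Set.mem_iUnion]
    constructor
    · intro hX
      obtain ⟨s, hs⟩ := Set.mem_iUnion.1 hX
      obtain ⟨ρ, h1, h2⟩ := exists_minP (Q := Qn r e (n+1)) hs
      exact ⟨ρ, h1, CS_sub_CC Y s _ h2⟩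
    · rintro ⟨ρ, h1, h2⟩
      obtain ⟨s, hs⟩ := Set.mem_iUnion.1 h2
      exact Set.mem_iUnion.2 ⟨s, S.Qn_up hs h1.1⟩
  rw [hU]
  refine sum_disj _ (CC Y) (CC Y) _ _ (fun f _ => meas_CC Y f) (meas_NN Y r e).compl (S.minP_disj _) ?_
  intro ρ hρ
  apply S.CC_le
  obtain ⟨h1, h2⟩ := hρ
  have hpos : 1 ≤ ρ.length := le_trans (by omega) (Qn_len h1)
  obtain ⟨l, hl⟩ : ∃ l, ρ.length = l + 1 := ⟨ρ.length - 1, by omega⟩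
  have htl : (ρ.take l).length = l := by simp; omega
  have h3 : ¬ Qn r e (n+1) (ρ.take l) := by
    intro hq
    have := h2 _ (take_pfx _ _) hq
    rw [this] at htl; omega
  unfold Qn at h1 h3
  rw [S.st_pfx (take_pfx l ρ) le_rfl, htl] at h3
  rw [hl] at h1 ⊢
  rcases ecount_step r e l ρ with h | h
  · omega
  · exact h.2.2.2

theorem Sys.NN_null {Y r k} (S : Sys Y r k) (e) : lam (NN Y r e) = 0 := by
  set c := ((2 : ℝ≥0∞) ^ (k + e + 2 + 1))⁻¹ * ((2 : ℝ≥0∞) ^ (k + e + 2 + 1))⁻¹ with hc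
  have h0 : ⋂ n, (Un Y r e (n+1) ∩ (NN Y r e)ᶜ) = ∅ := by
    rw [Set.eq_empty_iff_forall_notMem]
    intro X hX
    rw [Set.mem_iInter] at hX
    apply (hX 0).2
    refine Set.mem_iInter.2 fun n => Un_anti Y r e (Nat.le_succ n) (hX n).1
  have hanti : Antitone (fun n => Un Y r e (n+1) ∩ (NN Y r e)ᶜ) := by
    intro a b hab
    exact Set.inter_subset_inter_left _ (Un_anti Y r e (by omega))
  have h1 := hanti.measure_iInter (μ := lam) (fun n => ((meas_Un Y r e (n+1)).inter (meas_NN Y r e).compl).nullMeasurableSet) ⟨0, measure_ne_top _ _⟩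
  rw [h0, measure_empty] at h1
  have h2 : c * lam (NN Y r e) ≤ 0 := by
    rw [h1]
    refine le_iInf fun n => le_trans ?_ (S.Un_le e n)
    gcongr
    exact Set.iInter_subset _ _
  have h3 : c * lam (NN Y r e) = 0 := le_antisymm h2 (zero_le)
  rcases mul_eq_zero.1 h3 with h | h
  · exfalso
    rw [hc] at h
    rcases mul_eq_zero.1 h with h | h <;> simp at h
  · exact h


end part7_block

section part8_block
open MeasureTheory

section pr
variable {α β : Type} [Primcodable α] [Primcodable β]

theorem pr_filter {f : α → List β} {R : α → β → Prop} [∀ a, DecidablePred (R a)] (hf : Primrec f) (hR : PrimrecRel R) :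
    Primrec fun a => (f a).filter (fun b => decide (R a b)) := by
  have h : Primrec fun a => (f a).filterMap (fun b => if R a b then some b else none) :=
    Primrec.listFilterMap hf (Primrec.ite hR (Primrec.option_some.comp Primrec.snd) (Primrec.const none))
  refine h.of_eq fun a => ?_
  rw [← List.filterMap_eq_filter]
  congr 1
  funext b
  simp [Option.guard]

theorem pr_exists_mem {f : α → List β} {R : α → β → Prop} (hf : Primrec f) (hR : PrimrecRel R) :
    PrimrecPred fun a => ∃ b ∈ f a, R a b := by
  classical
  refine PrimrecPred.of_eq (p := fun a => ¬ ((f a).filter (fun b => decide (R a b))).length = 0) ?_ ?_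
  · exact PrimrecPred.not (Primrec.eq.comp (Primrec.list_length.comp (pr_filter hf hR)) (Primrec.const 0))
  · intro a; simp

theorem pr_forall_mem {f : α → List β} {R : α → β → Prop} (hf : Primrec f) (hR : PrimrecRel R) :
    PrimrecPred fun a => ∀ b ∈ f a, R a b := by
  refine PrimrecPred.of_eq (PrimrecPred.not (pr_exists_mem hf (R := fun a b => ¬ R a b) (PrimrecPred.not hR))) ?_
  intro a; simp

theorem pr_exists_lt {g : α → ℕ} {R : α → ℕ → Prop} (hg : Primrec g) (hR : PrimrecRel R) :
    PrimrecPred fun a => ∃ m < g a, R a m :=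
  PrimrecPred.of_eq (pr_exists_mem (Primrec.list_range.comp hg) hR) (fun a => by simp)

theorem pr_forall_lt {g : α → ℕ} {R : α → ℕ → Prop} (hg : Primrec g) (hR : PrimrecRel R) :
    PrimrecPred fun a => ∀ m < g a, R a m :=
  PrimrecPred.of_eq (pr_forall_mem (Primrec.list_range.comp hg) hR) (fun a => by simp)

theorem pr_pow {g : α → ℕ} (hg : Primrec g) : Primrec fun a => 2 ^ g a := by
  have h : Primrec fun n : ℕ => 2 ^ n := by
    have : Primrec (fun s : ℕ => Nat.rec (motive := fun _ => ℕ) 1 (fun _ l => l + l) s) :=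
      Primrec.nat_rec₁ _ (Primrec.nat_add.comp Primrec.snd Primrec.snd)
    refine this.of_eq fun n => ?_
    induction n with
    | zero => rfl
    | succ n ih => simp only at ih ⊢; rw [ih]; ring
  exact h.comp hg

theorem pr_take {f : α → List β} {g : α → ℕ} (hf : Primrec f) (hg : Primrec g) : Primrec fun a => (f a).take (g a) := by
  have h : Primrec fun a => (List.range (g a)).filterMap (fun i => (f a)[i]?) :=
    Primrec.listFilterMap (Primrec.list_range.comp hg) (Primrec.list_getElem?.comp (hf.comp Primrec.fst) Primrec.snd)
  refine h.of_eq fun a => ?_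
  generalize g a = n
  generalize f a = l
  induction n with
  | zero => simp
  | succ n ih =>
    rw [List.range_succ, List.filterMap_append, ih, List.take_add_one]
    congr 1

end pr

theorem unpair1_pr {α : Type} [Primcodable α] {f : α → ℕ} (hf : Primrec f) : Primrec fun a => (f a).unpair.1 :=
  Primrec.fst.comp (Primrec.unpair.comp hf)

theorem Efun_pr {α : Type} [Primcodable α] {t e : α → ℕ} {σ : α → List Bool} (h1 : Primrec t) (h2 : Primrec e) (h3 : Primrec σ) :
    Primrec fun a => Efun (t a) (e a) (σ a) :=
  Efun_primrec.comp (Primrec.pair (Primrec.pair h1 h2) h3)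

abbrev Ev := ℕ × ℕ × List Bool

theorem isSome_pr {α β : Type} [Primcodable α] [Primcodable β] {f : α → Option β} (h : Primrec f) : PrimrecPred fun a => (f a).isSome = true :=
  Primrec.eq.comp (Primrec.option_isSome.comp h) (Primrec.const true)

theorem isNone_pr {α β : Type} [Primcodable α] [Primcodable β] {f : α → Option β} (h : Primrec f) : PrimrecPred fun a => f a = none := by
  classical
  exact PrimrecPred.of_eq (PrimrecPred.not (isSome_pr h)) (fun a => by simp)

theorem attemptOK_pr : PrimrecPred fun p : (ℕ × ℕ) × List Ev => attemptOK p.1.1 p.1.2 p.2 := by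
  unfold attemptOK
  refine pr_forall_mem Primrec.snd ?_
  refine PrimrecPred.or ?_ (PrimrecPred.or ?_ (PrimrecPred.and ?_ ?_))
  · exact Primrec.eq.comp (Primrec.fst.comp Primrec.snd) (Primrec.const 0)
  · exact PrimrecPred.not (Primrec.eq.comp (Primrec.fst.comp (Primrec.snd.comp Primrec.snd)) (Primrec.snd.comp (Primrec.fst.comp Primrec.fst)))
  · exact Primrec.eq.comp (Primrec.fst.comp Primrec.snd) (Primrec.const 1)
  · exact isSome_pr (Efun_pr (Primrec.fst.comp (Primrec.fst.comp Primrec.fst)) (Primrec.snd.comp (Primrec.fst.comp Primrec.fst))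
      (Primrec.snd.comp (Primrec.snd.comp Primrec.snd)))

theorem snoc_pr {α : Type} [Primcodable α] {σ : α → List Bool} (h : Primrec σ) : Primrec fun a => σ a ++ [false] :=
  Primrec.list_append.comp h (Primrec.const [false])

theorem nxtNone_pr : Primrec fun p : ℕ × St => nxtNone p.1 p.2 := by
  unfold nxtNone
  have hlen : Primrec fun p : ℕ × St => p.2.2.1.length.unpair.1 :=
    unpair1_pr (Primrec.list_length.comp (Primrec.fst.comp (Primrec.snd.comp Primrec.snd)))
  have hout : Primrec fun p : ℕ × St => p.2.1 := Primrec.fst.comp Primrec.snd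
  have hhist : Primrec fun p : ℕ × St => p.2.2.1 := Primrec.fst.comp (Primrec.snd.comp Primrec.snd)
  refine Primrec.ite ?_ ?_ ?_
  · exact attemptOK_pr.comp (Primrec.pair (Primrec.pair Primrec.fst hlen) hhist)
  · exact Primrec.pair hout (Primrec.pair hhist (Primrec.option_some.comp (Primrec.pair hlen (Primrec.succ.comp Primrec.fst))))
  · exact Primrec.pair (snoc_pr hout) (Primrec.pair (Primrec.list_cons.comp (Primrec.pair (Primrec.const 0) (Primrec.pair hlen (snoc_pr hout))) hhist) (Primrec.const none))

theorem nxtSome_pr : Primrec fun p : (ℕ × St) × Bool × (ℕ × ℕ) => nxtSome p.1.1 p.1.2 p.2.1 p.2.2 := by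
  have ht : Primrec fun p : (ℕ × St) × Bool × (ℕ × ℕ) => p.1.1 := Primrec.fst.comp Primrec.fst
  have hS : Primrec fun p : (ℕ × St) × Bool × (ℕ × ℕ) => p.1.2 := Primrec.snd.comp Primrec.fst
  have hout : Primrec fun p : (ℕ × St) × Bool × (ℕ × ℕ) => p.1.2.1 := Primrec.fst.comp hS
  have hhist : Primrec fun p : (ℕ × St) × Bool × (ℕ × ℕ) => p.1.2.2.1 := Primrec.fst.comp (Primrec.snd.comp hS)
  have hm : Primrec fun p : (ℕ × St) × Bool × (ℕ × ℕ) => p.2.2.1 := Primrec.fst.comp (Primrec.snd.comp Primrec.snd)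
  have hb : Primrec fun p : (ℕ × St) × Bool × (ℕ × ℕ) => p.2.1 := Primrec.fst.comp Primrec.snd
  have h := Primrec.option_casesOn (o := fun p : (ℕ × St) × Bool × (ℕ × ℕ) => Efun p.1.1 p.2.2.1 p.1.2.1)
    (f := fun p => if p.2.1 = true ∧ p.1.1.unpair.1 = p.2.2.1 then
      ((p.1.2.1 ++ [false], (1, p.2.2.1, p.1.2.1 ++ [false]) :: p.1.2.2.1, none) : St) else p.1.2)
    (g := fun p τ => ((τ ++ [false], (2, p.2.2.1, τ ++ [false]) :: p.1.2.2.1, none) : St))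
    (Efun_pr ht hm hout)
    (by
      refine Primrec.ite (PrimrecPred.and ?_ ?_) ?_ hS
      · exact Primrec.eq.comp hb (Primrec.const true)
      · exact Primrec.eq.comp (unpair1_pr ht) hm
      · exact Primrec.pair (snoc_pr hout) (Primrec.pair (Primrec.list_cons.comp (Primrec.pair (Primrec.const 1) (Primrec.pair hm (snoc_pr hout))) hhist) (Primrec.const none)))
    (by
      exact Primrec.pair (snoc_pr Primrec.snd) (Primrec.pair (Primrec.list_cons.comp (Primrec.pair (Primrec.const 2)
        (Primrec.pair (hm.comp Primrec.fst) (snoc_pr Primrec.snd))) (hhist.comp Primrec.fst)) (Primrec.const none)))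
  refine h.of_eq fun p => ?_
  unfold nxtSome
  cases Efun p.1.1 p.2.2.1 p.1.2.1 <;> rfl

theorem nxt_pr : Primrec fun p : (ℕ × St) × Bool => nxt p.1.1 p.1.2 p.2 := by
  have h := Primrec.option_casesOn (o := fun p : (ℕ × St) × Bool => p.1.2.2.2)
    (f := fun p => nxtNone p.1.1 p.1.2) (g := fun p m => nxtSome p.1.1 p.1.2 p.2 m)
    (Primrec.snd.comp (Primrec.snd.comp (Primrec.snd.comp Primrec.fst))) (nxtNone_pr.comp Primrec.fst)
    (nxtSome_pr.comp (Primrec.pair (Primrec.fst.comp Primrec.fst) (Primrec.pair (Primrec.snd.comp Primrec.fst) Primrec.snd)))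
  refine h.of_eq fun p => ?_
  unfold nxt
  cases p.1.2.2.2 <;> rfl

theorem bitOf_pr : Primrec fun p : Option (List Bool) × List Bool => bitOf p.1 p.2 := by
  have h := Primrec.option_casesOn (o := fun p : Option (List Bool) × List Bool => p.1)
    (f := fun p => false) (g := fun p ρ => decide (ρ <+: p.2)) Primrec.fst (Primrec.const false)
    (PrimrecPred.decide (primrec_pfx.comp Primrec.snd (Primrec.snd.comp Primrec.fst)))
  refine h.of_eq fun p => ?_
  unfold bitOf
  cases p.1 <;> rfl

/-- lookup in a finite table -/
def lk (l : List (Option (List Bool))) (i : ℕ) : Option (List Bool) := l.getD i none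

abbrev RT := List (Option (List Bool))

theorem lk_pr : Primrec₂ lk := Primrec.list_getD none

theorem st_pr {α : Type} [Primcodable α] {l : α → RT} {t : α → ℕ} {σ : α → List Bool} (h1 : Primrec l) (h2 : Primrec t) (h3 : Primrec σ) :
    Primrec fun a => st (lk (l a)) (t a) (σ a) := by
  have h := Primrec.nat_rec' (f := t) (g := fun _ => (([], [], none) : St))
    (h := fun a p => nxt p.1 p.2 (bitOf (lk (l a) p.1) (σ a))) h2 (Primrec.const _)
    (nxt_pr.comp (Primrec.pair Primrec.snd (bitOf_pr.comp (Primrec.pair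
      (lk_pr.comp (h1.comp Primrec.fst) (Primrec.fst.comp Primrec.snd)) (h3.comp Primrec.fst)))))
  refine h.of_eq fun a => ?_
  generalize t a = n
  induction n with
  | zero => rfl
  | succ n ih => simp only at ih ⊢; rw [ih, st]

section withY
variable {Y : List Bool → List Bool} {α : Type} [Primcodable α]

theorem cnt_pr (hY : Primrec Y) {s : α → ℕ} {σ : α → List Bool} (h1 : Primrec s) (h2 : Primrec σ) :
    Primrec fun a => cnt Y (s a) (σ a) := by
  unfold cnt
  exact Primrec.list_length.comp (pr_filter (strs_primrec.comp h1)
    (primrec_pfx.comp (h2.comp Primrec.fst) (hY.comp Primrec.snd)))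

theorem small_pr (hY : Primrec Y) {K s : α → ℕ} {ρ σ : α → List Bool} (h0 : Primrec K) (h1 : Primrec s) (h2 : Primrec ρ) (h3 : Primrec σ) :
    PrimrecPred fun a => small Y (K a) (s a) (ρ a) (σ a) := by
  unfold small
  refine pr_exists_lt (Primrec.succ.comp h1) (PrimrecPred.and ?_ ?_)
  · exact Primrec.nat_lt.comp (Primrec.const 0) (cnt_pr hY Primrec.snd (h2.comp Primrec.fst))
  · refine Primrec.nat_le.comp (Primrec.nat_mul.comp (cnt_pr hY (h1.comp Primrec.fst) (h3.comp Primrec.fst)) (pr_pow ?_)) (pr_pow (h1.comp Primrec.fst))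
    exact Primrec.nat_add.comp (Primrec.succ.comp (h0.comp Primrec.fst)) Primrec.snd

theorem kee {k e : α → ℕ} (hk : Primrec k) (he : Primrec e) : Primrec fun a => k a + e a + 2 :=
  Primrec.nat_add.comp (Primrec.nat_add.comp hk he) (Primrec.const 2)

theorem Leaf_pr (hY : Primrec Y) {l : α → RT} {k e s : α → ℕ} {σ : α → List Bool} (hl : Primrec l) (hk : Primrec k) (he : Primrec e)
    (hs : Primrec s) (hσ : Primrec σ) : PrimrecPred fun a => Leaf Y (lk (l a)) (k a) (e a) (s a) (σ a) := by
  unfold Leaf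
  refine pr_exists_lt (Primrec.succ.comp (Primrec.list_length.comp hσ)) (PrimrecPred.and ?_ (PrimrecPred.and ?_ ?_))
  · exact Primrec.eq.comp (Primrec.snd.comp (Primrec.snd.comp (st_pr (hl.comp Primrec.fst) (hs.comp Primrec.fst) (hσ.comp Primrec.fst))))
      (Primrec.option_some.comp (Primrec.pair (he.comp Primrec.fst) Primrec.snd))
  · exact small_pr hY (kee (hk.comp Primrec.fst) (he.comp Primrec.fst)) (hs.comp Primrec.fst)
      (pr_take (hσ.comp Primrec.fst) Primrec.snd) (hσ.comp Primrec.fst)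
  · refine pr_forall_lt (Primrec.list_length.comp (hσ.comp Primrec.fst)) ?_
    have f2 : Primrec (fun p : (α × ℕ) × ℕ => p.1.1) := Primrec.fst.comp Primrec.fst
    refine PrimrecPred.of_eq (p := fun p : (α × ℕ) × ℕ => ¬ (p.1.2 ≤ p.2 ∧ small Y (k p.1.1 + e p.1.1 + 2) (s p.1.1) ((σ p.1.1).take p.1.2) ((σ p.1.1).take p.2))) ?_ ?_
    · refine PrimrecPred.not (PrimrecPred.and (Primrec.nat_le.comp (Primrec.snd.comp Primrec.fst) Primrec.snd) ?_)
      exact small_pr hY (kee (hk.comp f2) (he.comp f2)) (hs.comp f2) (pr_take (hσ.comp f2) (Primrec.snd.comp Primrec.fst)) (pr_take (hσ.comp f2) Primrec.snd)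
    · intro p; simp only [not_and]

theorem LeafIn_pr (hY : Primrec Y) {l : α → RT} {k e s : α → ℕ} {ρ y : α → List Bool} (hl : Primrec l) (hk : Primrec k) (he : Primrec e)
    (hs : Primrec s) (hρ : Primrec ρ) (hy : Primrec y) : PrimrecPred fun a => LeafIn Y (lk (l a)) (k a) (e a) (s a) (ρ a) (y a) := by
  unfold LeafIn
  refine pr_exists_lt (Primrec.succ.comp (Primrec.list_length.comp hy)) (PrimrecPred.and ?_ ?_)
  · exact primrec_pfx.comp (hρ.comp Primrec.fst) (pr_take (hy.comp Primrec.fst) Primrec.snd)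
  · exact Leaf_pr hY (hl.comp Primrec.fst) (hk.comp Primrec.fst) (he.comp Primrec.fst) (hs.comp Primrec.fst) (pr_take (hy.comp Primrec.fst) Primrec.snd)

theorem Wt_pr (hY : Primrec Y) {l : α → RT} {k e s : α → ℕ} {ρ : α → List Bool} (hl : Primrec l) (hk : Primrec k) (he : Primrec e)
    (hs : Primrec s) (hρ : Primrec ρ) : Primrec fun a => Wt Y (lk (l a)) (k a) (e a) (s a) (ρ a) := by
  unfold Wt
  refine Primrec.list_length.comp (pr_filter (strs_primrec.comp hs) ?_)
  exact LeafIn_pr hY (hl.comp Primrec.fst) (hk.comp Primrec.fst) (he.comp Primrec.fst) (hs.comp Primrec.fst) (hρ.comp Primrec.fst) (hY.comp Primrec.snd)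

theorem elig_pr (hY : Primrec Y) {l : α → RT} {k s : α → ℕ} {σ : α → List Bool} (hl : Primrec l) (hk : Primrec k)
    (hs : Primrec s) (hσ : Primrec σ) : PrimrecPred fun a => elig Y (lk (l a)) (k a) (s a) (σ a) := by
  unfold elig
  have he := unpair1_pr hs
  refine PrimrecPred.and (Leaf_pr hY hl hk he hs hσ) (PrimrecPred.and ?_ (PrimrecPred.and ?_ ?_))
  · exact Primrec.nat_le.comp (Primrec.list_length.comp hσ) hs
  · exact isNone_pr (Efun_pr hs he (Primrec.fst.comp (st_pr hl hs hσ)))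
  · refine pr_forall_lt (Primrec.succ.comp (Primrec.list_length.comp hσ)) ?_
    refine Primrec.nat_lt.comp (cnt_pr hY (hs.comp Primrec.fst) (pr_take (hσ.comp Primrec.fst) Primrec.snd)) ?_
    exact Primrec.nat_mul.comp (pr_pow (kee (hk.comp Primrec.fst) (he.comp Primrec.fst)))
      (Wt_pr hY (hl.comp Primrec.fst) (hk.comp Primrec.fst) (he.comp Primrec.fst) (hs.comp Primrec.fst) (pr_take (hσ.comp Primrec.fst) Primrec.snd))

theorem pick_pr (hY : Primrec Y) {l : α → RT} {k s : α → ℕ} (hl : Primrec l) (hk : Primrec k)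
    (hs : Primrec s) : Primrec fun a => pick Y (lk (l a)) (k a) (s a) := by
  unfold pick
  refine Primrec.list_head?.comp (Primrec.listFilterMap (Primrec.list_range.comp hs) ?_)
  refine Primrec.option_bind (Primrec.decode.comp Primrec.snd) ?_
  have f2 : Primrec (fun p : (α × ℕ) × List Bool => p.1.1) := Primrec.fst.comp Primrec.fst
  exact Primrec.ite (elig_pr hY (hl.comp f2) (hk.comp f2) (hs.comp f2) Primrec.snd) (Primrec.option_some.comp Primrec.snd) (Primrec.const none)

theorem RL_pr (hY : Primrec Y) {k s : α → ℕ} (hk : Primrec k) (hs : Primrec s) : Primrec fun a => RL Y (k a) (s a) := by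
  have h := Primrec.nat_rec' (f := s) (g := fun _ => ([] : RT))
    (h := fun a p => p.2 ++ [pick Y (lk p.2) (k a) p.1]) hs (Primrec.const _)
    (Primrec.list_append.comp (Primrec.snd.comp Primrec.snd) (Primrec.list_cons.comp
      (pick_pr hY (Primrec.snd.comp Primrec.snd) (hk.comp Primrec.fst) (Primrec.fst.comp Primrec.snd)) (Primrec.const [])))
  refine h.of_eq fun a => ?_
  generalize s a = n
  induction n with
  | zero => rfl
  | succ n ih => simp only at ih ⊢; rw [ih]; rfl

theorem lk_RL (Y k s) : ∀ i < s, rr Y k i = lk (RL Y k s) i := by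
  intro i hi
  simp [lk, RL_eq, hi]

theorem str_pr (hY : Primrec Y) {k t : α → ℕ} {σ : α → List Bool} (hk : Primrec k) (ht : Primrec t) (hσ : Primrec σ) :
    Primrec fun a => st (rr Y (k a)) (t a) (σ a) :=
  (st_pr (RL_pr hY hk ht) ht hσ).of_eq fun a => (st_congr (lk_RL Y (k a) (t a)) (σ a)).symm

theorem Leafr_pr (hY : Primrec Y) {k e s : α → ℕ} {σ : α → List Bool} (hk : Primrec k) (he : Primrec e)
    (hs : Primrec s) (hσ : Primrec σ) : PrimrecPred fun a => Leaf Y (rr Y (k a)) (k a) (e a) (s a) (σ a) :=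
  PrimrecPred.of_eq (Leaf_pr hY (RL_pr hY hk hs) hk he hs hσ) fun a => by rw [Leaf_congr (lk_RL Y (k a) (s a))]

theorem ecount_pr {e : α → ℕ} {S : α → St} (he : Primrec e) (hS : Primrec S) : Primrec fun a => ecount (e a) (S a) := by
  unfold ecount
  refine Primrec.list_length.comp (pr_filter (Primrec.fst.comp (Primrec.snd.comp hS)) (PrimrecPred.and ?_ ?_))
  · exact Primrec.eq.comp (Primrec.fst.comp Primrec.snd) (Primrec.const 1)
  · exact Primrec.eq.comp (Primrec.fst.comp (Primrec.snd.comp Primrec.snd)) (he.comp Primrec.fst)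

theorem Qn_pr (hY : Primrec Y) {k e n : α → ℕ} {σ : α → List Bool} (hk : Primrec k) (he : Primrec e)
    (hn : Primrec n) (hσ : Primrec σ) : PrimrecPred fun a => Qn (rr Y (k a)) (e a) (n a) (σ a) := by
  unfold Qn
  exact Primrec.nat_le.comp hn (ecount_pr he (str_pr hY hk (Primrec.list_length.comp hσ) hσ))

end withY


end part8_block

section part9_block
open MeasureTheory

theorem Sys.lam_CC {Y r k} (S : Sys Y r k) (σ) : lam (CC Y σ) = ⨆ s, lam (CS Y s σ) :=
  Monotone.measure_iUnion (fun _ _ h => S.CS_mono h σ)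

theorem Sys.comp_of_pos {Y r k} (S : Sys Y r k) (hY : Primrec Y) (B : ℕ → Bool) (c : ℕ)
    (hc : ∀ m, ((1 : ℕ) : ℝ≥0∞) / 2 ^ c < lam (CC Y (restr B m))) : ComputableSeq B := by
  set L : ℝ≥0∞ := ⨅ m, lam (CC Y (restr B m)) with hL
  have hL0 : ((1 : ℕ) : ℝ≥0∞) / 2 ^ c ≤ L := le_iInf fun m => (hc m).le
  have hL1 : L ≤ 1 := le_trans (iInf_le _ 0) prob_le_one
  set w := c + 2 with hw
  have hex : ∃ p : ℕ, L ≤ ((p + 1 : ℕ) : ℝ≥0∞) / 2 ^ w := by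
    refine ⟨2 ^ w, hL1.trans ?_⟩
    have := (div_le_div_nat 1 (2 ^ w + 1) 0 w).2 (by simp)
    simpa using this
  classical
  obtain ⟨p, hp, hmin⟩ : ∃ p : ℕ, L ≤ ((p + 1 : ℕ) : ℝ≥0∞) / 2 ^ w ∧ ∀ q < p, ¬ L ≤ ((q + 1 : ℕ) : ℝ≥0∞) / 2 ^ w :=
    ⟨Nat.find hex, Nat.find_spec hex, fun q hq => Nat.find_min hex hq⟩
  have hp2 : 2 ≤ p := by
    by_contra h
    have h1 := hL0.trans hp
    rw [div_le_div_nat] at h1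
    have h2 : 2 ^ w = 4 * 2 ^ c := by rw [hw, pow_add]; ring
    have h3 : 0 < 2 ^ c := by positivity
    have h4 : (p + 1) * 2 ^ c ≤ 2 * 2 ^ c := Nat.mul_le_mul_right _ (by omega)
    omega
  have hpL : ((p : ℕ) : ℝ≥0∞) / 2 ^ w < L := by
    have := hmin (p - 1) (by omega)
    rw [Nat.sub_add_cancel (by omega)] at this
    exact not_le.1 this
  have hm0 : ∃ m0, lam (CC Y (restr B m0)) < ((2 * p : ℕ) : ℝ≥0∞) / 2 ^ w := by
    apply iInf_lt_iff.1
    refine lt_of_le_of_lt hp ?_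
    rw [div_lt_div_nat]
    exact Nat.mul_lt_mul_of_pos_right (by omega) (by positivity)
  obtain ⟨m0, hm0⟩ := hm0
  let f : List Bool → ℕ → Option Bool := fun x n =>
    ((strs (m0 + n + 1)).filter (fun σ => decide (restr B m0 <+: σ ∧ p * 2 ^ x.length < cnt Y x.length σ * 2 ^ w))).head?.bind
      (fun σ => σ[n]?)
  have hf : Primrec₂ f := by
    refine Primrec.option_bind (Primrec.list_head?.comp (pr_filter ?_ ?_)) ?_
    · exact strs_primrec.comp (Primrec.succ.comp (Primrec.nat_add.comp (Primrec.const m0) Primrec.snd))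
    · refine PrimrecPred.and ?_ ?_
      · exact primrec_pfx.comp (Primrec.const _) Primrec.snd
      · have hl : Primrec fun q : (List Bool × ℕ) × List Bool => q.1.1.length :=
          Primrec.list_length.comp (Primrec.fst.comp Primrec.fst)
        exact Primrec.nat_lt.comp (Primrec.nat_mul.comp (Primrec.const p) (pr_pow hl))
          (Primrec.nat_mul.comp (cnt_pr hY hl Primrec.snd) (Primrec.const _))
    · exact Primrec.list_getElem?.comp Primrec.snd (Primrec.snd.comp Primrec.fst)
  refine TRed_of (fun _ => false) B f hf ?_ ?_
  · intro n
    have h1 : ((p : ℕ) : ℝ≥0∞) / 2 ^ w < lam (CC Y (restr B (m0 + n + 1))) := hpL.trans_le (iInf_le _ _)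
    rw [S.lam_CC, lt_iSup_iff] at h1
    obtain ⟨s, hs⟩ := h1
    refine ⟨s, ?_⟩
    rw [lam_CS, div_lt_div_nat] at hs
    have hmem : restr B (m0 + n + 1) ∈ (strs (m0 + n + 1)).filter (fun σ => decide (restr B m0 <+: σ ∧
        p * 2 ^ (restr (fun _ => false) s).length < cnt Y (restr (fun _ => false) s).length σ * 2 ^ w)) := by
      rw [List.mem_filter, mem_strs, restr_length]
      refine ⟨rfl, ?_⟩
      rw [decide_eq_true_iff, restr_length]
      exact ⟨restr_pfx B (by omega), hs⟩
    simp only [f]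
    cases hh : (List.filter (fun σ => decide (restr B m0 <+: σ ∧
        p * 2 ^ (restr (fun _ => false) s).length < cnt Y (restr (fun _ => false) s).length σ * 2 ^ w)) (strs (m0 + n + 1))) with
    | nil => rw [hh] at hmem; simp at hmem
    | cons a l =>
      have ha : a ∈ (strs (m0 + n + 1)) := by
        refine (List.mem_filter (p := (fun σ => decide (restr B m0 <+: σ ∧
          p * 2 ^ (restr (fun _ => false) s).length < cnt Y (restr (fun _ => false) s).length σ * 2 ^ w)))).1 ?_ |>.1
        rw [hh]; simp
      rw [mem_strs] at ha
      simp [ha]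
  · intro s n b hb
    simp only [f, Option.bind_eq_some_iff] at hb
    obtain ⟨σ, h1, h2⟩ := hb
    have h3 := List.mem_of_head? h1
    rw [List.mem_filter, mem_strs, decide_eq_true_iff, restr_length, ← div_lt_div_nat, ← lam_CS] at h3
    obtain ⟨h4, h5, h6⟩ := h3
    have heq : σ = restr B (m0 + n + 1) := by
      by_contra hne
      have hd : Disjoint (CC Y σ) (CC Y (restr B (m0 + n + 1))) := by
        rw [Set.disjoint_left]
        intro X hX hX'
        rcases S.comparable hX hX' with h | h
        · exact hne (h.eq_of_length (by simp [h4]))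
        · exact hne (h.eq_of_length (by simp [h4])).symm
      have h7 : lam (CC Y σ) + lam (CC Y (restr B (m0 + n + 1))) ≤ lam (CC Y (restr B m0)) := by
        rw [← measure_union hd (meas_CC _ _)]
        exact measure_mono (Set.union_subset (CC_anti Y h5) (CC_anti Y (restr_pfx B (by omega))))
      have h8 : ((p : ℕ) : ℝ≥0∞) / 2 ^ w ≤ lam (CC Y σ) := h6.le.trans (measure_mono (CS_sub_CC Y s σ))
      have h9 : ((p : ℕ) : ℝ≥0∞) / 2 ^ w ≤ lam (CC Y (restr B (m0 + n + 1))) := hpL.le.trans (iInf_le _ _)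
      have h10 := (add_le_add h8 h9).trans h7
      rw [← ENNReal.add_div, ← Nat.cast_add, ← two_mul] at h10
      exact absurd h10 (not_le.2 hm0)
    subst heq
    rw [List.getElem?_eq_some_iff] at h2
    obtain ⟨_, h2⟩ := h2
    rw [← h2]; simp [restr]

theorem Sys.mem_CC {Y r k} (S : Sys Y r k) {A B : ℕ → Bool} (h1 : ∀ s, Y (restr A s) <+: restr B s)
    (h2 : ∀ n, ∃ s, n ≤ (Y (restr A s)).length) (m) : A ∈ CC Y (restr B m) := by
  obtain ⟨s, hs⟩ := h2 m
  refine Set.mem_iUnion.2 ⟨s, ?_⟩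
  have h3 : m ≤ s := hs.trans ((S.len _).trans (by simp))
  exact List.prefix_of_prefix_length_le (restr_pfx B h3) (h1 s) (by simpa using hs)

theorem Sys.cnt_pos {Y r k} (_ : Sys Y r k) {A : ℕ → Bool} {σ} (h : A ∈ CC Y σ) : ∃ z, 0 < cnt Y z σ := by
  obtain ⟨s, hs⟩ := Set.mem_iUnion.1 h
  refine ⟨s, List.length_pos_of_mem (a := restr A s) ?_⟩
  rw [List.mem_filter, mem_strs]
  exact ⟨by simp, decide_eq_true hs⟩

theorem Sys.L7 {Y r k} (S : Sys Y r k) (hY : Primrec Y) {A B : ℕ → Bool} (hA : ∀ m, A ∈ CC Y (restr B m))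
    (hB : ¬ ComputableSeq B) {e n : ℕ} (hm : ∀ t, n ≤ t → (st r t (restr B t)).2.2 = some (e, n)) :
    A ∈ Lset Y r k e := by
  classical
  have hz := S.cnt_pos (hA n)
  obtain ⟨z, hzp, hzmin⟩ : ∃ z, 0 < cnt Y z (restr B n) ∧ ∀ z', 0 < cnt Y z' (restr B n) → z ≤ z' :=
    ⟨Nat.find hz, Nat.find_spec hz, fun z' h => Nat.find_min' hz h⟩
  set c := k + e + 2 + 1 + z with hcdef
  have hex : ∃ m, n ≤ m ∧ lam (CC Y (restr B m)) ≤ ((1 : ℕ) : ℝ≥0∞) / 2 ^ c := by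
    by_contra hcon
    push Not at hcon
    apply hB
    refine S.comp_of_pos hY B c (fun m => ?_)
    exact (hcon (max m n) (le_max_right _ _)).trans_le (measure_mono (CC_anti Y (restr_pfx B (le_max_left _ _))))
  obtain ⟨m, ⟨hnm, hsm⟩, hmin⟩ : ∃ m, (n ≤ m ∧ lam (CC Y (restr B m)) ≤ ((1 : ℕ) : ℝ≥0∞) / 2 ^ c) ∧
      ∀ q < m, ¬ (n ≤ q ∧ lam (CC Y (restr B q)) ≤ ((1 : ℕ) : ℝ≥0∞) / 2 ^ c) :=
    ⟨Nat.find hex, Nat.find_spec hex, fun q hq => Nat.find_min hex hq⟩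
  have hbig : ∀ q, q < m → n ≤ q → ∃ s0, ∀ s, s0 ≤ s → ((1 : ℕ) : ℝ≥0∞) / 2 ^ c < lam (CS Y s (restr B q)) := by
    intro q hq hnq
    have := hmin q hq
    rw [not_and, not_le] at this
    have := this hnq
    rw [S.lam_CC, lt_iSup_iff] at this
    obtain ⟨s0, hs0⟩ := this
    exact ⟨s0, fun s hs => hs0.trans_le (measure_mono (S.CS_mono hs _))⟩
  choose! g hg using hbig
  refine Set.mem_iUnion₂.2 ⟨restr B m, ?_, hA m⟩
  show Perm Y r k e (restr B m)
  refine ⟨m + z + ((Finset.range m).sup g), fun s hs => ?_⟩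
  have hst : ∀ t, t ≤ s → st r t (restr B m) = st r t (restr B s) := by
    intro t
    induction t with
    | zero => intro _; rfl
    | succ t ih =>
      intro hts
      rcases Nat.lt_or_ge t m with h | h
      · exact S.st_pfx (restr_pfx B (by omega)) (by simpa using h)
      · have i := ih (by omega)
        have Ac := active_of_mode (hm s (by omega))
        have hmode : (st r t (restr B s)).2.2 = some (e, n) := by
          rw [Ac.const' (by omega) (by omega : t ≤ s)]; exact Ac.mode
        obtain ⟨q1, q2⟩ := Ac.quiet t (by omega) (by omega)
        have q3 : ¬ (bitOf (r t) (restr B m) = true ∧ t.unpair.1 = e) := by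
          rintro ⟨h1, h2⟩
          apply q2
          refine ⟨?_, h2⟩
          rw [bitOf_true] at h1 ⊢
          obtain ⟨ρ, h3, h4⟩ := h1
          exact ⟨ρ, h3, h4.trans (restr_pfx B (by omega))⟩
        rw [st, st, i, nxt_of_some hmode, nxt_of_some hmode]
        have q1' : Efun t e (st r t (restr B s)).1 = none := by
          rw [Ac.const' (by omega) (by omega : t ≤ s)]
          exact Ac.quietE (by omega) (by omega)
        unfold nxtSome
        simp only [q1', q2, q3, if_false]
  have htn : (restr B m).take n = restr B n := by rw [restr_take, min_eq_left hnm]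
  refine ⟨n, by simp; omega, ?_, ?_, ?_⟩
  · rw [hst s le_rfl]; exact hm s (by omega)
  · refine ⟨z, by omega, by rw [htn]; exact hzp, ?_⟩
    have h1 : lam (CS Y s (restr B m)) ≤ ((1 : ℕ) : ℝ≥0∞) / 2 ^ c := (measure_mono (CS_sub_CC Y s _)).trans hsm
    rw [lam_CS, div_le_div_nat, one_mul] at h1
    exact h1
  · intro q hq hnq
    rw [restr_length] at hq
    rw [htn, restr_take, min_eq_left (by omega)]
    rintro ⟨z', hz', h1, h2⟩
    have h3 := hg q hq hnq s (by
      have : g q ≤ (Finset.range m).sup g := Finset.le_sup (by simpa using hq)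
      omega)
    rw [lam_CS, div_lt_div_nat, one_mul] at h3
    have h4 : 2 ^ c ≤ 2 ^ (k + e + 2 + 1 + z') := Nat.pow_le_pow_right (by norm_num) (by have := hzmin z' h1; omega)
    have h5 := Nat.mul_le_mul_left (cnt Y s (restr B q)) h4
    omega


end part9_block

section part10_block
open MeasureTheory

theorem nxt_cases (t : ℕ) (S : St) (bit : Bool) :
    (S.2.2 = none ∧ nxt t S bit = (S.1, S.2.1, some (S.2.1.length.unpair.1, t + 1))) ∨
    (∃ i e ρ, nxt t S bit = (ρ, (i, e, ρ) :: S.2.1, none) ∧ S.1 <+: ρ ∧ S.1.length < ρ.length ∧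
      ((i = 0 ∧ e = S.2.1.length.unpair.1 ∧ ¬ attemptOK t e S.2.1) ∨ (i = 1 ∧ ∃ n, S.2.2 = some (e, n)) ∨
        (i = 2 ∧ (∃ n, S.2.2 = some (e, n)) ∧ ∃ τ ∈ Wset e, τ <+: ρ))) ∨
    (nxt t S bit = S ∧ ∃ m, S.2.2 = some m) := by
  cases hm : S.2.2 with
  | none =>
    rw [nxt_of_none hm]; unfold nxtNone
    split_ifs with h
    · left; exact ⟨rfl, rfl⟩
    · right; left
      exact ⟨0, _, _, rfl, List.prefix_append _ _, by simp, Or.inl ⟨rfl, rfl, h⟩⟩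
  | some m =>
    obtain ⟨e, n⟩ := m
    rw [nxt_of_some hm]; unfold nxtSome
    right
    cases hE : Efun t e S.1 with
    | some τ =>
      left
      obtain ⟨h1, h2⟩ := Efun_sound hE
      refine ⟨2, e, τ ++ [false], rfl, h1.trans (List.prefix_append _ _), ?_, Or.inr (Or.inr ⟨rfl, ⟨n, rfl⟩, τ, h2, List.prefix_append _ _⟩)⟩
      have := h1.length_le
      simp; omega
    | none =>
      simp only
      split_ifs with h
      · left
        exact ⟨1, e, _, rfl, List.prefix_append _ _, by simp, Or.inr (Or.inl ⟨rfl, n, rfl⟩)⟩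
      · right; exact ⟨rfl, _, rfl⟩

def Inv (S : St) : Prop :=
  (∀ ev ∈ S.2.1, ev.1 ≤ 2 ∧ ev.2.2 <+: S.1 ∧ (ev.1 = 2 → ∃ τ ∈ Wset ev.2.1, τ <+: ev.2.2)) ∧
  (∀ e n, S.2.2 = some (e, n) → e = S.2.1.length.unpair.1) ∧ S.2.1.length ≤ S.1.length

theorem Inv_step {t S bit} (h : Inv S) : Inv (nxt t S bit) := by
  obtain ⟨h1, h2, h3⟩ := h
  rcases nxt_cases t S bit with ⟨_, hc⟩ | ⟨i, e, ρ, hc, hp, hl, hk⟩ | ⟨hc, _⟩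
  · rw [hc]
    refine ⟨h1, ?_, h3⟩
    intro e n h; simp at h; exact h.1.symm
  · rw [hc]
    refine ⟨?_, by simp, by simp; omega⟩
    intro ev hev
    simp only [List.mem_cons] at hev
    rcases hev with rfl | hev
    · refine ⟨?_, List.prefix_rfl, ?_⟩
      · rcases hk with hk | hk | hk <;> have := hk.1 <;> simp only <;> omega
      · intro h4
        simp only at h4
        rcases hk with hk | hk | hk
        · have := hk.1; omega
        · have := hk.1; omega
        · exact hk.2.2
    · obtain ⟨a, b, c⟩ := h1 ev hev
      exact ⟨a, b.trans hp, c⟩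
  · rw [hc]; exact ⟨h1, h2, h3⟩

structure Run (b : ℕ → St) (bit : ℕ → Bool) : Prop where
  zero : b 0 = ([], [], none)
  succ : ∀ t, b (t + 1) = nxt t (b t) (bit t)

section run
variable {b : ℕ → St} {bit : ℕ → Bool}

theorem Run.inv (R : Run b bit) (t) : Inv (b t) := by
  induction t with
  | zero => rw [R.zero]; simp [Inv]
  | succ t ih => rw [R.succ]; exact Inv_step ih

theorem Run.step (R : Run b bit) (t) :
    ((b (t+1)).2.1 = (b t).2.1 ∧ (b (t+1)).1 = (b t).1) ∨ (∃ i e ρ, b (t + 1) = (ρ, (i, e, ρ) :: (b t).2.1, none) ∧ (b t).1 <+: ρ ∧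
      e = (b t).2.1.length.unpair.1 ∧ (i = 0 → ¬ attemptOK t e (b t).2.1)) := by
  obtain ⟨h1, h2, h3⟩ := R.inv t
  rw [R.succ]
  rcases nxt_cases t (b t) (bit t) with ⟨_, hc⟩ | ⟨i, e, ρ, hc, hp, hl, hk⟩ | ⟨hc, _⟩
  · left; rw [hc]; exact ⟨rfl, rfl⟩
  · right
    refine ⟨i, e, ρ, hc, hp, ?_, ?_⟩
    · rcases hk with hk | ⟨_, n, hk⟩ | ⟨_, ⟨n, hk⟩, _⟩
      · exact hk.2.1
      · exact h2 e n hk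
      · exact h2 e n hk
    · intro hi
      rcases hk with hk | hk | hk
      · exact hk.2.2
      · have := hk.1; omega
      · have := hk.1; omega
  · left; rw [hc]; exact ⟨rfl, rfl⟩

theorem Run.out_mono (R : Run b bit) {t t'} (h : t ≤ t') : (b t).1 <+: (b t').1 := by
  induction t', h using Nat.le_induction with
  | base => exact List.prefix_rfl
  | succ t' _ ih =>
    rcases R.step t' with ⟨_, h⟩ | ⟨i, e, ρ, h, hp, _⟩
    · rw [h]; exact ih
    · rw [h]; exact ih.trans hp

theorem Run.hist_mono (R : Run b bit) {t t'} (h : t ≤ t') : (b t).2.1 <:+ (b t').2.1 := by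
  induction t', h using Nat.le_induction with
  | base => exact List.suffix_rfl
  | succ t' _ ih =>
    rcases R.step t' with ⟨h, _⟩ | ⟨i, e, ρ, h, hp, _⟩
    · rw [h]; exact ih
    · rw [h]; exact ih.trans (List.suffix_cons _ _)

theorem Run.next (R : Run b bit) (hna : ∀ e n, ¬ ∀ t, n ≤ t → (b t).2.2 = some (e, n)) 
    (hact : ∀ t e n, (b t).2.2 = some (e, n) → ∀ i, n ≤ i → i ≤ t → (b i).2.2 = some (e, n)) (t) :
    ∃ t' > t, (b t).2.1.length < (b t').2.1.length := by
  have key : ∀ t e n, (b t).2.2 = some (e, n) → ∃ t' > t, (b t).2.1.length < (b t').2.1.length := by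
    intro t e n h
    by_contra hcon
    push Not at hcon
    apply hna e n
    have hs : ∀ t', t ≤ t' → b t' = b t := by
      intro t' ht'
      induction t', ht' using Nat.le_induction with
      | base => rfl
      | succ t' ht' ih =>
        rcases nxt_cases t' (b t') (bit t') with ⟨h1, _⟩ | ⟨i, e, ρ, hc, _⟩ | ⟨hc, _⟩
        · rw [ih, h] at h1; simp at h1
        · have h2 := hcon (t'+1) (by omega)
          rw [R.succ, hc, ih] at h2
          simp at h2
        · rw [R.succ, hc, ih]
    intro t' ht'
    rcases Nat.lt_or_ge t t' with h1 | h1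
    · rw [hs t' h1.le, h]
    · exact hact t e n h t' ht' h1
  rcases nxt_cases t (b t) (bit t) with ⟨h1, h2⟩ | ⟨i, e, ρ, hc, _⟩ | ⟨_, ⟨e, n⟩, h⟩
  · rw [← R.succ] at h2
    obtain ⟨t', h3, h4⟩ := key (t+1) _ _ (by rw [h2])
    exact ⟨t', by omega, by rw [h2] at h4; exact h4⟩
  · exact ⟨t+1, by omega, by rw [R.succ, hc]; simp⟩
  · exact key t e n h

theorem Run.unbounded (_ : Run b bit) (hn : ∀ t, ∃ t' > t, (b t).2.1.length < (b t').2.1.length) (N) :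
    ∃ t, N < (b t).2.1.length := by
  induction N with
  | zero => obtain ⟨t, _, h⟩ := hn 0; exact ⟨t, by omega⟩
  | succ N ih =>
    obtain ⟨t, h⟩ := ih
    obtain ⟨t', _, h'⟩ := hn t
    exact ⟨t', by omega⟩

theorem Run.event (R : Run b bit) (hn : ∀ t, ∃ t' > t, (b t).2.1.length < (b t').2.1.length) (e T) :
    ∃ t ≥ T, ∃ i ρ, b (t + 1) = (ρ, (i, e, ρ) :: (b t).2.1, none) ∧ (i = 0 → ¬ attemptOK t e (b t).2.1) := by
  classical
  set N := Nat.pair e (b T).2.1.length with hN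
  have hNT : (b T).2.1.length ≤ N := Nat.right_le_pair _ _
  have hex := R.unbounded hn N
  obtain ⟨u, hu, hmin⟩ : ∃ u, N < (b u).2.1.length ∧ ∀ q < u, ¬ N < (b q).2.1.length :=
    ⟨Nat.find hex, Nat.find_spec hex, fun q hq => Nat.find_min hex hq⟩
  have huT : T < u := by
    by_contra h
    have := (R.hist_mono (not_lt.1 h)).length_le
    omega
  obtain ⟨t, rfl⟩ : ∃ t, u = t + 1 := ⟨u - 1, by omega⟩
  have h1 := hmin t (by omega)
  refine ⟨t, by omega, ?_⟩
  rcases R.step t with ⟨h, _⟩ | ⟨i, e', ρ, h, hp, he, hk⟩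
  · rw [h] at hu; omega
  · have hl : (b t).2.1.length = N := by
      rw [h] at hu; simp at hu; omega
    rw [hl, hN, Nat.unpair_pair] at he
    simp only at he
    subst he
    exact ⟨i, ρ, h, hk⟩

theorem list_bound {β : Type} (P : β → ℕ → Prop) (hP : ∀ x t t', t ≤ t' → P x t → P x t') (l : List β)
    (h : ∀ x ∈ l, ∃ t, P x t) : ∃ T, ∀ x ∈ l, P x T := by
  induction l with
  | nil => exact ⟨0, by simp⟩
  | cons a l ih =>
    obtain ⟨T, hT⟩ := ih (fun x hx => h x (by simp [hx]))
    obtain ⟨T', hT'⟩ := h a (by simp)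
    refine ⟨max T T', fun x hx => ?_⟩
    simp only [List.mem_cons] at hx
    rcases hx with rfl | hx
    · exact hP _ _ _ (le_max_right _ _) hT'
    · exact hP _ _ _ (le_max_left _ _) (hT x hx)

theorem Run.req (R : Run b bit) (hn : ∀ t, ∃ t' > t, (b t).2.1.length < (b t').2.1.length) (e N)
    (hN : ∀ t, ecount e (b t) ≤ N) :
    ∃ t σ, σ <+: (b t).1 ∧ (σ ∈ Wset e ∨ ∀ τ, σ <+: τ → τ ∉ Wset e) := by
  classical
  by_cases h2 : ∃ t, ∃ ev ∈ (b t).2.1, ev.1 = 2 ∧ ev.2.1 = e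
  · obtain ⟨t, ev, hev, h3, h4⟩ := h2
    obtain ⟨_, h5, h6⟩ := (R.inv t).1 ev hev
    obtain ⟨τ, h7, h8⟩ := h6 h3
    exact ⟨t, τ, h8.trans h5, Or.inl (h4 ▸ h7)⟩
  -- the count of events stabilises
  have hmono : ∀ t t', t ≤ t' → ecount e (b t) ≤ ecount e (b t') := by
    intro t t' h
    exact ((R.hist_mono h).filter _).length_le
  obtain ⟨T, hT⟩ : ∃ T, ∀ t, ecount e (b t) ≤ ecount e (b T) := by
    by_contra hcon
    push Not at hcon
    have hall : ∀ M, ∃ t, M ≤ ecount e (b t) := by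
      intro M
      induction M with
      | zero => exact ⟨0, Nat.zero_le _⟩
      | succ M ih =>
        obtain ⟨t, ht⟩ := ih
        obtain ⟨t', ht'⟩ := hcon t
        exact ⟨t', by omega⟩
    obtain ⟨t, ht⟩ := hall (N+1)
    have := hN t
    omega
  have hF : ∀ t, T ≤ t → (b T).2.1.filter (fun ev => decide (ev.1 = 1 ∧ ev.2.1 = e)) =
      (b t).2.1.filter (fun ev => decide (ev.1 = 1 ∧ ev.2.1 = e)) := by
    intro t ht
    exact ((R.hist_mono ht).filter _).eq_of_length (le_antisymm (hmono T t ht) (hT t))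
  have hlate : ∀ T', T ≤ T' → ∃ ev ∈ (b T).2.1.filter (fun ev => decide (ev.1 = 1 ∧ ev.2.1 = e)), ¬ (Efun T' e ev.2.2).isSome = true := by
    intro T' hT'
    obtain ⟨t, ht, i, ρ, h3, h4⟩ := R.event hn e T'
    have hmem : (i, e, ρ) ∈ (b (t+1)).2.1 := by rw [h3]; simp
    have hi0 : i = 0 := by
      have h5 := ((R.inv (t+1)).1 _ hmem).1
      have h6 : i ≠ 2 := fun h => h2 ⟨t+1, _, hmem, h, rfl⟩
      have h7 : i ≠ 1 := by
        intro h
        have h8 := hT (t+1)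
        have h9 := hmono T t (by omega)
        have : ecount e (b (t+1)) = ecount e (b t) + 1 := by
          rw [h3]; simp [ecount, h]
        omega
      simp only at h5
      omega
    have h5 := h4 hi0
    unfold attemptOK at h5
    push Not at h5
    obtain ⟨ev, hev, h6, h7, h8⟩ := h5
    have h9 : ev.1 = 1 := by
      have h10 := ((R.inv t).1 _ hev).1
      have h11 : ev.1 ≠ 2 := fun h => h2 ⟨t, ev, hev, h, h7⟩
      omega
    refine ⟨ev, ?_, ?_⟩
    · rw [hF t (by omega), List.mem_filter]
      exact ⟨hev, by simp [h9, h7]⟩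
    · intro hs
      exact h8 h9 (Efun_mono ht hs)
  have : ∃ ev ∈ (b T).2.1.filter (fun ev => decide (ev.1 = 1 ∧ ev.2.1 = e)), ∀ t, ¬ (Efun t e ev.2.2).isSome = true := by
    by_contra hcon
    push Not at hcon
    obtain ⟨T', hT'⟩ := list_bound (fun (ev : ℕ × ℕ × List Bool) t => (Efun t e ev.2.2).isSome = true) (fun x t t' h hx => Efun_mono h hx) _ hcon
    obtain ⟨ev, hev, h3⟩ := hlate (max T T') (le_max_left _ _)
    exact h3 (Efun_mono (le_max_right _ _) (hT' ev hev))
  obtain ⟨ev, hev, h3⟩ := this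
  rw [List.mem_filter] at hev
  refine ⟨T, ev.2.2, ((R.inv T).1 ev hev.1).2.1, Or.inr ?_⟩
  intro τ h4 h5
  obtain ⟨t, ht⟩ := Efun_complete h4 h5
  exact h3 t ht

end run

theorem Sys.L8 {Y r k} (S : Sys Y r k) (hY : Primrec Y) (hr : Primrec fun x => st r x.length x) {A B : ℕ → Bool}
    (h1 : ∀ s, Y (restr A s) <+: restr B s)
    (h2 : ∀ n, ∃ s, n ≤ (Y (restr A s)).length) (hB : ¬ ComputableSeq B) (hL : ∀ e, A ∉ Lset Y r k e)
    (hN : ∀ e, A ∉ NN Y r e) : ∃ G : ℕ → Bool, OneGeneric G ∧ TRed G B := by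
  have hA := S.mem_CC h1 h2
  set b : ℕ → St := fun t => st r t (restr B t) with hb
  have hbm : ∀ t m, t ≤ m → st r t (restr B m) = b t := by
    intro t m h
    exact (S.st_pfx (restr_pfx B h) (by simp)).symm
  have R : Run b (fun t => bitOf (r t) (restr B (t+1))) := by
    refine ⟨rfl, fun t => ?_⟩
    show st r (t+1) (restr B (t+1)) = _
    rw [st, hbm t (t+1) (by omega)]
  have hn := R.next (fun e n h => hL e (S.L7 hY hA hB h)) (by
    intro t e n h i h3 h4
    rw [← hbm i t h4, (active_of_mode h).const' h3 h4]; exact h)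
  have hlen : ∀ n, ∃ t, n < (b t).1.length := by
    intro n
    obtain ⟨t, ht⟩ := R.unbounded hn n
    exact ⟨t, lt_of_lt_of_le ht (R.inv t).2.2⟩
  choose T hT using hlen
  let G : ℕ → Bool := fun n => (b (T n)).1[n]'(hT n)
  have hG : ∀ t n x, (b t).1[n]? = some x → x = G n := by
    intro t n x hx
    rw [List.getElem?_eq_some_iff] at hx
    obtain ⟨hlt, hx⟩ := hx
    rw [← hx]
    rcases le_total t (T n) with h | h
    · exact (R.out_mono h).getElem _
    · exact ((R.out_mono h).getElem _).symm
  refine ⟨G, ?_, ?_⟩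
  · intro W hW
    obtain ⟨e, rfl⟩ := exists_Wset W hW
    have hNe : ∃ n, ∀ s, ¬ Qn r e n (Y (restr A s)) := by
      have := hN e
      simp only [NN, Un, Set.mem_iInter, Set.mem_iUnion, Set.mem_ofPred_eq] at this
      push Not at this
      exact this
    obtain ⟨n, hn'⟩ := hNe
    obtain ⟨t, σ, h3, h4⟩ := R.req hn e n (by
      intro t
      obtain ⟨s, hs⟩ := h2 t
      have h5 := hn' s
      unfold Qn at h5
      have h6 := (prefix_restr_iff B).1 (h1 s)
      rw [← h6.2, restr_length] at h5
      have h7 := ecount_mono r e (restr B (Y (restr A s)).length) hs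
      rw [hbm t _ hs] at h7
      omega)
    refine ⟨σ, ?_, h4⟩
    intro i
    rw [List.get_eq_getElem]
    symm
    apply hG t i.1
    rw [List.getElem?_eq_some_iff]
    exact ⟨i.2.trans_le h3.length_le, (h3.getElem _).symm⟩
  · refine TRed_of B G (fun x n => (st r x.length x).1[n]?) ?_ ?_ ?_
    · exact Primrec.list_getElem?.comp (Primrec.fst.comp (hr.comp Primrec.fst)) Primrec.snd
    · intro n
      refine ⟨T n, ?_⟩
      rw [restr_length]
      have := hT n
      simp only [hb] at this
      simp [this]
    · intro s n x hx
      rw [restr_length] at hx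
      exact hG s n x hx


end part10_block

section part11_block
open MeasureTheory

theorem half_lt (i : ℕ) : ((1 : ℕ) : ℝ≥0∞) / 2 ^ (i+1) < (2 : ℝ≥0∞)⁻¹ ^ i := by
  have := (div_lt_div_nat 1 1 (i+1) i).2 (by rw [pow_succ]; have : 0 < 2 ^ i := by positivity
                                             omega)
  refine this.trans_le ?_
  rw [Nat.cast_one, one_div, ENNReal.inv_pow]

def strOf (n : ℕ) : List Bool := (Encodable.decode (α := List Bool) n).getD []

theorem strOf_encode (x : List Bool) : strOf (Encodable.encode x) = x := by simp [strOf]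

theorem strOf_pr : Primrec strOf := Primrec.option_getD.comp Primrec.decode (Primrec.const [])

theorem unpair2_pr {α : Type} [Primcodable α] {f : α → ℕ} (hf : Primrec f) : Primrec fun a => (f a).unpair.2 :=
  Primrec.snd.comp (Primrec.unpair.comp hf)

theorem test_lemma {A : ℕ → Bool} (hA : TwoRandom A) (V : ℕ → Set (List Bool)) (P : ℕ → ℕ → ℕ → Bool)
    (hP : Primrec (fun p : ℕ × ℕ × ℕ => P p.1 p.2.1 p.2.2))
    (hV : ∀ i x, x ∈ V i ↔ ∃ a, ∀ b, P (Nat.pair i (Encodable.encode x)) a b = true)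
    (hm : ∀ i, lam (openOf (V i)) ≤ ((1 : ℕ) : ℝ≥0∞) / 2 ^ (i+1)) : ∃ i, A ∉ openOf (V i) := by
  obtain ⟨C, hC⟩ := sigma2 P hP.to_comp
  refine hA V ⟨⟨C, fun i σ => ?_⟩, fun i => ?_⟩
  · rw [hC, hV]
  · exact ((stringMeasure_le _).trans (hm i)).trans_lt (half_lt i)

theorem test1 {A : ℕ → Bool} (hA : TwoRandom A) {Y : List Bool → List Bool} (hY : Primrec Y)
    (S : ∀ k, Sys Y (rr Y k) k) : ∃ k, ∀ e, A ∉ Lset Y (rr Y k) k e := by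
  let V : ℕ → Set (List Bool) := fun k => {x | ∃ e m, Perm Y (rr Y k) k e ((Y x).take m)}
  let P : ℕ → ℕ → ℕ → Bool := fun u a b => decide (¬ a.unpair.2.unpair.2 ≤ b ∨
    Leaf Y (rr Y u.unpair.1) u.unpair.1 a.unpair.1 b ((Y (strOf u.unpair.2)).take a.unpair.2.unpair.1))
  have hPp : Primrec (fun p : ℕ × ℕ × ℕ => P p.1 p.2.1 p.2.2) := by
    have pu : Primrec fun p : ℕ × ℕ × ℕ => p.1 := Primrec.fst
    have pa : Primrec fun p : ℕ × ℕ × ℕ => p.2.1 := Primrec.fst.comp Primrec.snd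
    have pb : Primrec fun p : ℕ × ℕ × ℕ => p.2.2 := Primrec.snd.comp Primrec.snd
    refine PrimrecPred.decide (PrimrecPred.or (PrimrecPred.not ?_) ?_)
    · exact Primrec.nat_le.comp (unpair2_pr (unpair2_pr pa)) pb
    · exact Leafr_pr hY (unpair1_pr pu) (unpair1_pr pa) pb
        (pr_take (hY.comp (strOf_pr.comp (unpair2_pr pu))) (unpair1_pr (unpair2_pr pa)))
  obtain ⟨k, hk⟩ := test_lemma hA V P hPp (by
    intro k x
    simp only [V, P, Set.mem_ofPred_eq, Nat.unpair_pair, strOf_encode, decide_eq_true_iff]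
    constructor
    · rintro ⟨e, m, s0, h⟩
      refine ⟨Nat.pair e (Nat.pair m s0), fun b => ?_⟩
      simp only [Nat.unpair_pair]
      by_cases hb : s0 ≤ b
      · exact Or.inr (h b hb)
      · exact Or.inl hb
    · rintro ⟨a, h⟩
      exact ⟨a.unpair.1, a.unpair.2.unpair.1, a.unpair.2.unpair.2, fun b hb => (h b).resolve_left (not_not.2 hb)⟩) (by
    intro k
    have hsub : openOf (V k) ⊆ ⋃ e, Lset Y (rr Y k) k e := by
      intro X hX
      obtain ⟨s, e, m, h⟩ := (openOf_iff _ _).1 hX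
      refine Set.mem_iUnion.2 ⟨e, Set.mem_iUnion₂.2 ⟨_, h, ?_⟩⟩
      exact Set.mem_iUnion.2 ⟨s, take_pfx _ _⟩
    refine (measure_mono hsub).trans ((measure_iUnion_le _).trans ?_)
    refine (ENNReal.tsum_le_tsum fun e => (S k).lam_Lset e).trans ?_
    have : ∀ e : ℕ, ((2:ℝ≥0∞)^(k+e+2))⁻¹ = 2⁻¹ ^ (k+2) * 2⁻¹ ^ e := by
      intro e
      rw [ENNReal.inv_pow, ← pow_add]; congr 1; omega
    simp_rw [this]
    rw [ENNReal.tsum_mul_left, ENNReal.tsum_geometric, ENNReal.one_sub_inv_two, inv_inv, pow_succ, mul_assoc,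
      ENNReal.inv_mul_cancel (by simp) (by simp), mul_one, Nat.cast_one, one_div, ENNReal.inv_pow])
  refine ⟨k, fun e he => hk ?_⟩
  obtain ⟨σ, hσ, h⟩ := Set.mem_iUnion₂.1 he
  obtain ⟨s, hs⟩ := Set.mem_iUnion.1 h
  refine (openOf_iff _ _).2 ⟨s, e, σ.length, ?_⟩
  rw [take_of_pfx hs]
  exact hσ

instance (r e n ρ) : Decidable (Qn r e n ρ) := by unfold Qn; infer_instance

def cntQ (Y : List Bool → List Bool) (r : ℕ → Option (List Bool)) (e n s : ℕ) : ℕ :=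
  ((strs s).filter (fun x => decide (Qn r e n (Y x)))).length

theorem lam_Q (Y r e n s) : lam {X | Qn r e n (Y (restr X s))} = (cntQ Y r e n s : ℝ≥0∞) / 2 ^ s :=
  lam_restr s (fun x => Qn r e n (Y x))

theorem Sys.lam_Un {Y r k} (S : Sys Y r k) (e n) : lam (Un Y r e n) = ⨆ s, (cntQ Y r e n s : ℝ≥0∞) / 2 ^ s := by
  simp_rw [← lam_Q]
  exact Monotone.measure_iUnion (fun s s' h X hX => S.Qn_up (S.Y_restr X h) hX)

theorem Sys.Q_mono {Y r k} (S : Sys Y r k) (e n) {s s'} (h : s ≤ s') :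
    (cntQ Y r e n s : ℝ≥0∞) / 2 ^ s ≤ (cntQ Y r e n s' : ℝ≥0∞) / 2 ^ s' := by
  rw [← lam_Q, ← lam_Q]
  exact measure_mono (fun X hX => S.Qn_up (S.Y_restr X h) hX)

theorem test2 {A : ℕ → Bool} (hA : TwoRandom A) {Y : List Bool → List Bool} (hY : Primrec Y) {k : ℕ}
    (S : Sys Y (rr Y k) k) (e : ℕ) : A ∉ NN Y (rr Y k) e := by
  let V : ℕ → Set (List Bool) := fun i => {x | ∃ n s1, Qn (rr Y k) e n (Y x) ∧
    (∀ n' < n, 2 ^ s1 < cntQ Y (rr Y k) e n' s1 * 2 ^ (i + 1)) ∧ ∀ s, cntQ Y (rr Y k) e n s * 2 ^ (i+1) ≤ 2 ^ s}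
  let P : ℕ → ℕ → ℕ → Bool := fun u a b => decide (Qn (rr Y k) e a.unpair.1 (Y (strOf u.unpair.2)) ∧
    (∀ n' < a.unpair.1, 2 ^ a.unpair.2 < cntQ Y (rr Y k) e n' a.unpair.2 * 2 ^ (u.unpair.1 + 1)) ∧
    cntQ Y (rr Y k) e a.unpair.1 b * 2 ^ (u.unpair.1+1) ≤ 2 ^ b)
  have cq : ∀ {α : Type} [Primcodable α] {n s : α → ℕ}, Primrec n → Primrec s → Primrec fun x => cntQ Y (rr Y k) e (n x) (s x) := by
    intro α _ n s hn hs
    refine Primrec.list_length.comp (pr_filter (strs_primrec.comp hs) ?_)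
    exact Qn_pr hY (Primrec.const k) (Primrec.const e) (hn.comp Primrec.fst) (hY.comp Primrec.snd)
  have hPp : Primrec (fun p : ℕ × ℕ × ℕ => P p.1 p.2.1 p.2.2) := by
    have pu : Primrec fun p : ℕ × ℕ × ℕ => p.1 := Primrec.fst
    have pa : Primrec fun p : ℕ × ℕ × ℕ => p.2.1 := Primrec.fst.comp Primrec.snd
    have pb : Primrec fun p : ℕ × ℕ × ℕ => p.2.2 := Primrec.snd.comp Primrec.snd
    refine PrimrecPred.decide (PrimrecPred.and ?_ (PrimrecPred.and ?_ ?_))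
    · exact Qn_pr hY (Primrec.const k) (Primrec.const e) (unpair1_pr pa) (hY.comp (strOf_pr.comp (unpair2_pr pu)))
    · refine pr_forall_lt (unpair1_pr pa) ?_
      refine Primrec.nat_lt.comp (pr_pow (unpair2_pr (pa.comp Primrec.fst))) (Primrec.nat_mul.comp ?_ (pr_pow (Primrec.succ.comp (unpair1_pr (pu.comp Primrec.fst)))))
      exact cq Primrec.snd (unpair2_pr (pa.comp Primrec.fst))
    · exact Primrec.nat_le.comp (Primrec.nat_mul.comp (cq (unpair1_pr pa) pb) (pr_pow (Primrec.succ.comp (unpair1_pr pu)))) (pr_pow pb)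
  have hup : ∀ i n, (∀ s, cntQ Y (rr Y k) e n s * 2 ^ (i+1) ≤ 2 ^ s) ↔ lam (Un Y (rr Y k) e n) ≤ ((1 : ℕ) : ℝ≥0∞) / 2 ^ (i+1) := by
    intro i n
    rw [S.lam_Un, iSup_le_iff]
    refine forall_congr' fun s => ?_
    rw [div_le_div_nat, one_mul]
  obtain ⟨i, hi⟩ := test_lemma hA V P hPp (by
    intro i x
    simp only [V, P, Set.mem_ofPred_eq, Nat.unpair_pair, strOf_encode, decide_eq_true_iff]
    constructor
    · rintro ⟨n, s1, h1, h2, h3⟩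
      refine ⟨Nat.pair n s1, fun b => ?_⟩
      simp only [Nat.unpair_pair]
      exact ⟨h1, h2, h3 b⟩
    · rintro ⟨a, h⟩
      exact ⟨a.unpair.1, a.unpair.2, (h 0).1, (h 0).2.1, fun s => (h s).2.2⟩) (by
    intro i
    by_cases hne : ∃ x, x ∈ V i
    · obtain ⟨x, n, s1, h1, h2, h3⟩ := hne
      refine le_trans (measure_mono ?_) ((hup i n).1 h3)
      intro X hX
      obtain ⟨s, n', s1', h1', h2', h3'⟩ := (openOf_iff _ _).1 hX
      have : n = n' := by
        rcases lt_trichotomy n n' with h | h | h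
        · have a := h2' n h
          have b := h3 s1'
          omega
        · exact h
        · have a := h2 n' h
          have b := h3' s1
          omega
      subst this
      exact Set.mem_iUnion.2 ⟨s, h1'⟩
    · have : openOf (V i) = ∅ := by
        ext X
        simp only [Set.mem_empty_iff_false, iff_false]
        intro hX
        obtain ⟨s, hs⟩ := (openOf_iff _ _).1 hX
        exact hne ⟨_, hs⟩
      rw [this]; simp)
  intro hN
  apply hi
  have h0 : ⨅ n, lam (Un Y (rr Y k) e n) = 0 := by
    rw [← Antitone.measure_iInter (Un_anti Y (rr Y k) e) (fun n => (meas_Un Y (rr Y k) e n).nullMeasurableSet) ⟨0, measure_ne_top _ _⟩]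
    exact S.NN_null e
  have hex : ∃ n, lam (Un Y (rr Y k) e n) ≤ ((1 : ℕ) : ℝ≥0∞) / 2 ^ (i+1) := by
    have : ⨅ n, lam (Un Y (rr Y k) e n) < ((1 : ℕ) : ℝ≥0∞) / 2 ^ (i+1) := by
      rw [h0]; simp
    obtain ⟨n, hn⟩ := iInf_lt_iff.1 this
    exact ⟨n, hn.le⟩
  classical
  obtain ⟨n, hn, hmin⟩ : ∃ n, lam (Un Y (rr Y k) e n) ≤ ((1 : ℕ) : ℝ≥0∞) / 2 ^ (i+1) ∧
      ∀ q < n, ¬ lam (Un Y (rr Y k) e q) ≤ ((1 : ℕ) : ℝ≥0∞) / 2 ^ (i+1) :=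
    ⟨Nat.find hex, Nat.find_spec hex, fun q hq => Nat.find_min hex hq⟩
  obtain ⟨s1, hs1⟩ := list_bound (fun q s => ((1 : ℕ) : ℝ≥0∞) / 2 ^ (i+1) < (cntQ Y (rr Y k) e q s : ℝ≥0∞) / 2 ^ s)
    (fun q s s' h hq => hq.trans_le (S.Q_mono e q h)) (List.range n) (by
      intro q hq
      have := hmin q (by simpa using hq)
      rw [not_le, S.lam_Un, lt_iSup_iff] at this
      exact this)
  obtain ⟨s, hs⟩ := Set.mem_iUnion.1 (Set.mem_iInter.1 hN n)
  refine (openOf_iff _ _).2 ⟨s, n, s1, hs, ?_, (hup i n).2 hn⟩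
  intro q hq
  have := hs1 q (by simpa using hq)
  rw [div_lt_div_nat, one_mul] at this
  exact this

theorem main_aux (A B : ℕ → Bool) (hA : TwoRandom A)
    (hBA : TRed B A) (hB : ¬ ComputableSeq B) :
    ∃ G : ℕ → Bool, OneGeneric G ∧ TRed G B := by
  obtain ⟨Y, hY, h1, h2, h3, h4⟩ := exists_Y A B hBA
  have S : ∀ k, Sys Y (rr Y k) k := fun k => ⟨h1, h2, fun s => rr_eq Y k s⟩
  obtain ⟨k, hk⟩ := test1 hA hY S
  exact (S k).L8 hY (str_pr hY (Primrec.const k) Primrec.list_length Primrec.id) h3 h4 hB hk (fun e => test2 hA hY (S k) e)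


end part11_block

/-- every non-zero Turing degree that is bounded by a 2-random
Turing degree bounds a 1-generic Turing degree. -/
theorem downward_density_of_oneGeneric (A B : ℕ → Bool) (hA : TwoRandom A)
    (hBA : TRed B A) (hB : ¬ ComputableSeq B) :
    ∃ G : ℕ → Bool, OneGeneric G ∧ TRed G B := by
  exact main_aux A B hA hBA hB

end TypicalDegree
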